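/- With the above hypotheses, S/J admits a bigraded free resolution 0 → P_m → P_{m−1} → ⋯ → P_n → Q_{n−1}⊕P_{n−1} → ⋯ → Q_1⊕P_1 → Q_0 → S/J → 0 over S, in which Q_k = S(−k,−k)^{⊕C(m,k)} for 0 ≤ k ≤ n−1, and P_i = ⊕_j S(−j, −(n+i−1−j))^{⊕r(i,j)} for 1 ≤ i ≤ m, where the sum is over integers j with max{0, i−(m−n+1)} ≤ j ≤ min{i−1, n−1}, and r(i,j) = C(n+i−2j−2, i−1−j)·C(n+i−1−j, j)·C(m, n+i−1−j). -/

import Mathlib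

open MvPolynomial

noncomputable section

/-- The bigraded polynomial ring `S = k[x₁,…,xₙ,y₁,…,y_p]`. -/
abbrev PolyS (k : Type) [Field k] (n p : ℕ) : Type := MvPolynomial (Fin n ⊕ Fin p) k

/-- The bigrading with `deg xᵢ = (1,0)` and `deg yⱼ = (0,1)`. -/
def bideg (n p : ℕ) : (Fin n ⊕ Fin p) → ℤ × ℤ :=
  Sum.elim (fun _ => ((1 : ℤ), (0 : ℤ))) (fun _ => ((0 : ℤ), (1 : ℤ)))

/-- The bihomogeneous component of `S` of bidegree `d`. -/
def piece (k : Type) [Field k] (n p : ℕ) (d : ℤ × ℤ) : Submodule k (PolyS k n p) :=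
  weightedHomogeneousSubmodule k (bideg n p) d

/-- The sequence `z` defined by `[z₁ … z_m] = [x₁ … xₙ]·φ`. -/
def zseq (k : Type) [Field k] (n m p : ℕ) (φ : Matrix (Fin n) (Fin m) (PolyS k n p))
    (j : Fin m) : PolyS k n p :=
  ∑ i : Fin n, X (Sum.inl i) * φ i j

/-- The ideal of `t × t` minors of a matrix. -/
def minorsIdeal {R : Type} [CommRing R] {a b : ℕ} (t : ℕ) (φ : Matrix (Fin a) (Fin b) R) :
    Ideal R :=
  Ideal.span { d : R | ∃ (r : Fin t ↪ Fin a) (c : Fin t ↪ Fin b),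
    d = (φ.submatrix r c).det }

/-- `J = (z₁,…,z_m) + Iₙ(φ)`. -/
def resJ (k : Type) [Field k] (n m p : ℕ) (φ : Matrix (Fin n) (Fin m) (PolyS k n p)) :
    Ideal (PolyS k n p) :=
  Ideal.span (Set.range (zseq k n m p φ)) ⊔ minorsIdeal n φ

/-- The height of an ideal. -/
def idealHeight {R : Type} [CommRing R] (I : Ideal R) : ℕ∞ :=
  ⨅ (P : PrimeSpectrum R) (_ : I ≤ P.asIdeal), Order.height P

/-- `grade I ≥ t`: there is a regular sequence of length `t` inside `I`. -/
def gradeGE {R : Type} [CommRing R] (I : Ideal R) (t : ℕ) : Prop :=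
  ∃ rs : List R, rs.length = t ∧ (∀ r ∈ rs, r ∈ I) ∧ RingTheory.Sequence.IsRegular R rs

/-- The ideal `(x₁,…,xₙ)` of `S`. -/
def xIdeal (k : Type) [Field k] (n p : ℕ) : Ideal (PolyS k n p) :=
  Ideal.span (Set.range fun i : Fin n => (X (Sum.inl i) : PolyS k n p))

/-- The geometric residual intersection condition: `(z)_𝔭 = (x)_𝔭` for all primes
`𝔭 ⊇ (x)` of height at most `m`. -/
def geomResCond (k : Type) [Field k] (n m p : ℕ)
    (φ : Matrix (Fin n) (Fin m) (PolyS k n p)) : Prop :=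
  ∀ P : PrimeSpectrum (PolyS k n p), xIdeal k n p ≤ P.asIdeal →
    Order.height P ≤ (m : ℕ∞) →
    Ideal.map (algebraMap (PolyS k n p) (Localization.AtPrime P.asIdeal))
        (Ideal.span (Set.range (zseq k n m p φ)))
      = Ideal.map (algebraMap (PolyS k n p) (Localization.AtPrime P.asIdeal))
          (xIdeal k n p)

/-- The multiplicity `r(i,j)`. -/
def rMult (n m i j : ℕ) : ℕ :=
  (n + i - 2 * j - 2).choose (i - 1 - j) * (n + i - 1 - j).choose j *
    m.choose (n + i - 1 - j)

/-- The predicted bigraded Betti numbers of `S/J`: `C(m,i)` in bidegree `(i,i)` for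
`0 ≤ i ≤ n-1`, and `r(i,a)` in bidegree `(a, n+i-1-a)` for `1 ≤ i ≤ m` and
`max{0, i-(m-n+1)} ≤ a ≤ min{i-1, n-1}`. -/
def bettiFormula (n m : ℕ) (i : ℕ) (d : ℤ × ℤ) : ℕ :=
  if i ≤ n - 1 ∧ d.1 = (i : ℤ) ∧ d.2 = (i : ℤ) then m.choose i
  else if 1 ≤ i ∧ i ≤ m ∧ ((i - (m - n + 1) : ℕ) : ℤ) ≤ d.1 ∧
      d.1 ≤ ((min (i - 1) (n - 1) : ℕ) : ℤ) ∧ d.2 = (n : ℤ) + (i : ℤ) - 1 - d.1 then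
    rMult n m i d.1.toNat
  else 0

/-- Index type of the free bigraded module with multiplicities `β i`. -/
def RIdx (β : ℕ → ℤ × ℤ → ℕ) (i : ℕ) : Type := { q : (ℤ × ℤ) × ℕ // q.2 < β i q.1 }

/-- The free bigraded `S`-module `⊕_{(a,b)} S(-a,-b)^{β i (a,b)}`. -/
abbrev FMod (k : Type) [Field k] (n p : ℕ) (β : ℕ → ℤ × ℤ → ℕ) (i : ℕ) : Type :=
  RIdx β i →₀ PolyS k n p

/-- `v` lies in the bigraded component of bidegree `d` of `FMod β i`
(the generator indexed by `q` sits in bidegree `q.1.1`, so its coefficient must lie in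
`S(-q.1.1)_d = S_{d - q.1.1}`). -/
def inPiece (k : Type) [Field k] (n p : ℕ) (β : ℕ → ℤ × ℤ → ℕ) (i : ℕ) (d : ℤ × ℤ)
    (v : FMod k n p β i) : Prop :=
  ∀ q : RIdx β i, v q ∈ piece k n p (d - q.1.1)

/-- The irrelevant ideal of `S`, generated by all the variables. -/
def varIdeal (k : Type) [Field k] (n p : ℕ) : Ideal (PolyS k n p) :=
  Ideal.span (Set.range (X : (Fin n ⊕ Fin p) → PolyS k n p))

/-- `β` records the shifts of a bigraded free resolution of `S/J` over `S`:
there are bidegree-preserving `S`-linear maps forming an exact sequence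
`⋯ → F_{i+1} → F_i → ⋯ → F_0 → S/J → 0` where `F_i = ⊕ S(-a,-b)^{β i (a,b)}`
(since `β i = 0` for large `i`, this is a finite resolution). -/
def IsBigradedFreeRes (k : Type) [Field k] (n p : ℕ) (J : Ideal (PolyS k n p))
    (β : ℕ → ℤ × ℤ → ℕ) : Prop :=
  ∃ (f : ∀ i : ℕ, FMod k n p β (i + 1) →ₗ[PolyS k n p] FMod k n p β i)
    (π : FMod k n p β 0 →ₗ[PolyS k n p] (PolyS k n p ⧸ J)),
    Function.Surjective π ∧ Function.Exact (f 0) π ∧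
    (∀ i, Function.Exact (f (i + 1)) (f i)) ∧
    (∀ i d v, inPiece k n p β (i + 1) d v → inPiece k n p β i d (f i v)) ∧
    (∀ d v, inPiece k n p β 0 d v →
      π v ∈ (piece k n p d).map (Ideal.Quotient.mkₐ k J).toLinearMap)

/-- `β` records the shifts of a *minimal* bigraded free resolution of `S/J` over `S`,
i.e. a bigraded free resolution whose differentials have image inside `𝔪·F` where `𝔪`
is the ideal generated by all the variables.  The multiplicities `β i (a,b)` of a
minimal bigraded free resolution are exactly the bigraded Betti numbers
`β_{i,(a,b)}(S/J) = dim_k Tor_i(S/J, k)_{(a,b)}`. -/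
def IsMinBigradedFreeRes (k : Type) [Field k] (n p : ℕ) (J : Ideal (PolyS k n p))
    (β : ℕ → ℤ × ℤ → ℕ) : Prop :=
  ∃ (f : ∀ i : ℕ, FMod k n p β (i + 1) →ₗ[PolyS k n p] FMod k n p β i)
    (π : FMod k n p β 0 →ₗ[PolyS k n p] (PolyS k n p ⧸ J)),
    Function.Surjective π ∧ Function.Exact (f 0) π ∧
    (∀ i, Function.Exact (f (i + 1)) (f i)) ∧
    (∀ i d v, inPiece k n p β (i + 1) d v → inPiece k n p β i d (f i v)) ∧
    (∀ d v, inPiece k n p β 0 d v →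
      π v ∈ (piece k n p d).map (Ideal.Quotient.mkₐ k J).toLinearMap) ∧
    (∀ i, LinearMap.range (f i) ≤
      (varIdeal k n p) • (⊤ : Submodule (PolyS k n p) (FMod k n p β i)))

namespace Residual

section Fock

variable {R : Type*} [CommRing R] {n m : ℕ}

/-- Indices of the exterior variables: `n` of type `w` and `m` of type `e`. -/
abbrev Ferm (n m : ℕ) : Type := Fin n ⊕ Fin m

/-- The ambient module: divided powers in `n` variables tensored with an exterior algebra. -/
abbrev Full (R : Type*) (n m : ℕ) : Type _ := (Fin n → ℕ) → Finset (Ferm n m) → R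

/-- The ring of endomorphisms of the ambient module. -/
def Op (R : Type*) [CommRing R] (n m : ℕ) : Type _ := Module.End R (Full R n m)

namespace Op

/-- A linear map as an operator. -/
def of (A : Full R n m →ₗ[R] Full R n m) : Op R n m := A

instance : Ring (Op R n m) := inferInstanceAs (Ring (Module.End R (Full R n m)))
instance : Algebra R (Op R n m) := inferInstanceAs (Algebra R (Module.End R (Full R n m)))
instance : FunLike (Op R n m) (Full R n m) (Full R n m) :=
  inferInstanceAs (FunLike (Full R n m →ₗ[R] Full R n m) (Full R n m) (Full R n m))
instance : LinearMapClass (Op R n m) R (Full R n m) (Full R n m) :=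
  inferInstanceAs (LinearMapClass (Full R n m →ₗ[R] Full R n m) R (Full R n m) (Full R n m))

@[ext] lemma ext {A B : Op R n m} (h : ∀ f a I, A f a I = B f a I) : A = B :=
  DFunLike.ext A B fun f => funext fun a => funext fun I => h f a I

@[simp] lemma of_apply (A : Full R n m →ₗ[R] Full R n m) (f) : of A f = A f := rfl
@[simp] lemma mul_apply (A B : Op R n m) (f) : (A * B) f = A (B f) := rfl
@[simp] lemma one_apply (f : Full R n m) : (1 : Op R n m) f = f := rfl
@[simp] lemma zero_apply (f : Full R n m) : (0 : Op R n m) f = 0 := rfl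
@[simp] lemma add_apply (A B : Op R n m) (f) : (A + B) f = A f + B f := rfl
@[simp] lemma sub_apply (A B : Op R n m) (f) : (A - B) f = A f - B f := rfl
@[simp] lemma neg_apply (A : Op R n m) (f) : (- A) f = - A f := rfl
@[simp] lemma smul_apply (r : R) (A : Op R n m) (f) : (r • A) f = r • A f := rfl
@[simp] lemma sum_apply {κ : Type*} (s : Finset κ) (A : κ → Op R n m) (f) :
    (∑ i ∈ s, A i) f = ∑ i ∈ s, A i f :=
  LinearMap.sum_apply (M := Full R n m) (M₂ := Full R n m) s A f

end Op

/-- The position of an exterior variable in the chosen total order. -/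
def rk (i : Ferm n m) : ℕ := Sum.elim (fun i : Fin n => (i : ℕ)) (fun g : Fin m => n + g) i

lemma rk_injective : Function.Injective (rk : Ferm n m → ℕ) := by
  rintro (i | i) (j | j) h <;> simp [rk] at h ⊢ <;> omega

/-- The sign of moving the variable `i` into its place among those of `I`. -/
def sg (R : Type*) [CommRing R] (i : Ferm n m) (I : Finset (Ferm n m)) : R :=
  (-1) ^ (I.filter fun k => rk k < rk i).card

lemma sg_mul_self (i : Ferm n m) (I : Finset (Ferm n m)) : sg R i I * sg R i I = 1 := by
  rw [sg, ← mul_pow]; simp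

lemma sg_insert {i j : Ferm n m} {I : Finset (Ferm n m)} (hj : j ∉ I) :
    sg R i (insert j I) = if rk j < rk i then - sg R i I else sg R i I := by
  unfold sg
  rw [Finset.filter_insert]
  split_ifs with h
  · rw [Finset.card_insert_of_notMem (by simp [hj]), pow_succ]; ring
  · rfl

lemma sg_erase_self (i : Ferm n m) (I : Finset (Ferm n m)) : sg R i (I.erase i) = sg R i I := by
  by_cases h : i ∈ I
  · conv_rhs => rw [← Finset.insert_erase h]
    rw [sg_insert (by simp)]; simp
  · rw [Finset.erase_eq_of_notMem h]

/-- Exterior multiplication by a variable. -/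
def cr (i : Ferm n m) : Op R n m := Op.of <|
  { toFun f a I := if i ∈ I then sg R i I * f a (I.erase i) else 0
    map_add' f g := by ext a I; simp only [Pi.add_apply]; split_ifs <;> ring
    map_smul' r f := by
      ext a I; simp only [Pi.smul_apply, smul_eq_mul, RingHom.id_apply]; split_ifs <;> ring }

/-- Contraction by a variable. -/
def an (i : Ferm n m) : Op R n m := Op.of <|
  { toFun f a I := if i ∈ I then 0 else sg R i I * f a (insert i I)
    map_add' f g := by ext a I; simp only [Pi.add_apply]; split_ifs <;> ring
    map_smul' r f := by
      ext a I; simp only [Pi.smul_apply, smul_eq_mul, RingHom.id_apply]; split_ifs <;> ring }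

lemma cr_apply (i : Ferm n m) (f : Full R n m) (a I) :
    cr i f a I = if i ∈ I then sg R i I * f a (I.erase i) else 0 := rfl

lemma an_apply (i : Ferm n m) (f : Full R n m) (a I) :
    an i f a I = if i ∈ I then 0 else sg R i I * f a (insert i I) := rfl

/-- The anticommutator. -/
def acm {E : Type*} [Ring E] (A B : E) : E := A * B + B * A

lemma acm_cr_cr (i j : Ferm n m) : acm (cr i : Op R n m) (cr j) = 0 := by
  ext f a I
  simp only [acm, Op.add_apply, Op.mul_apply, cr_apply, Pi.add_apply,
    Op.zero_apply, Pi.zero_apply]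
  by_cases hij : i = j
  · subst hij; simp
  by_cases hi : i ∈ I <;> by_cases hj : j ∈ I <;> simp [hi, hj, hij, Ne.symm hij]
  have h1 : sg R i I = if rk j < rk i then - sg R i (I.erase j) else sg R i (I.erase j) := by
    conv_lhs => rw [← Finset.insert_erase hj]
    rw [sg_insert (by simp)]
  have h2 : sg R j I = if rk i < rk j then - sg R j (I.erase i) else sg R j (I.erase i) := by
    conv_lhs => rw [← Finset.insert_erase hi]
    rw [sg_insert (by simp)]
  rw [h1, h2, Finset.erase_right_comm]
  have := rk_injective.ne hij
  rcases lt_or_gt_of_ne this with h | h <;> simp [h, h.not_gt] <;> ring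

lemma acm_an_an (i j : Ferm n m) : acm (an i : Op R n m) (an j) = 0 := by
  ext f a I
  simp only [acm, Op.add_apply, Op.mul_apply, an_apply, Pi.add_apply,
    Op.zero_apply, Pi.zero_apply]
  by_cases hij : i = j
  · subst hij; simp
  by_cases hi : i ∈ I <;> by_cases hj : j ∈ I <;> simp [hi, hj, hij, Ne.symm hij]
  rw [sg_insert hi, sg_insert hj, Finset.insert_comm]
  have := rk_injective.ne hij
  rcases lt_or_gt_of_ne this with h | h <;> simp [h, h.not_gt] <;> ring

lemma acm_an_cr (i j : Ferm n m) : acm (an i : Op R n m) (cr j) = if i = j then 1 else 0 := by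
  ext f a I
  simp only [acm, Op.add_apply, Op.mul_apply, an_apply, cr_apply, Pi.add_apply]
  by_cases hij : i = j
  · subst hij
    by_cases hi : i ∈ I
    · simp [hi, Finset.insert_erase, sg_erase_self, ← mul_assoc, sg_mul_self]
    · simp [hi, sg_insert, ← mul_assoc, sg_mul_self]
  by_cases hi : i ∈ I <;> by_cases hj : j ∈ I <;> simp [hi, hj, hij, Ne.symm hij]
  have h1 : sg R i I = if rk j < rk i then - sg R i (I.erase j) else sg R i (I.erase j) := by
    conv_lhs => rw [← Finset.insert_erase hj]
    rw [sg_insert (by simp)]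
  rw [h1, sg_insert hi, Finset.erase_insert_of_ne hij]
  have := rk_injective.ne hij
  rcases lt_or_gt_of_ne this with h | h <;> simp [h, h.not_gt] <;> ring

section acm

variable {E : Type*} [Ring E] [Algebra R E]

lemma acm_comm (A B : E) : acm A B = acm B A := by unfold acm; abel
lemma acm_add_left (A B C : E) : acm (A + B) C = acm A C + acm B C := by
  unfold acm; noncomm_ring
lemma acm_add_right (A B C : E) : acm A (B + C) = acm A B + acm A C := by
  unfold acm; noncomm_ring
lemma acm_sub_right (A B C : E) : acm A (B - C) = acm A B - acm A C := by
  unfold acm; noncomm_ring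
lemma acm_smul_left (r : R) (A B : E) : acm (r • A) B = r • acm A B := by simp [acm]
lemma acm_smul_right (r : R) (A B : E) : acm A (r • B) = r • acm A B := by simp [acm]
lemma acm_sum_left {κ : Type*} (s : Finset κ) (A : κ → E) (B : E) :
    acm (∑ i ∈ s, A i) B = ∑ i ∈ s, acm (A i) B := by
  simp [acm, Finset.sum_mul, Finset.mul_sum, Finset.sum_add_distrib]
lemma acm_sum_right {κ : Type*} (s : Finset κ) (A : κ → E) (B : E) :
    acm B (∑ i ∈ s, A i) = ∑ i ∈ s, acm B (A i) := by
  simp [acm, Finset.sum_mul, Finset.mul_sum, Finset.sum_add_distrib]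

lemma acm_mul_mul {Y Z A B : E} (h1 : Commute Y Z) (h2 : Commute Y B) (h3 : Commute Z A) :
    acm (Y * A) (Z * B) = Y * Z * acm A B := by
  unfold acm
  have e1 : Y * A * (Z * B) = Y * Z * (A * B) := by
    rw [mul_assoc, ← mul_assoc A, ← h3.eq]; simp only [mul_assoc]
  have e2 : Z * B * (Y * A) = Y * Z * (B * A) := by
    rw [mul_assoc, ← mul_assoc B, ← h2.eq, h1.eq]; simp only [mul_assoc]
  rw [e1, e2, mul_add]

end acm

/-- The shift operator lowering the `i`-th exponent. -/
def sh (i : Fin n) : Op R n m := Op.of <|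
  { toFun f a := f (Function.update a i (a i + 1))
    map_add' _ _ := rfl
    map_smul' _ _ := rfl }

lemma sh_apply (i : Fin n) (f : Full R n m) (a) :
    sh i f a = f (Function.update a i (a i + 1)) := rfl

/-- A right inverse of `sh i + c`. -/
def ri (c : R) (i : Fin n) : Op R n m := Op.of <|
  { toFun f a := ∑ t ∈ Finset.range (a i), (-c) ^ (a i - 1 - t) • f (Function.update a i t)
    map_add' f g := by ext; simp [Finset.sum_add_distrib]
    map_smul' r f := by
      ext; simp only [Pi.smul_apply, Finset.smul_sum, RingHom.id_apply, Finset.sum_apply]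
      exact Finset.sum_congr rfl fun _ _ => smul_comm _ _ _ }

lemma ri_apply (c : R) (i : Fin n) (f : Full R n m) (a) :
    ri c i f a = ∑ t ∈ Finset.range (a i), (-c) ^ (a i - 1 - t) • f (Function.update a i t) := rfl

/-- The idempotent complementary to `ri c i * (sh i + c)`. -/
def pr (c : R) (i : Fin n) : Op R n m := Op.of <|
  { toFun f a := (-c) ^ (a i) • f (Function.update a i 0)
    map_add' f g := by ext; simp [mul_add]
    map_smul' r f := by ext; simp; ring }

lemma pr_apply (c : R) (i : Fin n) (f : Full R n m) (a) :
    pr c i f a = (-c) ^ (a i) • f (Function.update a i 0) := rfl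

lemma sh_mul_ri (c : R) (i : Fin n) : (sh i + c • 1 : Op R n m) * ri c i = 1 := by
  ext f a I
  simp only [Op.mul_apply, Op.add_apply, Op.smul_apply, Op.one_apply,
    sh_apply, ri_apply, Pi.add_apply, Pi.smul_apply, Finset.sum_apply, smul_eq_mul,
    Function.update_self, Function.update_idem, Finset.sum_range_succ, Nat.add_sub_cancel,
    Function.update_eq_self, Nat.sub_self, pow_zero, one_mul, Finset.mul_sum]
  have : ∀ t ∈ Finset.range (a i), (-c) ^ (a i - t) * f (Function.update a i t) I =
      - (c * ((-c) ^ (a i - 1 - t) * f (Function.update a i t) I)) := by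
    intro t ht
    have ht := Finset.mem_range.1 ht
    obtain ⟨s, hs⟩ : ∃ s, a i - t = s + 1 := ⟨a i - 1 - t, by omega⟩
    rw [hs, show a i - 1 - t = s by omega]; ring
  rw [Finset.sum_congr rfl this, Finset.sum_neg_distrib]; ring

lemma one_sub_ri_mul (c : R) (i : Fin n) :
    (1 : Op R n m) - ri c i * (sh i + c • 1) = pr c i := by
  ext f a I
  simp only [Op.mul_apply, Op.add_apply, Op.sub_apply, Op.smul_apply,
    Op.one_apply, sh_apply, ri_apply, pr_apply, Pi.add_apply, Pi.sub_apply, Pi.smul_apply,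
    Finset.sum_apply, smul_eq_mul, Function.update_self, Function.update_idem]
  have key : ∀ s : ℕ, ∑ t ∈ Finset.range s, (-c) ^ (s - 1 - t) *
      (f (Function.update a i (t + 1)) I + c * f (Function.update a i t) I) =
      f (Function.update a i s) I - (-c) ^ s * f (Function.update a i 0) I := by
    intro s
    induction s with
    | zero => simp
    | succ s ih =>
      have : ∀ t ∈ Finset.range s, (-c) ^ (s + 1 - 1 - t) *
          (f (Function.update a i (t + 1)) I + c * f (Function.update a i t) I) =
          (-c) * ((-c) ^ (s - 1 - t) *
          (f (Function.update a i (t + 1)) I + c * f (Function.update a i t) I)) := by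
        intro t ht
        have ht := Finset.mem_range.1 ht
        obtain ⟨r, hr⟩ : ∃ r, s - t = r + 1 := ⟨s - 1 - t, by omega⟩
        rw [Nat.add_sub_cancel, hr, show s - 1 - t = r by omega]; ring
      rw [Finset.sum_range_succ, Finset.sum_congr rfl this, ← Finset.mul_sum, ih]
      simp; ring
  rw [key, Function.update_eq_self]; ring

lemma sh_commute_sh (i j : Fin n) : Commute (sh i : Op R n m) (sh j) := by
  ext f a I
  simp only [Op.mul_apply, sh_apply]
  by_cases h : i = j
  · subst h; rfl
  · simp [Function.update_of_ne h, Function.update_of_ne (Ne.symm h), Function.update_comm h]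

lemma sh_commute_ri (c : R) {i j : Fin n} (h : j ≠ i) : Commute (sh j : Op R n m) (ri c i) := by
  ext f a I
  simp [Op.mul_apply, sh_apply, ri_apply, Function.update_of_ne h,
    Function.update_of_ne h.symm, Function.update_comm h]

lemma sh_commute_pr (c : R) {i j : Fin n} (h : j ≠ i) : Commute (sh j : Op R n m) (pr c i) := by
  ext f a I
  simp [Op.mul_apply, sh_apply, pr_apply, Function.update_of_ne h,
    Function.update_of_ne h.symm, Function.update_comm h]

lemma sh_commute_cr (i : Fin n) (j) : Commute (sh i : Op R n m) (cr j) := by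
  ext f a I; simp [Op.mul_apply, sh_apply, cr_apply]

lemma sh_commute_an (i : Fin n) (j) : Commute (sh i : Op R n m) (an j) := by
  ext f a I; simp [Op.mul_apply, sh_apply, an_apply]

lemma ri_commute_cr (c : R) (i : Fin n) (j) : Commute (ri c i : Op R n m) (cr j) := by
  ext f a I
  simp only [Op.mul_apply, ri_apply, cr_apply, Finset.sum_apply, Pi.smul_apply]
  split_ifs
  · simp [Finset.mul_sum]; exact Finset.sum_congr rfl fun _ _ => by ring
  · simp

lemma ri_commute_an (c : R) (i : Fin n) (j) : Commute (ri c i : Op R n m) (an j) := by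
  ext f a I
  simp only [Op.mul_apply, ri_apply, an_apply, Finset.sum_apply, Pi.smul_apply]
  split_ifs
  · simp
  · simp [Finset.mul_sum]; exact Finset.sum_congr rfl fun _ _ => by ring

lemma pr_commute_cr (c : R) (i : Fin n) (j) : Commute (pr c i : Op R n m) (cr j) := by
  ext f a I
  simp only [Op.mul_apply, pr_apply, cr_apply, Pi.smul_apply]
  split_ifs <;> simp; ring

lemma pr_commute_an (c : R) (i : Fin n) (j) : Commute (pr c i : Op R n m) (an j) := by
  ext f a I
  simp only [Op.mul_apply, pr_apply, an_apply, Pi.smul_apply]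
  split_ifs <;> simp; ring

end Fock

section Homotopy

variable {E : Type*} [Ring E] {ι : Type*}

/-- The homotopy assembled from one-variable homotopies `s i`. -/
def asm (c : E) (s q : ι → E) : List ι → E
  | [] => 0
  | i :: l => c ^ l.length * s i + q i * asm c s q l

lemma commute_of_acm {d s c q : E} (hd : d * d = 0) (hc : Commute d c) (h : acm d s = c - q) :
    Commute d q := by
  have hq : q = c - acm d s := by rw [h]; abel
  rw [hq]
  refine hc.sub_right ?_
  change d * acm d s = acm d s * d
  simp only [acm, mul_add, add_mul]
  rw [← mul_assoc, hd, mul_assoc s, hd]; simp [mul_assoc]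

lemma acm_asm {d c : E} {s q : ι → E} (hd : d * d = 0) (hc : ∀ e : E, Commute c e)
    (h : ∀ i, acm d (s i) = c - q i) (l : List ι) :
    acm d (asm c s q l) = c ^ l.length - (l.map q).prod := by
  induction l with
  | nil => simp [asm, acm]
  | cons i l ih =>
    have hq := commute_of_acm hd (hc d).symm (h i)
    have hcl := ((hc d).pow_left l.length)
    have e1 : acm d (c ^ l.length * s i) = c ^ l.length * acm d (s i) := by
      simp only [acm, mul_add]
      rw [← mul_assoc, ← hcl.eq]; simp only [mul_assoc]
    have e2 : acm d (q i * asm c s q l) = q i * acm d (asm c s q l) := by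
      simp only [acm, mul_add]
      rw [← mul_assoc, hq.eq]; simp only [mul_assoc]
    simp only [asm, acm_add_right, e1, e2, ih, h, List.map_cons, List.prod_cons, List.length_cons]
    rw [mul_sub, mul_sub, ← pow_succ, ((hc (q i)).pow_left l.length).eq]; abel

lemma mul_asm_eq_zero {p c : E} {s q : ι → E} (hc : ∀ e : E, Commute c e)
    (hs : ∀ i, p * s i = 0) (hq : ∀ i, ∃ e, p * q i = e * p) (l : List ι) :
    p * asm c s q l = 0 := by
  induction l with
  | nil => simp [asm]
  | cons i l ih =>
    obtain ⟨e, he⟩ := hq i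
    rw [asm, mul_add, ← mul_assoc, ← ((hc p).pow_left l.length).eq, mul_assoc, hs, ← mul_assoc, he,
      mul_assoc, ih]
    simp

lemma acm_single {Y τ a c : ι → E} {r d0 : E} [Fintype ι] (i : ι)
    (h1 : Y i * τ i = 1) (h2 : ∀ j, j ≠ i → Commute (Y j) (τ i))
    (hYc : ∀ j, Commute (Y j) (c i)) (hτa : ∀ j, Commute (τ i) (a j))
    (hac : ∀ j, j ≠ i → acm (a j) (c i) = 0) (hac' : acm (a i) (c i) = r)
    (h0 : acm d0 (τ i * c i) = 0) :
    acm (∑ j, Y j * a j + d0) (τ i * c i) = r - (1 - τ i * Y i) * (c i * a i) := by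
  classical
  rw [acm_add_left, h0, add_zero, acm_sum_left, Finset.sum_eq_single i]
  · simp only [acm] at hac' ⊢
    have e1 : Y i * a i * (τ i * c i) = a i * c i := by
      rw [mul_assoc, ← mul_assoc (a i), ← (hτa i).eq, mul_assoc, ← mul_assoc, h1, one_mul]
    have e2 : τ i * c i * (Y i * a i) = τ i * Y i * (c i * a i) := by
      rw [mul_assoc, ← mul_assoc (c i), ← (hYc i).eq]; simp only [mul_assoc]
    rw [e1, e2, ← hac']; noncomm_ring
  · intro j _ hj
    rw [acm_mul_mul (h2 j hj) (hYc j) (hτa j), hac j hj, mul_zero]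
  · simp

lemma prod_map_mul_of_commute {ρ b : ι → E} (h : ∀ i j, Commute (ρ i) (b j)) (l : List ι) :
    (l.map fun i => ρ i * b i).prod = (l.map ρ).prod * (l.map b).prod := by
  induction l with
  | nil => simp
  | cons i l ih =>
    simp only [List.map_cons, List.prod_cons, ih]
    have : Commute (l.map ρ).prod (b i) :=
      Commute.list_prod_left _ _ (by simpa using fun j _ => h j i)
    rw [mul_assoc, ← mul_assoc (b i), ← this.eq]; simp only [mul_assoc]

lemma mul_prod_of_acm {a : E} {c : ι → E} {l : List ι} (h : ∀ j ∈ l, acm a (c j) = 0) :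
    a * (l.map c).prod = (-1) ^ l.length * ((l.map c).prod * a) := by
  induction l with
  | nil => simp
  | cons j l ih =>
    have hj : a * c j = - (c j * a) := by
      have := h j (by simp); rw [acm] at this; exact eq_neg_of_add_eq_zero_left this
    simp only [List.map_cons, List.prod_cons, List.length_cons]
    rw [← mul_assoc, hj, neg_mul, mul_assoc, ih fun k hk => h k (by simp [hk]), pow_succ]
    have := ((Commute.neg_one_right (c j)).pow_right l.length)
    rw [← mul_assoc (c j), this.eq]; noncomm_ring

lemma prod_mul_eq_sign {a c : ι → E} {l : List ι} (hl : l.Nodup)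
    (h : ∀ i j, i ≠ j → acm (a i) (c j) = 0) :
    ∃ k : ℕ, (l.map fun i => c i * a i).prod = (-1) ^ k * ((l.map c).prod * (l.map a).prod) := by
  induction l with
  | nil => exact ⟨0, by simp⟩
  | cons i l ih =>
    obtain ⟨k, hk⟩ := ih hl.of_cons
    have hi := (List.nodup_cons.1 hl).1
    refine ⟨k + l.length, ?_⟩
    simp only [List.map_cons, List.prod_cons, hk]
    have e := mul_prod_of_acm (a := a i) (c := c) (l := l) fun j hj =>
      h i j fun e => hi (e ▸ hj)
    have s1 : ∀ (k : ℕ) (x : E), Commute ((-1 : E) ^ k) x := fun k x =>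
      (Commute.neg_one_left x).pow_left k
    calc c i * a i * ((-1) ^ k * ((l.map c).prod * (l.map a).prod))
        = (-1) ^ k * (c i * (a i * (l.map c).prod) * (l.map a).prod) := by
          rw [← mul_assoc, ← (s1 k _).eq]; simp only [mul_assoc]
      _ = _ := by
          rw [e, ← mul_assoc (c i), ← (s1 _ (c i)).eq, pow_add]; simp only [mul_assoc]

end Homotopy

section Squares

variable {R : Type*} [CommRing R] {E : Type*} [Ring E] [Algebra R E]

lemma sq_sum {κ : Type*} (s : Finset κ) (A : κ → E) (h : ∀ i, A i * A i = 0)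
    (h' : ∀ i j, acm (A i) (A j) = 0) : (∑ i ∈ s, A i) * (∑ i ∈ s, A i) = 0 := by
  classical
  induction s using Finset.induction_on with
  | empty => simp
  | insert i s hi ih =>
    rw [Finset.sum_insert hi]
    have : acm (A i) (∑ i ∈ s, A i) = 0 := by simp [acm_sum_right, h']
    rw [acm] at this
    rw [add_mul, mul_add, mul_add, h, ih, zero_add, add_zero, this]

lemma acm_mul_left {Z A B : E} (h : Commute Z B) : acm (Z * A) B = Z * acm A B := by
  have := acm_mul_mul (Z := 1) (A := A) (Commute.one_right Z) h (Commute.one_left A)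
  simpa using this

lemma acm_mul_right {Z A B : E} (h : Commute Z A) : acm A (Z * B) = Z * acm A B := by
  have := acm_mul_mul (Y := 1) (B := B) (Commute.one_left Z) (Commute.one_left B) h
  simpa using this

lemma commute_mul_of_acm {A B C : E} (h : acm A B = 0) (h' : acm A C = 0) :
    Commute A (B * C) := by
  have e1 := eq_neg_of_add_eq_zero_left h
  have e2 := eq_neg_of_add_eq_zero_left h'
  change A * (B * C) = B * C * A
  rw [← mul_assoc, e1, neg_mul, mul_assoc, e2, mul_neg, neg_neg, mul_assoc]

end Squares

section Operators

variable {R : Type*} [CommRing R] {n m : ℕ} (x : Fin n → R) (φ : Matrix (Fin n) (Fin m) R)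

lemma an_sq (i : Ferm n m) : (an i : Op R n m) * an i = 0 := by
  ext f a I; simp [an_apply]

lemma cr_sq (i : Ferm n m) : (cr i : Op R n m) * cr i = 0 := by
  ext f a I; simp [cr_apply]

/-- Contraction by the `i`-th row of the matrix. -/
def dphi (i : Fin n) : Op R n m := ∑ g, φ i g • an (Sum.inr g)

/-- Contraction by `w i` plus the `i`-th row of the matrix. -/
def pw (i : Fin n) : Op R n m := an (Sum.inl i) + dphi φ i

/-- The differential of the symmetric power strands. -/
def theta : Op R n m := ∑ i, sh i * an (Sum.inl i)

/-- The Koszul differential in the `w` variables. -/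
def dx : Op R n m := ∑ i, x i • an (Sum.inl i)

/-- The Eagon–Northcott differential. -/
def dF : Op R n m := ∑ i, sh i * dphi φ i

/-- The Koszul differential of the sequence `x · φ`. -/
def dz : Op R n m := ∑ i, x i • dphi φ i

/-- The part of the total differential that preserves the level. -/
def delta : Op R n m := dx x + dF φ

/-- The total differential. -/
def dtot : Op R n m := theta + delta x φ

/-- The idempotent with image the elements killed by all `w i`. -/
def Q : Op R n m := ((List.finRange n).map fun i => cr (Sum.inl i) * pw φ i).prod

/-- The product of the operators `pr (x i) i`. -/
def prAll : Op R n m := ((List.finRange n).map fun i => pr (x i) i).prod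

/-- The connecting map from the symmetric strand to the Koszul strand. -/
def mu : Op R n m := Q φ * prAll (fun _ => 0)

lemma acm_an_dphi (k : Ferm n m) (i : Fin n) : acm (an k) (dphi φ i) = 0 := by
  simp [dphi, acm_sum_right, acm_smul_right, acm_an_an]

lemma acm_dphi_dphi (i j : Fin n) : acm (dphi φ i) (dphi φ j) = 0 := by
  conv_lhs => arg 1; rw [dphi]
  simp [acm_sum_left, acm_smul_left, acm_an_dphi]

lemma dphi_sq (i : Fin n) : dphi φ i * dphi φ i = 0 := by
  refine sq_sum _ _ (fun g => ?_) fun g g' => ?_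
  · simp [an_sq]
  · simp [acm_smul_left, acm_smul_right, acm_an_an]

lemma acm_dphi_w (i j : Fin n) : acm (dphi φ i) (cr (Sum.inl j)) = 0 := by
  simp [dphi, acm_sum_left, acm_smul_left, acm_an_cr]

lemma acm_dphi_e (i : Fin n) (g : Fin m) : acm (dphi φ i) (cr (Sum.inr g)) = φ i g • 1 := by
  simp only [dphi, acm_sum_left, acm_smul_left, acm_an_cr, Sum.inr.injEq, smul_ite, smul_zero]
  simp

lemma sh_commute_dphi (i j : Fin n) : Commute (sh i) (dphi φ j) :=
  Commute.sum_right _ _ _ fun _ _ => (sh_commute_an _ _).smul_right _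

lemma ri_commute_dphi (c : R) (i j : Fin n) : Commute (ri c i) (dphi φ j) :=
  Commute.sum_right _ _ _ fun _ _ => (ri_commute_an _ _ _).smul_right _

lemma pr_commute_dphi (c : R) (i j : Fin n) : Commute (pr c i) (dphi φ j) :=
  Commute.sum_right _ _ _ fun _ _ => (pr_commute_an _ _ _).smul_right _

lemma sh_commute_pw (i j : Fin n) : Commute (sh i) (pw φ j) :=
  (sh_commute_an _ _).add_right (sh_commute_dphi _ _ _)

lemma ri_commute_pw (c : R) (i j : Fin n) : Commute (ri c i) (pw φ j) :=
  (ri_commute_an _ _ _).add_right (ri_commute_dphi _ _ _ _)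

lemma pr_commute_pw (c : R) (i j : Fin n) : Commute (pr c i) (pw φ j) :=
  (pr_commute_an _ _ _).add_right (pr_commute_dphi _ _ _ _)

lemma acm_pw_w (i j : Fin n) :
    acm (pw φ i) (cr (Sum.inl j)) = if i = j then 1 else 0 := by
  simp [pw, acm_add_left, acm_dphi_w, acm_an_cr]

lemma acm_pw_e (i : Fin n) (g : Fin m) : acm (pw φ i) (cr (Sum.inr g)) = φ i g • 1 := by
  simp [pw, acm_add_left, acm_dphi_e, acm_an_cr]

lemma acm_dphi_pw (i j : Fin n) : acm (dphi φ i) (pw φ j) = 0 := by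
  rw [pw, acm_add_right, acm_comm, acm_an_dphi, acm_dphi_dphi, add_zero]

lemma acm_pw_pw (i j : Fin n) : acm (pw φ i) (pw φ j) = 0 := by
  conv_lhs => arg 1; rw [pw]
  rw [acm_add_left, acm_dphi_pw, pw, acm_add_right, acm_an_an, acm_an_dphi]; simp

lemma pw_sq (i : Fin n) : pw φ i * pw φ i = 0 := by
  have := acm_an_dphi φ (Sum.inl i) i
  rw [acm] at this
  rw [pw, add_mul, mul_add, mul_add, an_sq, dphi_sq, zero_add, add_zero, this]

lemma theta_sq : (theta : Op R n m) * theta = 0 := by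
  refine sq_sum _ _ (fun i => ?_) fun i j => ?_
  · rw [mul_assoc, ← mul_assoc (an _), ← (sh_commute_an i _).eq, mul_assoc, an_sq]; simp
  · rw [acm_mul_mul (sh_commute_sh _ _) (sh_commute_an _ _) (sh_commute_an _ _), acm_an_an,
      mul_zero]

lemma dx_sq : (dx x : Op R n m) * dx x = 0 := by
  refine sq_sum _ _ (fun i => ?_) fun i j => ?_
  · simp [an_sq]
  · simp [acm_smul_left, acm_smul_right, acm_an_an]

lemma dz_sq : (dz x φ : Op R n m) * dz x φ = 0 := by
  refine sq_sum _ _ (fun i => ?_) fun i j => ?_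
  · simp [dphi_sq]
  · simp [acm_smul_left, acm_smul_right, acm_dphi_dphi]

lemma dF_sq : dF φ * dF φ = 0 := by
  refine sq_sum _ _ (fun i => ?_) fun i j => ?_
  · rw [mul_assoc, ← mul_assoc (dphi _ _), ← (sh_commute_dphi φ i _).eq, mul_assoc, dphi_sq]; simp
  · rw [acm_mul_mul (sh_commute_sh _ _) (sh_commute_dphi _ _ _) (sh_commute_dphi _ _ _),
      acm_dphi_dphi, mul_zero]

lemma acm_theta_dx : acm (theta : Op R n m) (dx x) = 0 := by
  simp [theta, dx, acm_sum_left, acm_sum_right, acm_smul_right, acm_mul_left (sh_commute_an _ _),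
    acm_an_an]

lemma acm_theta_dF : acm theta (dF φ) = 0 := by
  simp [theta, dF, acm_sum_left, acm_sum_right, acm_an_dphi,
    acm_mul_mul (sh_commute_sh _ _) (sh_commute_dphi _ _ _) (sh_commute_an _ _)]

lemma acm_dx_dF : acm (dx x) (dF φ) = 0 := by
  simp [dx, dF, acm_sum_left, acm_sum_right, acm_smul_left, acm_mul_right (sh_commute_an _ _),
    acm_an_dphi]

lemma acm_theta_delta : acm theta (delta x φ) = 0 := by
  rw [delta, acm_add_right, acm_theta_dx, acm_theta_dF, add_zero]

lemma delta_sq : delta x φ * delta x φ = 0 := by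
  have := acm_dx_dF x φ
  rw [acm] at this
  rw [delta, add_mul, mul_add, mul_add, dx_sq, dF_sq, zero_add, add_zero, this]

lemma dtot_sq : dtot x φ * dtot x φ = 0 := by
  have := acm_theta_delta x φ
  rw [acm] at this
  rw [dtot, add_mul, mul_add, mul_add, theta_sq, delta_sq, zero_add, add_zero, this]

lemma sh_commute_Q (i : Fin n) : Commute (sh i) (Q φ) :=
  Commute.list_prod_right _ _ (by
    simpa using fun j => (sh_commute_cr _ _).mul_right (sh_commute_pw _ _ _))

lemma pr_commute_Q (c : R) (i : Fin n) : Commute (pr c i) (Q φ) :=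
  Commute.list_prod_right _ _ (by
    simpa using fun j => (pr_commute_cr _ _ _).mul_right (pr_commute_pw _ _ _ _))

lemma prAll_commute_Q : Commute (prAll x) (Q φ) :=
  Commute.list_prod_left _ _ (by simpa using fun j => pr_commute_Q _ _ _)

lemma prAll_commute_an (k : Ferm n m) : Commute (prAll x) (an k) :=
  Commute.list_prod_left _ _ (by simpa using fun j => pr_commute_an _ _ _)

lemma prAll_commute_cr (k : Ferm n m) : Commute (prAll x) (cr k) :=
  Commute.list_prod_left _ _ (by simpa using fun j => pr_commute_cr _ _ _)

lemma prAll_commute_dphi (y : Fin n → R) (i : Fin n) : Commute (prAll y) (dphi φ i) :=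
  Commute.sum_right _ _ _ fun _ _ => (prAll_commute_an _ _).smul_right _

lemma prAll_commute_dz (y : Fin n → R) : Commute (prAll y) (dz x φ) :=
  Commute.sum_right _ _ _ fun _ _ => (prAll_commute_dphi _ _ _).smul_right _

lemma acm_dz_w (i : Fin n) : acm (dz x φ) (cr (Sum.inl i)) = 0 := by
  simp [dz, acm_sum_left, acm_smul_left, acm_dphi_w]

lemma acm_dz_pw (i : Fin n) : acm (dz x φ) (pw φ i) = 0 := by
  simp [dz, acm_sum_left, acm_smul_left, acm_dphi_pw]

lemma dz_commute_Q : Commute (dz x φ) (Q φ) :=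
  Commute.list_prod_right _ _ (by
    simpa using fun j => commute_mul_of_acm (acm_dz_w _ _ _) (acm_dz_pw _ _ _))

lemma Q_mul_pw (i : Fin n) : Q φ * pw φ i = 0 := by
  have key : ∀ l : List (Fin n), i ∈ l → l.Nodup →
      (l.map fun i => cr (Sum.inl i) * pw φ i).prod * pw φ i = 0 := by
    intro l
    induction l with
    | nil => simp
    | cons j l ih =>
      intro hi hl
      rw [List.nodup_cons] at hl
      rw [List.map_cons, List.prod_cons, mul_assoc]
      by_cases h : i ∈ l
      · rw [ih h hl.2, mul_zero]
      · have : i = j := by simpa [h] using hi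
        subst this
        have : Commute (pw φ i) (l.map fun i => cr (Sum.inl i) * pw φ i).prod := by
          refine Commute.list_prod_right _ _ ?_
          simp only [List.mem_map, forall_exists_index, and_imp]
          rintro _ j hj rfl
          refine commute_mul_of_acm ?_ (acm_pw_pw _ _ _)
          rw [acm_pw_w, if_neg]
          rintro rfl; exact hl.1 hj
        rw [← this.eq, ← mul_assoc, mul_assoc (cr _), pw_sq]; simp
  exact key _ (List.mem_finRange i) (List.nodup_finRange n)

lemma w_mul_Q (i : Fin n) : cr (Sum.inl i) * Q φ = 0 := by
  have key : ∀ l : List (Fin n), i ∈ l →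
      cr (Sum.inl i) * (l.map fun i => cr (Sum.inl i) * pw φ i).prod = 0 := by
    intro l
    induction l with
    | nil => simp
    | cons j l ih =>
      intro hi
      rw [List.map_cons, List.prod_cons, ← mul_assoc]
      by_cases h : i = j
      · subst h; rw [← mul_assoc, cr_sq]; simp
      · have : Commute (cr (Sum.inl i)) (cr (Sum.inl j) * pw φ j) := by
          refine commute_mul_of_acm (acm_cr_cr _ _) ?_
          rw [acm_comm, acm_pw_w, if_neg (Ne.symm h)]
        rw [this.eq, mul_assoc, ih (by simpa [h] using hi), mul_zero]
  exact key _ (List.mem_finRange i)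

lemma Q_apply_of_w (f : Full R n m) (h : ∀ i, cr (Sum.inl i) f = 0) : Q φ f = f := by
  have key : ∀ l : List (Fin n), 
      ((l.map fun i => cr (Sum.inl i) * pw φ i).prod : Op R n m) f = f := by
    intro l
    induction l with
    | nil => simp
    | cons j l ih =>
      rw [List.map_cons, List.prod_cons, Op.mul_apply, ih]
      have := congrArg (· f) (acm_pw_w φ j j)
      simpa [acm, h] using this
  exact key _

lemma prAll_zero_apply (f : Full R n m) (a) :
    prAll (fun _ => (0 : R)) f a = if a = 0 then f a else 0 := by
  have key : ∀ l : List (Fin n), (l.map fun i => (pr 0 i : Op R n m)).prod f a =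
      if ∀ i ∈ l, a i = 0 then f a else 0 := by
    intro l
    induction l generalizing a with
    | nil => simp
    | cons j l ih =>
      rw [List.map_cons, List.prod_cons, Op.mul_apply, pr_apply]
      by_cases h : a j = 0
      · rw [← h, Function.update_eq_self, ih]; simp [h]
      · simp [h]
  rw [prAll, key]; simp [funext_iff]

lemma sh_add_mul_pr (c : R) (i : Fin n) : (sh i + c • 1 : Op R n m) * pr c i = 0 := by
  rw [← one_sub_ri_mul, mul_sub, ← mul_assoc, sh_mul_ri]; simp

lemma sh_add_mul_prAll (i : Fin n) : (sh i + x i • 1 : Op R n m) * prAll x = 0 := by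
  have key : ∀ l : List (Fin n), i ∈ l →
      (sh i + x i • 1 : Op R n m) * (l.map fun i => pr (x i) i).prod = 0 := by
    intro l
    induction l with
    | nil => simp
    | cons j l ih =>
      intro hi
      rw [List.map_cons, List.prod_cons, ← mul_assoc]
      by_cases h : i = j
      · subst h; rw [sh_add_mul_pr, zero_mul]
      · have : Commute (sh i + x i • 1 : Op R n m) (pr (x j) j) :=
          (sh_commute_pr _ h).add_left ((Commute.one_left _).smul_left _)
        rw [this.eq, mul_assoc, ih (by simpa [h] using hi), mul_zero]
  exact key _ (List.mem_finRange i)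

lemma prAll_apply (f : Full R n m) (a) :
    prAll x f a = (∏ i, (- x i) ^ a i) • f 0 := by
  have key : ∀ l : List (Fin n), l.Nodup → ∀ a, (l.map fun i => (pr (x i) i : Op R n m)).prod f a =
      (l.map fun i => (- x i) ^ a i).prod • f (fun i => if i ∈ l then 0 else a i) := by
    intro l
    induction l with
    | nil => simp
    | cons j l ih =>
      intro hl a
      rw [List.nodup_cons] at hl
      rw [List.map_cons, List.prod_cons, Op.mul_apply, pr_apply, ih hl.2, List.map_cons,
        List.prod_cons, smul_smul]
      congr 2
      · congr 1
        refine List.map_congr_left fun i hi => ?_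
        rw [Function.update_of_ne]
        rintro rfl; exact hl.1 hi
      · ext i
        by_cases h : i = j
        · subst h; simp [hl.1]
        · simp [h]
  rw [prAll, key _ (List.nodup_finRange n)]
  simp only [List.mem_finRange, if_true]
  congr 1

lemma prAll_mul_prAll_zero : prAll x * prAll (fun _ => 0) = (prAll x : Op R n m) := by
  ext f a I
  simp [Op.mul_apply, prAll_apply x, prAll_zero_apply]

lemma prAll_zero_mul_prAll :
    prAll (fun _ => 0) * prAll x = (prAll (fun _ => 0) : Op R n m) := by
  ext f a I
  simp only [Op.mul_apply, prAll_zero_apply]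
  split_ifs with h
  · subst h; simp [prAll_apply]
  · rfl

lemma sum_smul_pw : ∑ i, x i • pw φ i = dx x + dz x φ := by
  simp [pw, dx, dz, Finset.sum_add_distrib]

lemma sum_sh_mul_pw : ∑ i, sh i * pw φ i = theta + dF φ := by
  simp [pw, theta, dF, Finset.sum_add_distrib, mul_add]

lemma dtot_eq : dtot x φ = ∑ i, (sh i + x i • 1) * pw φ i + - dz x φ := by
  simp only [add_mul, Finset.sum_add_distrib, sum_sh_mul_pw, smul_mul_assoc, one_mul, sum_smul_pw]
  rw [dtot, delta]; abel

lemma dtot_eq' : dtot x φ = ∑ i, sh i * pw φ i + dx x := by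
  rw [sum_sh_mul_pw, dtot, delta]; abel

lemma Q_mul_dx : Q φ * dx x = - (dz x φ * Q φ) := by
  have : Q φ * (dx x + dz x φ) = 0 := by
    rw [← sum_smul_pw, Finset.mul_sum]; simp [Q_mul_pw]
  rw [mul_add, ← (dz_commute_Q x φ).eq] at this
  exact eq_neg_of_add_eq_zero_left this

lemma mu_mul_dtot : mu φ * dtot x φ = - (dz x φ * mu φ) := by
  have h0 : Q φ * ∑ i, sh i * pw φ i = 0 := by
    rw [Finset.mul_sum]
    refine Finset.sum_eq_zero fun i _ => ?_
    rw [← mul_assoc, ← (sh_commute_Q φ i).eq, mul_assoc, Q_mul_pw, mul_zero]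
  rw [mu, ← (prAll_commute_Q _ φ).eq, mul_assoc, dtot_eq', mul_add, h0, zero_add, Q_mul_dx,
    mul_neg, ← mul_assoc, (prAll_commute_dz x φ _).eq, mul_assoc]

lemma dtot_mul_prAll : dtot x φ * prAll x = - (prAll x * dz x φ) := by
  rw [dtot_eq, add_mul, Finset.sum_mul, Finset.sum_eq_zero, zero_add, neg_mul,
    (prAll_commute_dz x φ x).eq]
  intro i _
  have h : Commute (prAll x) (pw φ i) := (prAll_commute_an _ _).add_right (prAll_commute_dphi _ _ _)
  rw [mul_assoc, ← h.eq, ← mul_assoc, sh_add_mul_prAll, zero_mul]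

end Operators

section Weights

variable {R : Type*} [CommRing R] {n m : ℕ}

/-- A linear weight on the indices of the ambient module. -/
def lw (α β γ : ℤ) (a : Fin n → ℕ) (I : Finset (Ferm n m)) : ℤ :=
  α * ∑ i, (a i : ℤ) + β * I.toLeft.card + γ * I.toRight.card

/-- The operator `A` raises the weight by at least `s`. -/
def Raise (wt : (Fin n → ℕ) → Finset (Ferm n m) → ℤ) (s : ℤ) (A : Op R n m) : Prop :=
  ∀ (f : Full R n m) (D : ℤ), (∀ a I, wt a I < D → f a I = 0) →
    ∀ a I, wt a I < D + s → A f a I = 0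

namespace Raise

variable {wt : (Fin n → ℕ) → Finset (Ferm n m) → ℤ} {s t : ℤ} {A B : Op R n m}

lemma mono (h : Raise wt s A) (hts : t ≤ s) : Raise wt t A :=
  fun f D hf a I hw => h f D hf a I (by omega)

lemma mul (hA : Raise wt s A) (hB : Raise wt t B) : Raise wt (s + t) (A * B) :=
  fun f D hf a I hw => hA (B f) (D + t) (hB f D hf) a I (by omega)

lemma add (hA : Raise wt s A) (hB : Raise wt s B) : Raise wt s (A + B) :=
  fun f D hf a I hw => by simp [hA f D hf a I hw, hB f D hf a I hw]

lemma smul (r : R) (hA : Raise wt s A) : Raise wt s (r • A) :=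
  fun f D hf a I hw => by simp [hA f D hf a I hw]

lemma zero : Raise wt s (0 : Op R n m) := fun f D hf a I hw => by simp

lemma one : Raise wt 0 (1 : Op R n m) := fun f D hf a I hw => by
  simpa using hf a I (by omega)

lemma sum {κ : Type*} (S : Finset κ) {A : κ → Op R n m} (h : ∀ i, Raise wt s (A i)) :
    Raise wt s (∑ i ∈ S, A i) :=
  fun f D hf a I hw => by simp [Finset.sum_eq_zero fun i _ => h i f D hf a I hw]

lemma list_prod {κ : Type*} (l : List κ) {A : κ → Op R n m} (h : ∀ i, Raise wt 0 (A i)) :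
    Raise wt 0 (l.map A).prod := by
  induction l with
  | nil => simpa using one
  | cons i l ih => simpa using (h i).mul ih

lemma asm (l : List (Fin n)) {S q : Fin n → Op R n m} (c : R) (hS : ∀ i, Raise wt s (S i))
    (hq : ∀ i, Raise wt 0 (q i)) : Raise wt s (Residual.asm (c • 1) S q l) := by
  induction l with
  | nil => exact zero
  | cons i l ih =>
    refine add ?_ (by simpa using (hq i).mul ih)
    rw [smul_pow, one_pow, smul_mul_assoc, one_mul]
    exact (hS i).smul _

end Raise

variable (α β γ : ℤ)

lemma sum_update (a : Fin n → ℕ) (i : Fin n) (t : ℕ) :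
    ∑ j, ((Function.update a i t j : ℕ) : ℤ) = ∑ j, (a j : ℤ) + t - a i := by
  have h1 := Finset.sum_update_of_mem (Finset.mem_univ i) a t
  have h2 := Finset.add_sum_erase Finset.univ a (Finset.mem_univ i)
  rw [← Finset.sdiff_singleton_eq_erase] at h2
  push_cast [← Nat.cast_sum]
  omega

lemma raise_sh (i : Fin n) : Raise (lw α β γ) (-α) (sh i : Op R n m) := by
  intro f D hf a I hw
  rw [sh_apply]
  refine hf _ _ ?_
  simp only [lw, sum_update] at hw ⊢
  push_cast
  linarith

lemma raise_ri_zero (i : Fin n) : Raise (lw α β γ) α (ri 0 i : Op R n m) := by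
  intro f D hf a I hw
  rw [ri_apply, Finset.sum_apply]
  refine Finset.sum_eq_zero fun t ht => ?_
  have ht := Finset.mem_range.1 ht
  by_cases h : t = a i - 1
  · rw [Pi.smul_apply, hf, smul_zero]
    simp only [lw, sum_update] at hw ⊢
    have : (a i : ℤ) = t + 1 := by omega
    rw [this]; linarith
  · rw [neg_zero, zero_pow (by omega), zero_smul, Pi.zero_apply]

lemma raise_ri (c : R) (hα : 0 ≤ α) (i : Fin n) : Raise (lw α β γ) α (ri c i : Op R n m) := by
  intro f D hf a I hw
  rw [ri_apply, Finset.sum_apply]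
  refine Finset.sum_eq_zero fun t ht => ?_
  have ht := Finset.mem_range.1 ht
  rw [Pi.smul_apply, hf, smul_zero]
  simp only [lw, sum_update] at hw ⊢
  have : (t : ℤ) + 1 ≤ a i := by omega
  nlinarith

lemma raise_pr (c : R) (hα : 0 ≤ α) (i : Fin n) : Raise (lw α β γ) 0 (pr c i : Op R n m) := by
  intro f D hf a I hw
  rw [pr_apply, Pi.smul_apply, hf, smul_zero]
  simp only [lw, sum_update] at hw ⊢
  push_cast
  nlinarith

lemma raise_pr_zero (i : Fin n) : Raise (lw α β γ) 0 (pr 0 i : Op R n m) := by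
  intro f D hf a I hw
  rw [pr_apply]
  by_cases h : a i = 0
  · rw [← h, Function.update_eq_self, Pi.smul_apply, hf _ _ (by simpa using hw), smul_zero]
  · simp [h]

lemma toLeft_card_insert_inl {i : Fin n} {I : Finset (Ferm n m)} (h : Sum.inl i ∉ I) :
    (insert (Sum.inl i) I).toLeft.card = I.toLeft.card + 1 := by
  rw [Finset.toLeft_insert_inl, Finset.card_insert_of_notMem (by simpa using h)]

lemma toRight_card_insert_inr {g : Fin m} {I : Finset (Ferm n m)} (h : Sum.inr g ∉ I) :
    (insert (Sum.inr g) I).toRight.card = I.toRight.card + 1 := by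
  rw [Finset.toRight_insert_inr, Finset.card_insert_of_notMem (by simpa using h)]

lemma raise_an_inl (i : Fin n) : Raise (lw α β γ) (-β) (an (Sum.inl i) : Op R n m) := by
  intro f D hf a I hw
  rw [an_apply]
  split_ifs with h
  · rfl
  · rw [hf, mul_zero]
    simp only [lw, toLeft_card_insert_inl h, Finset.toRight_insert_inl] at hw ⊢
    push_cast; linarith

lemma raise_an_inr (g : Fin m) : Raise (lw α β γ) (-γ) (an (Sum.inr g) : Op R n m) := by
  intro f D hf a I hw
  rw [an_apply]
  split_ifs with h
  · rfl
  · rw [hf, mul_zero]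
    simp only [lw, toRight_card_insert_inr h, Finset.toLeft_insert_inr] at hw ⊢
    push_cast; linarith

lemma raise_cr_inl (i : Fin n) : Raise (lw α β γ) β (cr (Sum.inl i) : Op R n m) := by
  intro f D hf a I hw
  rw [cr_apply]
  split_ifs with h
  · rw [hf, mul_zero]
    rw [← Finset.insert_erase h] at hw
    simp only [lw, toLeft_card_insert_inl (Finset.notMem_erase _ I),
      Finset.toRight_insert_inl] at hw ⊢
    push_cast at hw; linarith
  · rfl

lemma raise_cr_inr (g : Fin m) : Raise (lw α β γ) γ (cr (Sum.inr g) : Op R n m) := by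
  intro f D hf a I hw
  rw [cr_apply]
  split_ifs with h
  · rw [hf, mul_zero]
    rw [← Finset.insert_erase h] at hw
    simp only [lw, toRight_card_insert_inr (Finset.notMem_erase _ I),
      Finset.toLeft_insert_inr] at hw ⊢
    push_cast at hw; linarith
  · rfl

variable (x : Fin n → R) (φ : Matrix (Fin n) (Fin m) R)

lemma raise_dphi (i : Fin n) : Raise (lw α β γ) (-γ) (dphi φ i) :=
  Raise.sum _ fun g => (raise_an_inr α β γ g).smul _

lemma raise_theta : Raise (lw α β γ) (-α - β) (theta : Op R n m) :=
  Raise.sum _ fun i => ((raise_sh α β γ i).mul (raise_an_inl α β γ i)).mono (by linarith)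

lemma raise_dx : Raise (lw α β γ) (-β) (dx x : Op R n m) :=
  Raise.sum _ fun i => (raise_an_inl α β γ i).smul _

lemma raise_dF : Raise (lw α β γ) (-α - γ) (dF φ) :=
  Raise.sum _ fun i => ((raise_sh α β γ i).mul (raise_dphi α β γ φ i)).mono (by linarith)

lemma raise_dz : Raise (lw α β γ) (-γ) (dz x φ) :=
  Raise.sum _ fun i => (raise_dphi α β γ φ i).smul _

lemma raise_pw {s : ℤ} (h1 : s ≤ -β) (h2 : s ≤ -γ) (i : Fin n) :
    Raise (lw α β γ) s (pw φ i) :=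
  ((raise_an_inl α β γ i).mono h1).add ((raise_dphi α β γ φ i).mono h2)

lemma raise_w_pw (h : γ ≤ β) (i : Fin n) :
    Raise (lw α β γ) 0 (cr (Sum.inl i) * pw φ i) :=
  ((raise_cr_inl α β γ i).mul (raise_pw α β γ φ (s := -β) le_rfl (by linarith) i)).mono
    (by linarith)

lemma raise_Q (h : γ ≤ β) : Raise (lw α β γ) 0 (Q φ) :=
  Raise.list_prod _ (raise_w_pw α β γ φ h)

lemma raise_prAll_zero : Raise (lw α β γ) 0 (prAll (fun _ => 0) : Op R n m) :=
  Raise.list_prod _ fun i => raise_pr_zero α β γ i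

lemma raise_prAll (hα : 0 ≤ α) : Raise (lw α β γ) 0 (prAll x : Op R n m) :=
  Raise.list_prod _ fun i => raise_pr α β γ (x i) hα i

lemma raise_mu (h : γ ≤ β) : Raise (lw α β γ) 0 (mu φ) := by
  have := (raise_Q α β γ φ h).mul (raise_prAll_zero (R := R) α β γ)
  rw [add_zero] at this
  exact this

end Weights

section Homotopies

variable {R : Type*} [CommRing R] {n m : ℕ} (x : Fin n → R) (φ : Matrix (Fin n) (Fin m) R)

/-- The level of an index, whose zero set carries the symmetric strand. -/
def lev (a : Fin n → ℕ) (I : Finset (Ferm n m)) : ℤ := n + lw 1 0 (-1) a I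

/-- The element lives in levels at least `D`. -/
def GE (D : ℤ) (f : Full R n m) : Prop := ∀ a I, lev a I < D → f a I = 0

/-- The element lives in levels at most `D`. -/
def LE (D : ℤ) (f : Full R n m) : Prop := ∀ a I, D < lev a I → f a I = 0

lemma Raise.ge {s : ℤ} {A : Op R n m} (h : Raise (lw 1 0 (-1)) s A) {D D' : ℤ}
    {f : Full R n m} (hf : GE D f) (hD : D' ≤ D + s) : GE D' (A f) :=
  fun a I hw => h f (D - n) (fun a I hw => hf a I (by unfold lev; omega)) a I (by
    unfold lev at hw; omega)

lemma Raise.le {s : ℤ} {A : Op R n m} (h : Raise (lw (-1) 0 1) s A) {D D' : ℤ}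
    {f : Full R n m} (hf : LE D f) (hD : D - s ≤ D') : LE D' (A f) := by
  have e : ∀ (a : Fin n → ℕ) (I : Finset (Ferm n m)), lw (-1) 0 1 a I = - lw 1 0 (-1) a I :=
    fun a I => by simp only [lw]; ring
  exact fun a I hw => h f (n - D) (fun a I hw => hf a I (by
    rw [e] at hw; unfold lev; omega)) a I (by rw [e]; unfold lev at hw; omega)

/-- Multiplication by `α` is homotopic to an operator landing in nonpositive levels. -/
def Contracts (α : R) : Prop :=
  ∃ T S : Op R n m, acm (dtot x φ) T = α • 1 - S ∧ (∀ f, LE 0 f → LE 0 (T f)) ∧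
    ∀ f, LE 0 (S f)

lemma smul_one_commute (c : R) (A : Op R n m) : Commute (c • 1 : Op R n m) A :=
  (Commute.one_left A).smul_left c

lemma contracts_z (g : Fin m) : Contracts x φ (∑ i, x i * φ i g) := by
  refine ⟨∑ i, φ i g • cr (Sum.inl i) - cr (Sum.inr g), 0, ?_, fun f hf => ?_, fun f a I _ => by
    simp⟩
  · have h1 : ∀ i, acm (dtot x φ) (cr (Sum.inl i)) = sh i + x i • 1 := by
      intro i
      rw [dtot_eq, ← neg_one_smul R, acm_add_left, acm_smul_left, acm_dz_w, acm_sum_left]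
      rw [Finset.sum_congr rfl fun j _ => acm_mul_left
        ((sh_commute_cr j _).add_left (smul_one_commute (x j) (cr (Sum.inl i))))]
      simp [acm_pw_w]
    have h2 : acm (dtot x φ) (cr (Sum.inr g)) = ∑ i, φ i g • sh i := by
      rw [dtot_eq', acm_add_left, acm_sum_left,
        Finset.sum_congr rfl fun j _ => acm_mul_left (sh_commute_cr j _)]
      simp [acm_pw_e, dx, acm_sum_left, acm_smul_left, acm_an_cr]
    rw [acm_sub_right, acm_sum_right, h2]
    simp only [acm_smul_right, h1, smul_add, Finset.sum_add_distrib, smul_smul, Finset.sum_smul]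
    simp [mul_comm]
  · intro a I hw
    have h1 := (Raise.sum Finset.univ fun i => (raise_cr_inl (R := R) (m := m) (-1) 0 1 i).smul
      (φ i g)).le hf (D' := 0) (by norm_num) a I hw
    have h2 := (raise_cr_inr (R := R) (n := n) (-1) 0 1 g).le hf (D' := 0) (by norm_num) a I hw
    simpa [h2] using h1

lemma contracts_of_mul_eq {ψ : Matrix (Fin m) (Fin n) R} {c : R} (h : φ * ψ = c • 1) :
    Contracts x φ (c ^ n) := by
  set E : Fin n → Op R n m := fun i => ∑ g, ψ g i • cr (Sum.inr g) with hE
  have hYE : ∀ i j, Commute (sh j) (E i) := fun i j =>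
    Commute.sum_right _ _ _ fun _ _ => (sh_commute_cr _ _).smul_right _
  have hpE : ∀ i j, acm (pw φ j) (E i) = if i = j then c • 1 else 0 := by
    intro i j
    have := congrFun (congrFun h j) i
    simp only [Matrix.mul_apply, Matrix.smul_apply, Matrix.one_apply] at this
    simp only [hE, acm_sum_right, acm_smul_right, acm_pw_e, smul_smul, ← Finset.sum_smul]
    rw [Finset.sum_congr rfl fun g _ => mul_comm (ψ g i) (φ j g), this]
    by_cases hij : i = j
    · simp [hij]
    · simp [hij, Ne.symm hij]
  have hR : ∀ i, Commute (ri 0 i) (E i) := fun i =>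
    Commute.sum_right _ _ _ fun _ _ => (ri_commute_cr _ _ _).smul_right _
  have hdE : ∀ i, acm (dx x) (E i) = 0 := fun i => by
    simp [hE, dx, acm_sum_left, acm_sum_right, acm_smul_left, acm_smul_right, acm_an_cr]
  have hsingle : ∀ i, acm (dtot x φ) (ri 0 i * E i) = c • 1 - pr 0 i * (E i * pw φ i) := by
    intro i
    have hYri : ∀ j, (sh j : Op R n m) = sh j + (0 : R) • 1 := by simp
    rw [dtot_eq', acm_single (τ := ri 0) (c := E) (r := c • 1) i ?_
      (fun j hj => sh_commute_ri _ hj) (fun j => hYE i j) (fun j => ri_commute_pw _ _ _ _)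
      (fun j hj => by rw [hpE, if_neg hj.symm]) (by rw [hpE, if_pos rfl]) ?_]
    · conv_lhs => rw [hYri i, one_sub_ri_mul]
    · conv_lhs => rw [hYri i, sh_mul_ri]
    · rw [acm_mul_right, hdE, mul_zero]
      exact Commute.sum_right _ _ _ fun _ _ => (ri_commute_an _ _ _).smul_right _
  refine ⟨asm (c • 1) (fun i => ri 0 i * E i) (fun i => pr 0 i * (E i * pw φ i))
    (List.finRange n), ((List.finRange n).map fun i => pr 0 i * (E i * pw φ i)).prod, ?_, ?_, ?_⟩
  · exact (acm_asm (dtot_sq x φ) (smul_one_commute c) hsingle _).trans (by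
      rw [smul_pow, one_pow, List.length_finRange])
  · intro f hf
    have rE : ∀ i, Raise (lw (-1) 0 1) 1 (E i) := fun i =>
      Raise.sum _ fun g => (raise_cr_inr _ _ _ _).smul _
    refine (Raise.asm (s := 0) _ c (fun i => ?_) fun i => ?_).le hf (by norm_num)
    · exact ((raise_ri_zero _ _ _ i).mul (rE i)).mono (by norm_num)
    · exact ((raise_pr_zero _ _ _ i).mul ((rE i).mul
        (raise_pw _ _ _ φ (s := -1) (by norm_num) (by norm_num) i))).mono (by norm_num)
  · intro f a I hw
    obtain ⟨k, hk⟩ := prod_mul_eq_sign (a := pw φ) (c := E) (List.nodup_finRange n)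
      fun i j hij => by rw [hpE, if_neg hij.symm]
    rw [prod_map_mul_of_commute, hk]
    · have h0 := prAll_zero_apply (R := R) (n := n) (m := m)
      rw [prAll] at h0
      rw [Op.mul_apply, h0]
      split_ifs with ha
      · subst ha
        have hI : ((I.toRight.card : ℕ) : ℤ) < n := by
          simp [lev, lw] at hw; omega
        have rE : ∀ i, Raise (lw 0 0 1) 1 (E i) := fun i =>
          Raise.sum _ fun g => (raise_cr_inr _ _ _ _).smul _
        have rEs : ∀ l : List (Fin n), Raise (lw 0 0 1) l.length (l.map E).prod := by
          intro l
          induction l with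
          | nil => simpa using Raise.one
          | cons i l ih => simpa [add_comm] using (rE i).mul ih
        have : ∀ f : Full R n m, (((List.finRange n).map E).prod : Op R n m) f 0 I = 0 := by
          intro f
          refine rEs (List.finRange n) f 0 (fun a I hw => ?_) 0 I ?_
          · simp only [lw] at hw; omega
          · simp [lw] ; omega
        have hs : ∀ (k : ℕ) (f : Full R n m), (((-1) ^ k : Op R n m)) f = (-1 : R) ^ k • f := by
          intro k f
          rcases Nat.even_or_odd k with h | h <;> simp [h.neg_one_pow]
        rw [Op.mul_apply, hs, Pi.smul_apply, Pi.smul_apply, Op.mul_apply, this, smul_zero]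
      · rfl
    · intro i j
      exact (Commute.sum_right _ _ _ fun _ _ => (pr_commute_cr _ _ _).smul_right _).mul_right
        (pr_commute_pw _ _ _ _)

lemma contracts_minor (r : Fin n ↪ Fin n) (c : Fin n ↪ Fin m) :
    Contracts x φ ((φ.submatrix r c).det ^ n) := by
  have hr : Function.Bijective r := Finite.injective_iff_bijective.1 r.injective
  set e := Equiv.ofBijective r hr
  set M : Matrix (Fin n) (Fin n) R := φ.submatrix r c with hM
  refine contracts_of_mul_eq x φ (ψ := Matrix.of fun g i =>
    ∑ j : Fin n, if c j = g then M.adjugate j (e.symm i) else 0) ?_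
  ext i l
  have h := congrFun (congrFun (Matrix.mul_adjugate M) (e.symm i)) (e.symm l)
  simp only [Matrix.mul_apply, Matrix.smul_apply, Matrix.one_apply] at h ⊢
  simp only [Matrix.of_apply, Finset.mul_sum, mul_ite, mul_zero]
  rw [Finset.sum_comm]
  simp only [Finset.sum_ite_eq, Finset.mem_univ, if_true]
  have he : ∀ i, φ i = fun g => φ (r (e.symm i)) g := fun i => by
    rw [show r (e.symm i) = i from e.apply_symm_apply i]
  rw [he i]
  simpa [hM] using h

end Homotopies

section Torsion

variable {R : Type*} [CommRing R] {n m : ℕ} (x : Fin n → R) (φ : Matrix (Fin n) (Fin m) R)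

/-- The indices `(0, I)` for which `I` contains all the exterior variables `inl i`. -/
def IsCorner (a : Fin n → ℕ) (I : Finset (Ferm n m)) : Prop := a = 0 ∧ ∀ i, Sum.inl i ∈ I

/-- The kernel of `theta` in level zero, away from the corner. -/
def symPart (R : Type*) [CommRing R] (n m : ℕ) : Submodule R (Full R n m) where
  carrier := {u | theta u = 0 ∧ ∀ a I, (lev a I ≠ 0 ∨ IsCorner a I) → u a I = 0}
  add_mem' := fun {u v} hu hv => ⟨by rw [map_add, hu.1, hv.1, add_zero],
    fun a I h => by simp [hu.2 a I h, hv.2 a I h]⟩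
  zero_mem' := ⟨map_zero _, fun _ _ _ => rfl⟩
  smul_mem' := fun c u hu => ⟨by rw [map_smul, hu.1, smul_zero],
    fun a I h => by simp [hu.2 a I h]⟩

/-- The elements supported on corner indices of positive level. -/
def koszulPart (R : Type*) [CommRing R] (n m : ℕ) : Submodule R (Full R n m) where
  carrier := {κ | ∀ a I, ¬ (0 < lev a I ∧ IsCorner a I) → κ a I = 0}
  add_mem' := fun {u v} hu hv a I h => by simp [hu a I h, hv a I h]
  zero_mem' := fun _ _ _ => rfl
  smul_mem' := fun c u hu a I h => by simp [hu a I h]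

lemma corner_of (f : Full R n m) (h0 : prAll (fun _ => 0) f = f)
    (hw : ∀ i, cr (Sum.inl i) f = 0) (a I) (h : ¬ IsCorner a I) : f a I = 0 := by
  by_cases ha : a = 0
  · have : ¬ ∀ i, Sum.inl i ∈ I := fun h' => h ⟨ha, h'⟩
    push Not at this
    obtain ⟨i, hi⟩ := this
    have := congrFun (congrFun (hw i) a) (insert (Sum.inl i) I)
    rw [cr_apply, if_pos (Finset.mem_insert_self _ _), Finset.erase_insert hi] at this
    have h2 := sg_mul_self (R := R) (Sum.inl i) (insert (Sum.inl i) I)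
    simp only [Pi.zero_apply] at this
    calc f a I = sg R (Sum.inl i) (insert (Sum.inl i) I) *
        (sg R (Sum.inl i) (insert (Sum.inl i) I) * f a I) := by rw [← mul_assoc, h2, one_mul]
      _ = 0 := by rw [this, mul_zero]
  · rw [← h0, prAll_zero_apply, if_neg ha]; rfl

lemma prAll_of_corner {f : Full R n m} (h : ∀ a I, ¬ IsCorner a I → f a I = 0) :
    prAll (fun _ => 0) f = f := by
  ext a I
  rw [prAll_zero_apply]
  split_ifs with ha
  · rfl
  · rw [h a I fun h' => ha h'.1]; rfl

lemma cr_of_corner {f : Full R n m} (h : ∀ a I, ¬ IsCorner a I → f a I = 0) (i : Fin n) :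
    cr (Sum.inl i) f = 0 := by
  ext a I
  rw [cr_apply]
  split_ifs
  · rw [h _ _ fun h' => Finset.notMem_erase _ _ (h'.2 i), mul_zero]; rfl
  · rfl

lemma koszulPart_corner {κ : Full R n m} (h : κ ∈ koszulPart R n m) (a I)
    (h' : ¬ IsCorner a I) : κ a I = 0 := h a I fun h'' => h' h''.2

lemma koszulPart_ge {κ : Full R n m} (h : κ ∈ koszulPart R n m) : GE 1 κ :=
  fun a I hl => h a I fun h'' => by omega

lemma symPart_ge {u : Full R n m} (h : u ∈ symPart R n m) : GE 0 u :=
  fun a I hl => h.2 a I (Or.inl (by omega))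

lemma symPart_le {u : Full R n m} (h : u ∈ symPart R n m) : LE 0 u :=
  fun a I hl => h.2 a I (Or.inl (by omega))

lemma mem_koszulPart {κ : Full R n m} (h0 : prAll (fun _ => 0) κ = κ)
    (hw : ∀ i, cr (Sum.inl i) κ = 0) (h1 : GE 1 κ) : κ ∈ koszulPart R n m := by
  intro a I h
  by_cases hc : IsCorner a I
  · exact h1 a I (by by_contra h'; exact h ⟨by omega, hc⟩)
  · exact corner_of κ h0 hw a I hc

lemma prAll_zero_mu (f : Full R n m) : prAll (fun _ => 0) (mu φ f) = mu φ f := by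
  rw [← Op.mul_apply, mu, ← mul_assoc, (prAll_commute_Q _ φ).eq, mul_assoc]
  congr 2
  ext f a
  rw [Op.mul_apply, prAll_zero_apply, prAll_zero_apply]
  split_ifs <;> rfl

lemma cr_mu (f : Full R n m) (i : Fin n) : cr (Sum.inl i) (mu φ f) = 0 := by
  rw [← Op.mul_apply, mu, ← mul_assoc, w_mul_Q]; simp

lemma mu_ge {f : Full R n m} {D : ℤ} (h : GE D f) : GE D (mu φ f) :=
  (raise_mu 1 0 (-1) φ (by norm_num)).ge h (by simp)

lemma mu_mem_of_ge {f : Full R n m} (h : GE 1 f) : mu φ f ∈ koszulPart R n m :=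
  mem_koszulPart (prAll_zero_mu φ f) (cr_mu φ f) (mu_ge φ h)

lemma toLeft_card_le (I : Finset (Ferm n m)) : I.toLeft.card ≤ n := by
  simpa using Finset.card_le_univ I.toLeft

lemma toLeft_card_eq {I : Finset (Ferm n m)} : I.toLeft.card = n ↔ ∀ i, Sum.inl i ∈ I := by
  constructor
  · intro h i
    have : I.toLeft = Finset.univ := by
      rw [← Finset.card_eq_iff_eq_univ]; simpa using h
    simpa using (Finset.ext_iff.1 this i).2 (Finset.mem_univ i)
  · intro h
    have : I.toLeft = Finset.univ := by ext i; simpa using h i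
    simp [this]

lemma mu_mem {u : Full R n m} (hu : u ∈ symPart R n m) : mu φ u ∈ koszulPart R n m := by
  refine mem_koszulPart (prAll_zero_mu φ u) (cr_mu φ u) fun a I hl => ?_
  by_cases hl' : lev a I < 0
  · exact mu_ge φ (symPart_ge hu) a I hl'
  by_cases hc : IsCorner a I
  swap
  · exact corner_of _ (prAll_zero_mu φ u) (cr_mu φ u) a I hc
  rw [mu, Op.mul_apply]
  refine raise_Q 0 (-1) (-1) φ le_rfl _ (1 - 2 * n) ?_ a I ?_
  · intro b K hb
    rw [prAll_zero_apply]
    split_ifs with h0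
    · refine hu.2 b K ?_
      by_contra h
      push Not at h
      have h1 := toLeft_card_eq.not.2 fun h' => h.2 ⟨h0, h'⟩
      have h2 := toLeft_card_le K
      have h3 := h.1
      subst h0
      simp only [lev, lw, Pi.zero_apply] at h3 hb
      simp at h3 hb
      omega
    · rfl
  · have h1 := toLeft_card_eq.2 hc.2
    have h3 : lev a I = 0 := by omega
    rw [hc.1] at h3 ⊢
    simp only [lev, lw] at h3 ⊢
    simp at h3 ⊢
    omega

lemma dz_mem {κ : Full R n m} (hκ : κ ∈ koszulPart R n m) : dz x φ κ ∈ koszulPart R n m := by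
  have hc := koszulPart_corner hκ
  refine mem_koszulPart ?_ (fun i => ?_) ?_
  · rw [← Op.mul_apply, (prAll_commute_dz x φ _).eq, Op.mul_apply, prAll_of_corner hc]
  · have := acm_dz_w x φ i
    rw [acm, add_eq_zero_iff_eq_neg'] at this
    rw [← Op.mul_apply, this, Op.neg_apply, Op.mul_apply, cr_of_corner hc, map_zero, neg_zero]
  · exact (raise_dz 1 0 (-1) x φ).ge (koszulPart_ge hκ) (by norm_num)

lemma theta_apply (f : Full R n m) (a I) :
    theta f a I = ∑ i, if Sum.inl i ∈ I then 0 else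
      sg R (Sum.inl i) I * f (Function.update a i (a i + 1)) (insert (Sum.inl i) I) := by
  simp [theta, sh_apply, an_apply]

lemma theta_corner (f : Full R n m) (a) {I : Finset (Ferm n m)} (h : ∀ i, Sum.inl i ∈ I) :
    theta f a I = 0 := by
  rw [theta_apply]
  exact Finset.sum_eq_zero fun i _ => if_pos (h i)

lemma symPart_next {u : Full R n m} (hu : theta u = 0) (i : Fin n) {I : Finset (Ferm n m)}
    (hI : ∀ i, Sum.inl i ∈ I) (a : Fin n → ℕ) : u (Function.update a i (a i + 1)) I = 0 := by
  have h := congrFun (congrFun hu a) (I.erase (Sum.inl i))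
  rw [theta_apply, Finset.sum_eq_single i] at h
  · rw [if_neg (Finset.notMem_erase _ _), Finset.insert_erase (hI i)] at h
    have h2 := sg_mul_self (R := R) (Sum.inl i) (I.erase (Sum.inl i))
    calc _ = sg R (Sum.inl i) (I.erase (Sum.inl i)) * (sg R (Sum.inl i) (I.erase (Sum.inl i)) *
        u (Function.update a i (a i + 1)) I) := by rw [← mul_assoc, h2, one_mul]
      _ = 0 := by rw [h]; simp
  · intro j _ hj
    rw [if_pos]
    exact Finset.mem_erase.2 ⟨fun h => hj (Sum.inl_injective h), hI j⟩
  · simp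

lemma raise_delta_up : Raise (lw 1 0 (-1)) 0 (delta x φ) :=
  ((raise_dx _ _ _ x).mono (by norm_num)).add ((raise_dF _ _ _ φ).mono (by norm_num))

lemma raise_delta_down : Raise (lw (-1) 0 1) 0 (delta x φ) :=
  ((raise_dx _ _ _ x).mono (by norm_num)).add ((raise_dF _ _ _ φ).mono (by norm_num))

lemma theta_delta {u : Full R n m} (h : theta u = 0) : theta (delta x φ u) = 0 := by
  have := acm_theta_delta x φ
  rw [acm, add_eq_zero_iff_eq_neg] at this
  rw [← Op.mul_apply, this, Op.neg_apply, Op.mul_apply, h, map_zero, neg_zero]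

lemma delta_mem {u : Full R n m} (hu : u ∈ symPart R n m) : delta x φ u ∈ symPart R n m := by
  refine ⟨theta_delta x φ hu.1, fun a I h => ?_⟩
  by_cases hl : lev a I = 0
  · obtain ⟨rfl, hI⟩ := h.resolve_left (not_not.2 hl)
    rw [delta, Op.add_apply, Pi.add_apply, Pi.add_apply, dx, dF]
    have h1 : ∀ i, (x i • an (Sum.inl i) : Op R n m) u 0 I = 0 := fun i => by
      simp [an_apply, hI i]
    have h2 : ∀ i, (sh i * dphi φ i : Op R n m) u 0 I = 0 := fun i => by
      rw [Op.mul_apply, sh_apply, dphi]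
      simp only [Op.sum_apply, Finset.sum_apply, Op.smul_apply, Pi.smul_apply, an_apply]
      refine Finset.sum_eq_zero fun g _ => ?_
      split_ifs
      · simp
      · have := symPart_next hu.1 i (I := insert (Sum.inr g) I)
          (fun j => Finset.mem_insert_of_mem (hI j)) 0
        rw [this]; simp
    simp only [Op.sum_apply, Finset.sum_apply, h1, h2, Finset.sum_const_zero, add_zero]
  · rcases lt_or_gt_of_ne hl with h' | h'
    · exact (raise_delta_up x φ).ge (symPart_ge hu) (by norm_num) a I h'
    · exact (raise_delta_down x φ).le (symPart_le hu) (by norm_num) a I h'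

lemma mu_delta {u : Full R n m} (hu : theta u = 0) :
    mu φ (delta x φ u) + dz x φ (mu φ u) = 0 := by
  have h := congrArg (fun A : Op R n m => A u) (mu_mul_dtot x φ)
  simp only [Op.mul_apply, Op.neg_apply, dtot, Op.add_apply, hu, zero_add] at h
  rw [h, neg_add_cancel]

/-- The preliminary homotopy contracting the total complex onto its Koszul part. -/
def hom : Op R n m := asm ((1 : R) • 1) (fun i => ri (x i) i * cr (Sum.inl i))
  (fun i => pr (x i) i * (cr (Sum.inl i) * pw φ i)) (List.finRange n)

lemma acm_hom : acm (dtot x φ) (hom x φ) = 1 - prAll x * Q φ := by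
  have hsingle : ∀ i, acm (dtot x φ) (ri (x i) i * cr (Sum.inl i)) =
      (1 : R) • 1 - pr (x i) i * (cr (Sum.inl i) * pw φ i) := by
    intro i
    rw [dtot_eq, acm_single (τ := fun i => ri (x i) i) (c := fun i => cr (Sum.inl i)) (r := 1) i
      (sh_mul_ri _ _) ?_ ?_ (fun j => ri_commute_pw _ _ _ _)
      (fun j hj => by rw [acm_pw_w, if_neg hj]) (by rw [acm_pw_w, if_pos rfl]) ?_,
      one_sub_ri_mul, one_smul]
    · exact fun j hj => (sh_commute_ri _ hj).add_left (smul_one_commute _ _)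
    · exact fun j => (sh_commute_cr _ _).add_left (smul_one_commute _ _)
    · rw [← neg_one_smul R, acm_smul_left, acm_mul_right, acm_dz_w, mul_zero, smul_zero]
      exact Commute.sum_right _ _ _ fun _ _ => (ri_commute_dphi _ _ _ _).smul_right _
  rw [hom, acm_asm (dtot_sq x φ) (smul_one_commute 1) hsingle, one_smul, one_pow,
    prod_map_mul_of_commute fun i j => (pr_commute_cr _ _ _).mul_right (pr_commute_pw _ _ _ _)]
  rfl

lemma raise_hom : Raise (lw 1 0 (-1)) 1 (hom x φ) :=
  Raise.asm _ _ (fun i => ((raise_ri _ _ _ _ (by norm_num) i).mul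
    (raise_cr_inl _ _ _ i)).mono (by norm_num)) fun i => ((raise_pr _ _ _ _ (by norm_num) i).mul
    (raise_w_pw _ _ _ φ (by norm_num) i)).mono (by norm_num)

lemma mu_hom : mu φ * hom x φ = 0 := by
  rw [mu, mul_assoc, hom, mul_asm_eq_zero (smul_one_commute 1), mul_zero]
  · intro i
    ext f a
    rw [Op.mul_apply, prAll_zero_apply]
    split_ifs with h
    · subst h
      simp [Op.mul_apply, ri_apply]
    · simp
  · intro i
    refine ⟨cr (Sum.inl i) * pw φ i, ?_⟩
    have e : (prAll (fun _ => 0) * pr (x i) i : Op R n m) = prAll (fun _ => 0) := by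
      ext f a
      rw [Op.mul_apply, prAll_zero_apply, prAll_zero_apply]
      split_ifs with h
      · subst h
        simp [pr_apply]
      · rfl
    rw [← mul_assoc, e]
    exact ((prAll_commute_cr _ _).mul_right ((prAll_commute_an _ _).add_right
      (prAll_commute_dphi _ _ _)))

theorem torsion {α : R} (hα : Contracts x φ α) {u κ : Full R n m}
    (hu : u ∈ symPart R n m) (hκ : κ ∈ koszulPart R n m) (h1 : delta x φ u = 0)
    (h2 : mu φ u + dz x φ κ = 0) :
    ∃ u' ∈ symPart R n m, ∃ κ' ∈ koszulPart R n m, delta x φ u' = α • u ∧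
      mu φ u' + dz x φ κ' = α • κ := by
  obtain ⟨T, S, hTS, hT, hS⟩ := hα
  have hdu : dtot x φ u = 0 := by rw [dtot, Op.add_apply, hu.1, h1, add_zero]
  set v := hom x φ u + prAll x κ with hv
  have hdv : dtot x φ v = u := by
    have e1 := congrArg (fun A : Op R n m => A u) (acm_hom x φ)
    simp only [acm, Op.mul_apply, Op.add_apply, hdu, map_zero, add_zero, Op.sub_apply,
      Op.one_apply] at e1
    have e2 := congrArg (fun A : Op R n m => A κ) (dtot_mul_prAll x φ)
    simp only [Op.mul_apply, Op.neg_apply] at e2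
    have e3 : prAll x (Q φ u) = prAll x (mu φ u) := by
      rw [← Op.mul_apply, ← Op.mul_apply, mu, ← mul_assoc, (prAll_commute_Q x φ).eq, mul_assoc,
        prAll_mul_prAll_zero]
    rw [hv, map_add, e1, e2, e3, eq_neg_of_add_eq_zero_left h2, map_neg]
    abel
  have hv1 : GE 1 v := fun a I hl => by
    have e1 := (raise_hom x φ).ge (symPart_ge hu) (D' := 1) (by norm_num) a I hl
    have e2 := (raise_prAll 1 0 (-1) x (by norm_num)).ge (koszulPart_ge hκ) (D' := 1)
      (by norm_num) a I hl
    simp [hv, e1, e2]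
  have hμv : mu φ v = κ := by
    have hc := koszulPart_corner hκ
    rw [hv, map_add, ← Op.mul_apply, ← Op.mul_apply, mu_hom, mu, mul_assoc, prAll_zero_mul_prAll,
      Op.mul_apply, prAll_of_corner hc, Q_apply_of_w φ _ (cr_of_corner hc)]
    simp
  set t := T v
  set s : Full R n m := fun a I => if 0 < lev a I then t a I else 0 with hs
  have hs1 : GE 1 s := fun a I hl => if_neg (by omega)
  have hts : LE 0 (t - s) := fun a I hl => by simp [hs, hl]
  set u' := α • v - dtot x φ s with hu'
  have hdu' : dtot x φ u' = α • u := by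
    rw [hu', map_sub, map_smul, hdv, ← Op.mul_apply, dtot_sq]; simp
  have hle : LE 0 u' := by
    have e : u' = S v + T u + dtot x φ (t - s) := by
      have e1 := congrArg (fun A : Op R n m => A v) hTS
      simp only [acm, Op.mul_apply, Op.add_apply, hdv, Op.sub_apply, Op.smul_apply,
        Op.one_apply] at e1
      rw [map_sub, hu']
      rw [eq_sub_iff_add_eq] at e1
      rw [← e1]; abel
    intro a I hl
    have e1 := hS v a I hl
    have e2 := hT u (symPart_le hu) a I hl
    have e3 := (((raise_theta (-1) 0 1).mono (by norm_num)).add (raise_delta_down x φ)).le hts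
      (D' := 0) (by norm_num) a I hl
    rw [e]
    simp only [Pi.add_apply, e1, e2, zero_add]
    exact e3
  have hδs : GE 1 (delta x φ s) := (raise_delta_up x φ).ge hs1 (by norm_num)
  have hval : ∀ a I, lev a I ≤ 0 → u' a I = - theta s a I := by
    intro a I hl
    have e1 := hv1 a I (by omega)
    have e2 := hδs a I (by omega)
    rw [hu', dtot]
    simp [e1, e2]
  have hge : GE 0 u' := by
    intro a I hl
    rw [hval a I hl.le, (raise_theta 1 0 (-1)).ge hs1 (D' := 0) (by norm_num) a I hl, neg_zero]
  have hδge : GE 0 (delta x φ u') := (raise_delta_up x φ).ge hge (by norm_num)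
  have hθ : theta u' = 0 := by
    ext a I
    by_cases hl : -1 < lev a I
    · exact (raise_theta (-1) 0 1).le hle (D' := -1) (by norm_num) a I hl
    · have e := congrFun (congrFun hdu' a) I
      have e1 := hδge a I (by omega)
      have e2 := symPart_ge hu a I (by omega)
      simpa [dtot, e1, e2] using e
  have hu'm : u' ∈ symPart R n m := by
    refine ⟨hθ, fun a I h => ?_⟩
    by_cases hl : lev a I = 0
    · rw [hval a I hl.le, theta_corner s a (h.resolve_left (not_not.2 hl)).2, neg_zero]
    · rcases lt_or_gt_of_ne hl with h' | h'
      · exact hge a I h'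
      · exact hle a I h'
  refine ⟨u', hu'm, - mu φ s, Submodule.neg_mem _ (mu_mem_of_ge φ hs1), ?_, ?_⟩
  · rw [dtot, Op.add_apply, hθ, zero_add] at hdu'
    exact hdu'
  · have e := congrArg (fun A : Op R n m => A s) (mu_mul_dtot x φ)
    simp only [Op.mul_apply, Op.neg_apply] at e
    rw [hu', map_sub, map_smul, hμv, e, map_neg]
    abel

end Torsion

section Acyclicity

open RingTheory.Sequence

variable {S : Type*} [CommRing S]

lemma isWeaklyRegular_of_flat (M : Type*) [AddCommGroup M] [Module S M] [Module.Flat S M]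
    {rs : List S} (h : IsWeaklyRegular S rs) : IsWeaklyRegular M rs :=
  ((TensorProduct.rid S M).isWeaklyRegular_congr rs).1 (h.isWeaklyRegular_lTensor (M₂ := M))

/-- A complex of modules vanishing above `m`, with a sequence `rs` regular on all its terms and
acting nilpotently on each homology class, is exact in degrees above `m - rs.length`. -/
theorem acyclic (rs : List S) : ∀ (M : ℕ → Type*) [∀ i, AddCommGroup (M i)]
    [∀ i, Module S (M i)] (d : ∀ i, M (i + 1) →ₗ[S] M i) (m : ℕ)
    (_ : ∀ i, d i ∘ₗ d (i + 1) = 0) (_ : ∀ i, m < i → Subsingleton (M i))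
    (_ : ∀ i, IsWeaklyRegular (M i) rs)
    (_ : ∀ a ∈ rs, ∀ z, ∃ N : ℕ, ∃ w, d 0 w = a ^ N • z)
    (_ : ∀ a ∈ rs, ∀ i z, d i z = 0 → ∃ N : ℕ, ∃ w, d (i + 1) w = a ^ N • z)
    (i : ℕ) (_ : m < i + 1 + rs.length) (z : M (i + 1)), d i z = 0 → ∃ w, d (i + 1) w = z := by
  induction rs with
  | nil =>
    intro M _ _ d m _ hm _ _ _ i hi z _
    have := hm (i + 1) (by simpa using hi)
    exact ⟨0, Subsingleton.elim _ _⟩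
  | cons a rs ih =>
    intro M _ _ d m hd hm hreg h0 hS i hi z hz
    have hreg' := fun i => (isWeaklyRegular_cons_iff (M i) a rs).1 (hreg i)
    have hmk : ∀ i (y : M i), (Submodule.Quotient.mk y : QuotSMulTop a (M i)) = 0 ↔
        ∃ y', a • y' = y := fun i y => by
      rw [Submodule.Quotient.mk_eq_zero, Submodule.mem_smul_pointwise_iff_exists]
      simp
    have hdd : ∀ i y, d i (d (i + 1) y) = 0 := fun i y => LinearMap.congr_fun (hd i) y
    have key := ih (fun i => QuotSMulTop a (M i)) (fun i => QuotSMulTop.map a (d i)) m ?_ ?_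
      (fun i => (hreg' i).2) ?_ ?_
    · obtain ⟨N, w, hw⟩ := hS a (by simp) i z hz
      induction N generalizing z w with
      | zero => exact ⟨w, by simpa using hw⟩
      | succ N ihN =>
        have hz' : d i (a ^ N • z) = 0 := by rw [map_smul, hz, smul_zero]
        obtain ⟨y, hy⟩ : ∃ y, d (i + 1) y = a ^ N • z := by
          have hcyc : QuotSMulTop.map a (d (i + 1)) (Submodule.Quotient.mk w) = 0 := by
            rw [QuotSMulTop.map_apply_mk, hmk]
            exact ⟨a ^ N • z, by rw [hw, smul_smul, pow_succ']⟩
          obtain ⟨v, hv⟩ := key (i + 1) (by simp at hi ⊢; omega) _ hcyc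
          obtain ⟨v, rfl⟩ := Submodule.Quotient.mk_surjective _ v
          rw [QuotSMulTop.map_apply_mk, ← sub_eq_zero, ← Submodule.Quotient.mk_sub, hmk] at hv
          obtain ⟨y, hy⟩ := hv
          refine ⟨-y, (hreg' (i + 1)).1 ?_⟩
          have := congrArg (d (i + 1)) hy
          rw [map_sub, hdd, map_smul, hw, zero_sub] at this
          simp only [map_neg, smul_neg, this, neg_neg, smul_smul, pow_succ']
        exact ihN z hz y hy
    · intro i
      ext y
      simp [hdd]
    · intro i hi
      have := hm i hi
      infer_instance
    · intro b hb z
      obtain ⟨z, rfl⟩ := Submodule.Quotient.mk_surjective _ z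
      obtain ⟨N, w, hw⟩ := h0 b (by simp [hb]) z
      exact ⟨N, Submodule.Quotient.mk w, by rw [QuotSMulTop.map_apply_mk, hw]; rfl⟩
    · intro b hb i z hz
      obtain ⟨z, rfl⟩ := Submodule.Quotient.mk_surjective _ z
      rw [QuotSMulTop.map_apply_mk, hmk] at hz
      obtain ⟨y, hy⟩ := hz
      have hb' : b ∈ a :: rs := by simp [hb]
      have hbound : ∃ N : ℕ, ∃ w, d i w = b ^ N • y := by
        cases i with
        | zero => exact h0 b hb' y
        | succ i =>
          refine hS b hb' i y ((hreg' i).1 ?_)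
          simp only
          rw [← map_smul, hy, hdd, smul_zero]
      obtain ⟨N, w, hw⟩ := hbound
      obtain ⟨N', w', hw'⟩ := hS b hb' i (b ^ N • z - a • w) (by
        rw [map_sub, map_smul, map_smul, hw, ← hy, smul_comm, sub_self])
      refine ⟨N' + N, Submodule.Quotient.mk w', ?_⟩
      rw [QuotSMulTop.map_apply_mk, hw', ← Submodule.Quotient.mk_smul, ← sub_eq_zero,
        ← Submodule.Quotient.mk_sub, hmk]
      refine ⟨- (b ^ N' • w), ?_⟩
      rw [smul_sub, smul_smul, pow_add, smul_neg, smul_comm a]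
      abel

end Acyclicity

section Grade

open RingTheory.Sequence Polynomial

/-- All the primes containing `I` have height at least `m`. -/
def HeightGE {R : Type*} [CommRing R] (I : Ideal R) (m : ℕ) : Prop :=
  ∀ P : Ideal R, P.IsPrime → I ≤ P → (m : ℕ∞) ≤ P.height

/-- The ideal contains a weakly regular sequence of length `m`. -/
def HasSeq {R : Type*} [CommRing R] (I : Ideal R) (m : ℕ) : Prop :=
  ∃ rs : List R, rs.length = m ∧ (∀ r ∈ rs, r ∈ I) ∧ IsWeaklyRegular R rs

variable {R S : Type*} [CommRing R] [CommRing S]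

lemma HeightGE.map (e : R ≃+* S) {I : Ideal R} {m : ℕ} (h : HeightGE I m) :
    HeightGE (I.map e) m := by
  intro P hP hI
  have := h (P.comap e) inferInstance (Ideal.map_le_iff_le_comap.1 hI)
  rwa [RingEquiv.height_comap] at this

lemma HasSeq.of_map (e : R ≃+* S) {I : Ideal R} {m : ℕ} (h : HasSeq (I.map e) m) :
    HasSeq I m := by
  obtain ⟨rs, hl, hI, hr⟩ := h
  refine ⟨rs.map e.symm, by simpa, fun r hr => ?_, ?_⟩
  · obtain ⟨s, hs, rfl⟩ := List.mem_map.1 hr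
    have := hI s hs
    rw [← Ideal.comap_symm] at this
    exact this
  · refine ((AddEquiv.isWeaklyRegular_congr (e := e.symm.toAddEquiv) ?_).1 hr)
    refine List.forall₂_map_right_iff.2 (List.forall₂_same.2 fun r _ x => ?_)
    exact map_mul e.symm r x

lemma hasSeq_zero (I : Ideal R) : HasSeq I 0 := ⟨[], rfl, by simp, .nil _ _⟩

lemma isWeaklyRegular_replicate_one (m : ℕ) (M : Type*) [AddCommGroup M] [Module R M] :
    IsWeaklyRegular M (List.replicate m (1 : R)) := by
  induction m generalizing M with
  | zero => exact .nil _ _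
  | succ m ih =>
    rw [List.replicate_succ, isWeaklyRegular_cons_iff]
    exact ⟨IsSMulRegular.one M, ih _⟩

lemma hasSeq_top (m : ℕ) : HasSeq (⊤ : Ideal R) m :=
  ⟨List.replicate m 1, by simp, by simp, isWeaklyRegular_replicate_one m R⟩

lemma HeightGE.ne_bot [IsDomain R] {I : Ideal R} {m : ℕ} (h : HeightGE I (m + 1)) : I ≠ ⊥ := by
  rintro rfl
  have := h ⊥ inferInstance le_rfl
  simp at this

lemma height_le_of_isIntegral [Algebra R S] [Algebra.IsIntegral R S] (P : Ideal S) [P.IsPrime] :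
    P.height ≤ (P.comap (algebraMap R S)).height := by
  let f : PrimeSpectrum S → PrimeSpectrum R := PrimeSpectrum.comap (algebraMap R S)
  have hf : StrictMono f := fun I J h => by
    have : I.asIdeal < J.asIdeal := h
    exact Ideal.IsIntegral.comap_lt_comap this
  have := Order.height_le_height_apply_of_strictMono f hf ⟨P, inferInstance⟩
  rw [← PrimeSpectrum.height_eq_orderHeight, ← PrimeSpectrum.height_eq_orderHeight] at this
  exact this

lemma isIntegral_quotient_of_monic {f : R[X]} (hf : f.Monic) {I : Ideal R[X]} (hI : f ∈ I) :
    Algebra.IsIntegral R (R[X] ⧸ I) := by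
  exact algebraMap_isIntegral_iff.1 (hf.quotient_isIntegral hI)

lemma heightGE_comap_C [IsNoetherianRing R] {I : Ideal R[X]} {f : R[X]} (hf : f.Monic)
    (hfI : f ∈ I) {m : ℕ} (h : HeightGE I (m + 1)) : HeightGE (I.comap Polynomial.C) m := by
  intro q hq hIq
  have := isIntegral_quotient_of_monic hf hfI
  obtain ⟨Q, -, hQ, hQq⟩ := Ideal.exists_ideal_over_prime_of_isIntegral (S := R[X] ⧸ I) q ⊥ (by
    refine le_trans (fun r hr => ?_) hIq
    have : Ideal.Quotient.mk I (Polynomial.C r) = 0 := hr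
    change Polynomial.C r ∈ I
    exact Ideal.Quotient.eq_zero_iff_mem.1 this)
  set P := Q.comap (Ideal.Quotient.mk I)
  have hIP : I ≤ P := fun r hr => by
    change Ideal.Quotient.mk I r ∈ Q
    rw [Ideal.Quotient.eq_zero_iff_mem.2 hr]; exact Q.zero_mem
  have hP : P.IsPrime := inferInstance
  have h1 := h P hP hIP
  have h2 := Ideal.height_le_height_add_one_of_mem (hIP hfI)
  have hint := isIntegral_quotient_of_monic hf (Ideal.mem_span_singleton_self f)
  have hker : RingHom.ker (Ideal.Quotient.mk (Ideal.span {f})) ≤ P := by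
    rw [Ideal.mk_ker, Ideal.span_singleton_le_iff_mem]; exact hIP hfI
  have hP' : (P.map (Ideal.Quotient.mk (Ideal.span {f}))).IsPrime :=
    Ideal.map_isPrime_of_surjective Ideal.Quotient.mk_surjective hker
  have h3 := height_le_of_isIntegral (R := R) (P.map (Ideal.Quotient.mk (Ideal.span {f})))
  have h4 : (P.map (Ideal.Quotient.mk (Ideal.span {f}))).comap
      (algebraMap R (R[X] ⧸ Ideal.span {f})) = q := by
    rw [← hQq]
    have : (P.map (Ideal.Quotient.mk (Ideal.span {f}))).comap (Ideal.Quotient.mk (Ideal.span {f}))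
        = P := by
      rw [Ideal.comap_map_of_surjective' _ Ideal.Quotient.mk_surjective, sup_eq_left.2 hker]
    ext r
    exact SetLike.ext_iff.1 this (Polynomial.C r)
  rw [h4] at h3
  have h5 := h1.trans (h2.trans (add_le_add_left h3 1))
  push_cast at h5
  exact (ENat.add_le_add_iff_right (by simp)).1 h5

lemma hasSeq_of_monic {I : Ideal R[X]} {f : R[X]} (hf : f.Monic)
    (hfI : f ∈ I) {m : ℕ} (h : HasSeq (I.comap Polynomial.C) m) : HasSeq I (m + 1) := by
  obtain ⟨rs, hl, hI, hr⟩ := h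
  refine ⟨rs.map Polynomial.C ++ [f], by simpa, ?_, ?_⟩
  · simp only [List.mem_append, List.mem_map, List.mem_singleton]
    rintro r (⟨s, hs, rfl⟩ | rfl)
    · exact hI s hs
    · exact hfI
  · rw [isWeaklyRegular_append_iff, isWeaklyRegular_singleton_iff]
    refine ⟨hr.of_flat (S := R[X]), ?_⟩
    rw [← Ideal.map_ofList]
    set J := Ideal.ofList rs
    rw [isSMulRegular_iff_right_eq_zero_of_smul]
    intro g hg
    obtain ⟨g, rfl⟩ := Submodule.Quotient.mk_surjective _ g
    rw [← Submodule.Quotient.mk_smul, Submodule.Quotient.mk_eq_zero] at hg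
    rw [Submodule.Quotient.mk_eq_zero]
    simp only [smul_eq_mul, Ideal.mul_top] at hg ⊢
    have e : ∀ p : R[X], p ∈ J.map Polynomial.C ↔ p.map (Ideal.Quotient.mk J) = 0 := fun p => by
      rw [Ideal.mem_map_C_iff, Polynomial.ext_iff]
      simp [Ideal.Quotient.eq_zero_iff_mem]
    rw [e, Polynomial.map_mul] at hg
    rw [e]
    by_contra h0
    exact h0 (((hf.map (Ideal.Quotient.mk J)).mul_right_eq_zero_iff).1 hg)

end Grade

section Shear

open Polynomial MvPolynomial Ideal Nat RingHom List

variable {k : Type*} [Field k] {n : ℕ} (f : MvPolynomial (Fin (n + 1)) k)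
variable (v w : Fin (n + 1) →₀ ℕ)

variable {f v} in
lemma lt_two_add_totalDegree (vlt : ∀ i, v i < (2 + f.totalDegree)) :
    ∀ l ∈ ofFn v, l < (2 + f.totalDegree) := by
  grind

lemma t1_comp_t1_neg (c : k) :
    (NoetherNormalization.T1 f c).comp (NoetherNormalization.T1 f (-c)) = AlgHom.id _ _ := by
  rw [comp_aeval, ← MvPolynomial.aeval_X_left]
  ext i v
  cases i using Fin.cases <;> simp

/-- The automorphism `X_i ↦ X_i + X_0 ^ (r ^ i)`, which makes `f` monic in `X_0` up to a unit. -/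
abbrev shear := AlgEquiv.ofAlgHom (NoetherNormalization.T1 f 1) (NoetherNormalization.T1 f (-1))
  (t1_comp_t1_neg f 1) (by simpa using t1_comp_t1_neg f (-1))

lemma sum_r_mul_ne (vlt : ∀ i, v i < (2 + f.totalDegree))
    (wlt : ∀ i, w i < (2 + f.totalDegree)) (ne : v ≠ w) :
    ∑ x : Fin (n + 1), (2 + f.totalDegree) ^ x.1 * v x ≠
      ∑ x : Fin (n + 1), (2 + f.totalDegree) ^ x.1 * w x := by
  intro h
  refine ne <| Finsupp.ext <| congrFun <| ofFn_inj.mp ?_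
  apply ofDigits_inj_of_len_eq (Nat.lt_add_right f.totalDegree one_lt_two)
    (by simp) (lt_two_add_totalDegree vlt) (lt_two_add_totalDegree wlt)
  simpa only [ofDigits_eq_sum_mapIdx, mapIdx_eq_ofFn, get_ofFn, length_ofFn,
    Fin.val_cast, mul_comm, sum_ofFn] using! h

lemma degreeOf_zero_shear {a : k} (ha : a ≠ 0) : ((shear f) (monomial v a)).degreeOf 0 =
    ∑ i : Fin (n + 1), (2 + f.totalDegree) ^ i.1 * v i := by
  rw [← natDegree_finSuccEquiv, monomial_eq, Finsupp.prod_pow v fun a ↦ X a]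
  simp only [Fin.prod_univ_succ, Fin.sum_univ_succ, map_mul, map_prod, map_pow,
    AlgEquiv.ofAlgHom_apply, MvPolynomial.aeval_C, MvPolynomial.aeval_X, if_pos, Fin.succ_ne_zero,
    ite_false, one_smul, map_add, finSuccEquiv_X_zero, finSuccEquiv_X_succ, algebraMap_eq]
  have h (i : Fin n) :
      (Polynomial.C (X (R := k) i) +
        Polynomial.X ^ (2 + f.totalDegree) ^ i.succ.1) ^ v i.succ ≠ 0 :=
    pow_ne_zero (v i.succ) (leadingCoeff_ne_zero.mp <| by simp [add_comm, leadingCoeff_X_pow_add_C])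
  rw [natDegree_mul (by simp [ha]) (mul_ne_zero (by simp) (Finset.prod_ne_zero_iff.mpr
    (fun i _ ↦ h i))), natDegree_mul (by simp) (Finset.prod_ne_zero_iff.mpr (fun i _ ↦ h i)),
    natDegree_prod _ _ (fun i _ ↦ h i), natDegree_finSuccEquiv, degreeOf_C]
  simpa only [natDegree_pow, zero_add, natDegree_X, mul_one, Fin.val_zero, pow_zero, one_mul,
    add_right_inj] using Finset.sum_congr rfl (fun i _ ↦ by
    rw [add_comm (Polynomial.C _), natDegree_X_pow_add_C, mul_comm])

/-- `shear f` maps different monomials of `f` to polynomials with different degrees in `X_0`. -/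
lemma degreeOf_shear_ne_of_ne (hv : v ∈ f.support) (hw : w ∈ f.support) (ne : v ≠ w) :
    (shear f <| monomial v <| coeff v f).degreeOf 0 ≠
    (shear f <| monomial w <| coeff w f).degreeOf 0 := by
  rw [degreeOf_zero_shear _ _ <| mem_support_iff.mp hv,
    degreeOf_zero_shear _ _ <| mem_support_iff.mp hw]
  refine sum_r_mul_ne f v w (fun i ↦ ?_) (fun i ↦ ?_) ne <;>
  exact lt_of_le_of_lt ((monomial_le_degreeOf i ‹_›).trans (degreeOf_le_totalDegree f i))
    (by lia)

lemma leadingCoeff_finSuccEquiv_shear :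
    (finSuccEquiv k n ((shear f) ((monomial v) (coeff v f)))).leadingCoeff =
    algebraMap k _ (coeff v f) := by
  rw [monomial_eq, Finsupp.prod_fintype]
  · simp only [map_mul, map_prod, leadingCoeff_mul, leadingCoeff_prod]
    rw [AlgEquiv.ofAlgHom_apply, algHom_C, algebraMap_eq, finSuccEquiv_apply,
      eval₂Hom_C, coe_comp]
    simp only [AlgEquiv.ofAlgHom_apply, Function.comp_apply, leadingCoeff_C, map_pow,
      leadingCoeff_pow, algebraMap_eq]
    have : ∀ j, ((finSuccEquiv k n) ((NoetherNormalization.T1 f) 1 (X j))).leadingCoeff = 1 :=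
        fun j ↦ by
      by_cases h : j = 0
      · simp [h, finSuccEquiv_apply]
      · simp only [aeval_eq_bind₁, bind₁_X_right, if_neg h, one_smul, map_add, map_pow]
        obtain ⟨i, rfl⟩ := Fin.exists_succ_eq.mpr h
        simp [finSuccEquiv_X_succ, finSuccEquiv_X_zero, add_comm]
    simp only [this, one_pow, Finset.prod_const_one, mul_one]
  exact fun i ↦ pow_zero _

/-- `shear f` maps `f` into some polynomial in `X_0` whose leading coefficient is invertible. -/
lemma shear_leadingCoeff_isUnit (fne : f ≠ 0) :
    IsUnit (finSuccEquiv k n (shear f f)).leadingCoeff := by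
  obtain ⟨v, vin, vs⟩ := Finset.exists_max_image f.support
    (fun v ↦ (shear f ((monomial v) (coeff v f))).degreeOf 0) (support_nonempty.mpr fne)
  set h := fun w ↦ (MvPolynomial.monomial w) (coeff w f)
  simp only [← natDegree_finSuccEquiv] at vs
  replace vs : ∀ x ∈ f.support \ {v}, (finSuccEquiv k n ((shear f) (h x))).degree <
      (finSuccEquiv k n ((shear f) (h v))).degree := by
    intro x hx
    obtain ⟨h1, h2⟩ := Finset.mem_sdiff.mp hx
    apply degree_lt_degree <| lt_of_le_of_ne (vs x h1) ?_
    simpa only [natDegree_finSuccEquiv]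
      using degreeOf_shear_ne_of_ne f _ _ h1 vin <| ne_of_not_mem_cons h2
  have coeff : (finSuccEquiv k n ((shear f) (h v + ∑ x ∈ f.support \ {v}, h x))).leadingCoeff =
      (finSuccEquiv k n ((shear f) (h v))).leadingCoeff := by
    simp only [map_add, map_sum]
    rw [add_comm]
    apply leadingCoeff_add_of_degree_lt <| (lt_of_le_of_lt <| degree_sum_le _ _) ?_
    have h2 : h v ≠ 0 := by simpa [h] using mem_support_iff.mp vin
    replace h2 : (finSuccEquiv k n ((shear f) (h v))) ≠ 0 := fun eq ↦ h2 <|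
      by simpa only [map_eq_zero_iff _ (AlgEquiv.injective _)] using eq
    exact (Finset.sup_lt_iff <| Ne.bot_lt (fun x ↦ h2 <| degree_eq_bot.mp x)).mpr vs
  nth_rw 2 [← f.support_sum_monomial_coeff]
  rw [Finset.sum_eq_add_sum_sdiff_singleton_of_mem vin h]
  rw [leadingCoeff_finSuccEquiv_shear] at coeff
  simpa only [coeff, algebraMap_eq] using (mem_support_iff.mp vin).isUnit.map MvPolynomial.C

end Shear

section GradeMv

/-- In a polynomial ring over a field, an ideal of height at least `m` contains a weakly regular
sequence of length `m`. -/
lemma HeightGE.hasSeq {k : Type*} [Field k] {N m : ℕ} {I : Ideal (MvPolynomial (Fin N) k)}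
    (h : HeightGE I m) : HasSeq I m := by
  induction N generalizing m with
  | zero =>
    cases m with
    | zero => exact hasSeq_zero I
    | succ m =>
      let e := (MvPolynomial.isEmptyAlgEquiv k (Fin 0)).toRingEquiv
      refine HasSeq.of_map e ?_
      rcases Ideal.eq_bot_or_top (I.map e) with h' | h'
      · exact absurd h' (h.map e).ne_bot
      · rw [h']; exact hasSeq_top _
  | succ N ih =>
    cases m with
    | zero => exact hasSeq_zero I
    | succ m =>
      obtain ⟨f, hfI, hf⟩ := Submodule.exists_mem_ne_zero_of_ne_bot h.ne_bot
      let e := ((shear f).trans (MvPolynomial.finSuccEquiv k N)).toRingEquiv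
      have hu : IsUnit (e f).leadingCoeff := shear_leadingCoeff_isUnit f hf
      refine HasSeq.of_map e ?_
      have hmon := Polynomial.monic_of_isUnit_leadingCoeff_inv_smul hu
      have hmem : hu.unit⁻¹ • e f ∈ I.map e := by
        rw [Units.smul_def, Polynomial.smul_eq_C_mul]
        exact Ideal.mul_mem_left _ _ (Ideal.mem_map_of_mem e hfI)
      exact hasSeq_of_monic hmon hmem (ih (heightGE_comap_C hmon hmem (h.map e)))

lemma HeightGE.hasSeq_of_fintype {k σ : Type*} [Field k] [Fintype σ] {m : ℕ}
    {I : Ideal (MvPolynomial σ k)} (h : HeightGE I m) : HasSeq I m :=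
  HasSeq.of_map (MvPolynomial.renameEquiv k (Fintype.equivFin σ)).toRingEquiv
    (HeightGE.hasSeq (h.map _))

end GradeMv

section Homogeneous

variable {R : Type*} [CommRing R] {n m : ℕ} {Γ : Type*} [AddCommGroup Γ]
variable (ℳ : Γ → AddSubgroup R)

/-- The weight of an index. -/
def wt (β γ : Γ) (I : Finset (Ferm n m)) : Γ := I.toLeft.card • β + I.toRight.card • γ

/-- The coefficients of the element are homogeneous, relative to a weight on the indices. -/
def InH (w : Finset (Ferm n m) → Γ) (d : Γ) (f : Full R n m) : Prop :=
  ∀ a I, f a I ∈ ℳ (d - w I)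

/-- The operator shifts the degree by `s`. -/
def Hom (w : Finset (Ferm n m) → Γ) (s : Γ) (A : Op R n m) : Prop :=
  ∀ d f, InH ℳ w d f → InH ℳ w (d + s) (A f)

variable {ℳ}

lemma sg_mul_mem {r : R} {N : AddSubgroup R} (i : Ferm n m) (I) (h : r ∈ N) :
    sg R i I * r ∈ N := by
  rcases neg_one_pow_eq_or R (I.filter fun k => rk k < rk i).card with h' | h' <;>
    rw [sg, h'] <;> simpa

lemma wt_insert_inl {β γ : Γ} {i : Fin n} {I : Finset (Ferm n m)} (h : Sum.inl i ∉ I) :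
    wt β γ (insert (Sum.inl i) I) = wt β γ I + β := by
  simp only [wt, toLeft_card_insert_inl h, Finset.toRight_insert_inl, succ_nsmul]; abel

lemma wt_insert_inr {β γ : Γ} {g : Fin m} {I : Finset (Ferm n m)} (h : Sum.inr g ∉ I) :
    wt β γ (insert (Sum.inr g) I) = wt β γ I + γ := by
  simp only [wt, toRight_card_insert_inr h, Finset.toLeft_insert_inr, succ_nsmul]; abel

namespace Hom

variable {w : Finset (Ferm n m) → Γ} {s t : Γ} {A B : Op R n m} {β γ : Γ}

lemma add (hA : Hom ℳ w s A) (hB : Hom ℳ w s B) : Hom ℳ w s (A + B) :=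
  fun d f hf a I => add_mem (hA d f hf a I) (hB d f hf a I)

lemma zero : Hom ℳ w s (0 : Op R n m) := fun _ _ _ _ _ => zero_mem _

lemma one : Hom ℳ w 0 (1 : Op R n m) := fun d f hf a I => by simpa using hf a I

lemma mul (hA : Hom ℳ w s A) (hB : Hom ℳ w t B) : Hom ℳ w (s + t) (A * B) :=
  fun d f hf => by
    have := hA _ _ (hB d f hf)
    rwa [add_assoc, add_comm t] at this

lemma sum {ι : Type*} {S : Finset ι} {A : ι → Op R n m} (h : ∀ i ∈ S, Hom ℳ w s (A i)) :
    Hom ℳ w s (∑ i ∈ S, A i) := by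
  classical
  induction S using Finset.induction_on with
  | empty => simpa using zero
  | insert i S hi ih =>
    rw [Finset.sum_insert hi]
    exact (h i (by simp)).add (ih fun j hj => h j (by simp [hj]))

lemma list_prod {ι : Type*} {l : List ι} {A : ι → Op R n m} (h : ∀ i, Hom ℳ w 0 (A i)) :
    Hom ℳ w 0 (l.map A).prod := by
  induction l with
  | nil => exact one
  | cons i l ih => simpa using (h i).mul ih

lemma smul {c : R} (hc : ∀ d r, r ∈ ℳ d → c * r ∈ ℳ (d + t)) (hA : Hom ℳ w s A) :
    Hom ℳ w (s + t) (c • A) := fun d f hf a I => by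
  have := hc _ _ (hA d f hf a I)
  rwa [show d + s - w I + t = d + (s + t) - w I by abel] at this

lemma asm {ι : Type*} {q r : ι → Op R n m} (hr : ∀ i, Hom ℳ w s (r i)) (hq : ∀ i, Hom ℳ w 0 (q i))
    (l : List ι) : Hom ℳ w s (asm ((1 : R) • 1) r q l) := by
  induction l with
  | nil => exact zero
  | cons i l ih =>
    have := (hq i).mul ih
    rw [zero_add] at this
    rw [Residual.asm, one_smul, one_pow, one_mul]
    rw [one_smul] at this
    exact (hr i).add this

lemma an_inl (i : Fin n) : Hom ℳ (wt β γ) (-β) (an (Sum.inl i) : Op R n m) := by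
  intro d f hf a I
  rw [an_apply]
  split_ifs with h
  · exact zero_mem _
  · refine sg_mul_mem _ _ ?_
    have := hf a (insert (Sum.inl i) I)
    rwa [wt_insert_inl h, show d - (wt β γ I + β) = d + -β - wt β γ I by abel] at this

lemma an_inr (g : Fin m) : Hom ℳ (wt β γ) (-γ) (an (Sum.inr g) : Op R n m) := by
  intro d f hf a I
  rw [an_apply]
  split_ifs with h
  · exact zero_mem _
  · refine sg_mul_mem _ _ ?_
    have := hf a (insert (Sum.inr g) I)
    rwa [wt_insert_inr h, show d - (wt β γ I + γ) = d + -γ - wt β γ I by abel] at this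

lemma cr_inl (i : Fin n) : Hom ℳ (wt β γ) β (cr (Sum.inl i) : Op R n m) := by
  intro d f hf a I
  rw [cr_apply]
  split_ifs with h
  · refine sg_mul_mem _ _ ?_
    have := hf a (I.erase (Sum.inl i))
    have h2 := wt_insert_inl (β := β) (γ := γ) (Finset.notMem_erase (Sum.inl i) I)
    rw [Finset.insert_erase h] at h2
    rwa [h2, show d + β - (wt β γ (I.erase (Sum.inl i)) + β) =
      d - wt β γ (I.erase (Sum.inl i)) by abel]
  · exact zero_mem _

lemma sh (i : Fin n) : Hom ℳ w 0 (sh i : Op R n m) := by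
  intro d f hf a I
  rw [sh_apply, add_zero]
  exact hf _ _

lemma neg_zero_pow_mul_mem {N : AddSubgroup R} (k : ℕ) {r : R} (h : r ∈ N) :
    (-(0 : R)) ^ k * r ∈ N := by
  rcases k with _ | k
  · simpa
  · simp

lemma ri (i : Fin n) : Hom ℳ w 0 (ri 0 i : Op R n m) := by
  intro d f hf a I
  rw [ri_apply, add_zero, Finset.sum_apply]
  exact sum_mem fun t _ => neg_zero_pow_mul_mem _ (hf _ _)

lemma pr (i : Fin n) : Hom ℳ w 0 (pr 0 i : Op R n m) := by
  intro d f hf a I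
  rw [pr_apply, add_zero]
  exact neg_zero_pow_mul_mem _ (hf _ _)

lemma theta : Hom ℳ (wt β γ) (-β) (theta : Op R n m) := by
  refine sum fun i _ => ?_
  rw [← zero_add (-β)]
  exact (sh i).mul (an_inl i)

variable {x : Fin n → R} {φ : Matrix (Fin n) (Fin m) R} {ξ η τ : Γ}

lemma dphi (hφ : ∀ i g d r, r ∈ ℳ d → φ i g * r ∈ ℳ (d + η)) (i : Fin n) :
    Hom ℳ (wt β γ) (-γ + η) (dphi φ i) := sum fun g _ => (an_inr g).smul (hφ i g)

lemma delta (hx : ∀ i d r, r ∈ ℳ d → x i * r ∈ ℳ (d + ξ))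
    (hφ : ∀ i g d r, r ∈ ℳ d → φ i g * r ∈ ℳ (d + η)) :
    Hom ℳ (wt (ξ - τ) (η - τ)) τ (delta x φ) := by
  refine add (sum fun i _ => ?_) (sum fun i _ => ?_)
  · have := (an_inl (ℳ := ℳ) (m := m) (β := ξ - τ) (γ := η - τ) i).smul (hx i)
    rwa [show -(ξ - τ) + ξ = τ by abel] at this
  · have := (sh (w := wt (ξ - τ) (η - τ)) i).mul (dphi (β := ξ - τ) (γ := η - τ) hφ i)
    rwa [show 0 + (-(η - τ) + η) = τ by abel] at this

lemma dz (hx : ∀ i d r, r ∈ ℳ d → x i * r ∈ ℳ (d + ξ))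
    (hφ : ∀ i g d r, r ∈ ℳ d → φ i g * r ∈ ℳ (d + η)) :
    Hom ℳ (wt β (ξ + η - τ)) τ (dz x φ) := by
  refine sum fun i _ => ?_
  have := (dphi (β := β) (γ := ξ + η - τ) hφ i).smul (hx i)
  rwa [show -(ξ + η - τ) + η + ξ = τ by abel] at this

lemma Q (hφ : ∀ i g d r, r ∈ ℳ d → φ i g * r ∈ ℳ (d + η)) :
    Hom ℳ (wt β (β + η)) 0 (Q φ) := by
  refine list_prod fun i => ?_
  rw [show (0 : Γ) = β + -β by abel]
  refine (cr_inl i).mul ((an_inl i).add ?_)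
  have := dphi (β := β) (γ := β + η) hφ i
  rwa [show -(β + η) + η = -β by abel] at this

end Hom

end Homogeneous

section Basis

variable {R : Type*} [CommRing R] {n m : ℕ}

/-- The contracting homotopy for `theta` along a list of variables. -/
def homL (l : List (Fin n)) : Op R n m := asm ((1 : R) • 1) (fun i => ri 0 i * cr (Sum.inl i))
  (fun i => pr 0 i * (cr (Sum.inl i) * an (Sum.inl i))) l

lemma homL_cons_apply (i : Fin n) (l : List (Fin n)) (f : Full R n m) (a I) :
    homL (i :: l) f a I = (if Sum.inl i ∈ I then sg R (Sum.inl i) I *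
      ∑ t ∈ Finset.range (a i), (-0) ^ (a i - 1 - t) * f (Function.update a i t)
        (I.erase (Sum.inl i)) else 0) + if Sum.inl i ∈ I ∧ a i = 0 then homL l f a I else 0 := by
  have : homL (i :: l) = ri 0 i * cr (Sum.inl i) + pr 0 i * (cr (Sum.inl i) * an (Sum.inl i)) *
      (homL l : Op R n m) := by
    rw [homL, asm, one_smul, one_pow, one_mul]; rw [homL, one_smul]
  rw [this, Op.add_apply, Pi.add_apply, Pi.add_apply]
  simp only [Op.mul_apply, ri_apply, pr_apply, Finset.sum_apply, Pi.smul_apply, cr_apply,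
      an_apply, smul_eq_mul]
  by_cases hi : Sum.inl i ∈ I
  · simp only [hi, if_true, true_and, Finset.notMem_erase, if_false, Finset.insert_erase,
      Finset.mul_sum]
    congr 1
    · exact Finset.sum_congr rfl fun t _ => by ring
    · rw [sg_erase_self, ← mul_assoc (sg R _ _), sg_mul_self, one_mul]
      split_ifs with h0
      · rw [h0, pow_zero, one_mul, ← h0, Function.update_eq_self]
      · rw [neg_zero, zero_pow h0, zero_mul]
  · simp [hi]

/-- The contracting homotopy for `theta`. -/
def hom0 : Op R n m := hom 0 0

lemma hom0_eq : (hom0 : Op R n m) = homL (List.finRange n) := by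
  simp [hom0, homL, hom, pw, dphi]

lemma Hom.hom0 {Γ : Type*} [AddCommGroup Γ] {ℳ : Γ → AddSubgroup R} {β γ : Γ} :
    Hom ℳ (wt β γ) β (hom0 : Op R n m) := by
  rw [hom0_eq]
  refine Hom.asm (fun i => ?_) (fun i => ?_) _
  · have := (Hom.ri i).mul (Hom.cr_inl (m := m) (ℳ := ℳ) (β := β) (γ := γ) i)
    rwa [zero_add] at this
  · rw [show (0 : Γ) = 0 + (β + -β) by abel]
    exact (Hom.pr i).mul ((Hom.cr_inl i).mul (Hom.an_inl i))

lemma acm_hom0 {f : Full R n m} (hf : ∀ a I, IsCorner a I → f a I = 0) :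
    theta (hom0 f) + hom0 (theta f) = f := by
  have h := congrArg (fun A : Op R n m => A f) (acm_hom (0 : Fin n → R) (0 : Matrix _ (Fin m) R))
  have h1 : (dtot 0 0 : Op R n m) = theta := by simp [dtot, delta, dx, dF, dphi]
  have h2 : (Q (0 : Matrix (Fin n) (Fin m) R)) f = fun a I => if ∀ i, Sum.inl i ∈ I then f a I
      else 0 := by
    have key : ∀ l : List (Fin n), ((l.map fun i => cr (Sum.inl i) * pw 0 i).prod : Op R n m) f =
        fun a I => if ∀ i ∈ l, Sum.inl i ∈ I then f a I else 0 := by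
      intro l
      induction l with
      | nil => simp
      | cons i l ih =>
        have : (pw (0 : Matrix (Fin n) (Fin m) R) i) = an (Sum.inl i) := by simp [pw, dphi]
        rw [List.map_cons, List.prod_cons, Op.mul_apply, ih, this, Op.mul_apply]
        ext a I
        rw [cr_apply, an_apply]
        by_cases hi : Sum.inl i ∈ I
        · simp only [hi, if_true, Finset.notMem_erase, if_false, Finset.insert_erase]
          rw [← mul_assoc, ← sg_erase_self, sg_mul_self]
          simp [hi]
        · simp [hi]
    rw [Q, key]; simp
  have h3 : (prAll 0 : Op R n m) (Q 0 f) = 0 := by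
    ext a I
    rw [show (0 : Fin n → R) = fun _ => 0 from rfl, prAll_zero_apply, h2]
    split_ifs with ha
    · by_cases hI : ∀ i, Sum.inl i ∈ I
      · simpa [hI] using hf a I ⟨ha, hI⟩
      · simp [hI]
    · rfl
  simp only [acm, h1, Op.add_apply, Op.mul_apply, Op.sub_apply, Op.one_apply, h3, sub_zero] at h
  exact h

/-- The indices of the generators of the symmetric strand, relative to a list of variables. -/
def TargetL (a : Fin n → ℕ) (I : Finset (Ferm n m)) : List (Fin n) → Prop
  | [] => False
  | i :: l => Sum.inl i ∉ I ∨ (Sum.inl i ∈ I ∧ a i = 0 ∧ TargetL a I l)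

/-- The indices of the generators of the symmetric strand. -/
def Target (a : Fin n → ℕ) (I : Finset (Ferm n m)) : Prop := TargetL a I (List.finRange n)

lemma homL_of_target (f : Full R n m) (l : List (Fin n)) (a I) (h : TargetL a I l) :
    homL l f a I = 0 := by
  induction l with
  | nil => rfl
  | cons i l ih =>
    rw [homL_cons_apply]
    rcases h with h | ⟨h, h0, h'⟩
    · simp [h]
    · simp [h0, ih h']

lemma homL_eq_zero (f : Full R n m) (l : List (Fin n)) (hl : l.Nodup) (a I)
    (h : ∀ b K, (∀ k, k ∉ l → b k = a k ∧ (Sum.inl k ∈ K ↔ Sum.inl k ∈ I)) → TargetL b K l →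
      f b K = 0) : homL l f a I = 0 := by
  induction l with
  | nil => rfl
  | cons i l ih =>
    rw [homL_cons_apply, Finset.sum_eq_zero, mul_zero, ite_self, zero_add]
    · split_ifs with hi
      · refine ih hl.of_cons fun b K hk hb => h b K (fun k hk' => hk k fun h' => hk' (by simp [h']))
          (Or.inr ?_)
        obtain ⟨h1, h2⟩ := hk i (List.nodup_cons.1 hl).1
        exact ⟨h2.2 hi.1, h1.trans hi.2, hb⟩
      · rfl
    · intro t _
      rw [h, mul_zero]
      · intro k hk
        have : k ≠ i := fun h' => hk (by simp [h'])
        simp [this]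
      · exact Or.inl (by simp)

lemma hom0_of_target (f : Full R n m) (a I) (h : Target a I) : hom0 f a I = 0 := by
  rw [hom0_eq]; exact homL_of_target f _ a I h

lemma hom0_congr {f g : Full R n m} (h : ∀ a I, Target a I → f a I = g a I) :
    hom0 f = hom0 g := by
  rw [← sub_eq_zero, ← map_sub]
  ext a I
  rw [hom0_eq]
  exact homL_eq_zero _ _ (List.nodup_finRange n) _ _ fun b K _ hb => sub_eq_zero.2 (h b K hb)

lemma Target.not_corner {a : Fin n → ℕ} {I : Finset (Ferm n m)} (h : Target a I) :
    ¬ IsCorner a I := by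
  rintro ⟨-, h'⟩
  have key : ∀ l, ¬ TargetL a I l := by
    intro l
    induction l with
    | nil => exact id
    | cons i l ih => rintro (h | h); exacts [h (h' i), ih h.2.2]
  exact key _ h

end Basis

section Complex

open Classical in
/-- Extension by zero of a family of coefficients. -/
def extend {R : Type*} [CommRing R] {n m : ℕ} (P : (Fin n → ℕ) × Finset (Ferm n m) → Prop) :
    ({t // P t} → R) →ₗ[R] Full R n m where
  toFun s a I := if h : P (a, I) then s ⟨(a, I), h⟩ else 0
  map_add' s t := by ext a I; simp only [Pi.add_apply]; split_ifs <;> simp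
  map_smul' c s := by ext a I; simp only [Pi.smul_apply]; split_ifs <;> simp

variable {R : Type*} [CommRing R] {n m : ℕ}

lemma extend_apply {P : (Fin n → ℕ) × Finset (Ferm n m) → Prop} (s : {t // P t} → R)
    (t : {t // P t}) : extend P s t.1.1 t.1.2 = s t := dif_pos t.2

lemma extend_apply_of_not {P : (Fin n → ℕ) × Finset (Ferm n m) → Prop} (s : {t // P t} → R)
    (a I) (h : ¬ P (a, I)) : extend P s a I = 0 := dif_neg h

/-- The indices of the generators of the symmetric strand. -/
def IsSym (t : (Fin n → ℕ) × Finset (Ferm n m)) : Prop := lev t.1 t.2 = 0 ∧ Target t.1 t.2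

/-- The indices of the generators of the Koszul strand. -/
def IsKos (t : (Fin n → ℕ) × Finset (Ferm n m)) : Prop := 0 < lev t.1 t.2 ∧ IsCorner t.1 t.2

/-- The generators of the resolution. -/
abbrev Gen (n m : ℕ) : Type :=
  {t : (Fin n → ℕ) × Finset (Ferm n m) // IsSym t} ⊕
    {t : (Fin n → ℕ) × Finset (Ferm n m) // IsKos t}

/-- The symmetric component of an element given by its coefficients. -/
def toSym : (Gen n m → R) →ₗ[R] Full R n m where
  toFun z := theta (hom0 (extend IsSym fun t => z (Sum.inl t)))
  map_add' y z := by
    rw [← map_add, ← map_add, ← map_add]; rfl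
  map_smul' c z := by
    rw [RingHom.id_apply, ← map_smul, ← map_smul, ← map_smul]; rfl

/-- The Koszul component of an element given by its coefficients. -/
def toKos : (Gen n m → R) →ₗ[R] Full R n m where
  toFun z := extend IsKos fun t => z (Sum.inr t)
  map_add' y z := by rw [← map_add]; rfl
  map_smul' c z := by rw [RingHom.id_apply, ← map_smul]; rfl

/-- The coefficients of a pair. -/
def coef (u κ : Full R n m) : Gen n m → R :=
  Sum.elim (fun t => u t.1.1 t.1.2) (fun t => κ t.1.1 t.1.2)

lemma toSym_apply (z : Gen n m → R) :
    toSym z = theta (hom0 (extend IsSym fun t => z (Sum.inl t))) := rfl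

lemma toKos_apply (z : Gen n m → R) : toKos z = extend IsKos fun t => z (Sum.inr t) := rfl

lemma raise_hom0 : Raise (lw (-1) 0 1) (-1) (hom0 : Op R n m) := by
  refine Raise.asm _ _ (fun i => ?_) fun i => ?_
  · have h : Raise (lw (-1) 0 1) (-1) (ri 0 i : Op R n m) := by
      intro f D hf a I hw
      simp only [ri_apply, Finset.sum_apply, Pi.smul_apply, smul_eq_mul]
      refine Finset.sum_eq_zero fun t ht => ?_
      rw [Finset.mem_range] at ht
      by_cases h : a i - 1 - t = 0
      · rw [hf, mul_zero]
        have := sum_update a i t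
        simp only [lw] at hw ⊢
        omega
      · simp [h]
    exact (h.mul (raise_cr_inl _ _ _ i)).mono (by norm_num)
  · have h : Raise (lw (-1) 0 1) 0 (pr 0 i : Op R n m) := by
      intro f D hf a I hw
      simp only [pr_apply, Pi.smul_apply, smul_eq_mul]
      by_cases h : a i = 0
      · rw [← h, Function.update_eq_self, hf _ _ (by linarith), mul_zero]
      · simp [h]
    have h2 : Raise (lw (-1) 0 1) 0 (cr (Sum.inl i) * pw (0 : Matrix _ (Fin m) R) i) := by
      have : pw (0 : Matrix (Fin n) (Fin m) R) i = an (Sum.inl i) := by simp [pw, dphi]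
      rw [this]
      exact ((raise_cr_inl _ _ _ i).mul (raise_an_inl _ _ _ i)).mono (by norm_num)
    exact (h.mul h2).mono (by norm_num)

lemma toSym_mem (z : Gen n m → R) : toSym z ∈ symPart R n m := by
  refine ⟨?_, fun a I h => ?_⟩
  · rw [toSym_apply, ← Op.mul_apply, theta_sq]; rfl
  rcases h with h | h
  · rw [toSym_apply]
    have hz : ∀ a I, lev a I ≠ 0 → extend IsSym (fun t => z (Sum.inl t)) a I = 0 :=
      fun a I h => extend_apply_of_not _ _ _ fun h' => h h'.1
    rcases lt_or_gt_of_ne h with h | h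
    · exact (raise_theta 1 0 (-1)).ge ((raise_hom 0 0).ge (D := 0) (D' := 1)
        (fun a I h => hz a I h.ne) (by norm_num)) (D' := 0) (by norm_num) a I h
    · exact (raise_theta (-1) 0 1).le (raise_hom0.le (D := 0) (D' := 1)
        (fun a I h => hz a I h.ne') (by norm_num)) (D' := 0) (by norm_num) a I h
  · exact theta_corner _ _ h.2

lemma toKos_mem (z : Gen n m → R) : toKos z ∈ koszulPart R n m :=
  fun a I h => extend_apply_of_not (fun t => z (Sum.inr t)) a I h

lemma toSym_coef {u : Full R n m} (hu : u ∈ symPart R n m) (κ : Full R n m) :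
    toSym (coef u κ) = u := by
  have h1 : hom0 (extend IsSym fun t => coef u κ (Sum.inl t)) = hom0 u := by
    refine hom0_congr fun a I ht => ?_
    by_cases hl : lev a I = 0
    · exact extend_apply (fun t => coef u κ (Sum.inl t)) ⟨(a, I), hl, ht⟩
    · rw [hu.2 a I (Or.inl hl)]
      exact extend_apply_of_not _ _ _ fun h => hl h.1
  have h2 := acm_hom0 (f := u) fun a I h => hu.2 a I (Or.inr h)
  rw [hu.1, map_zero, add_zero] at h2
  rw [toSym_apply, h1, h2]

lemma toKos_coef (u : Full R n m) {κ : Full R n m} (hκ : κ ∈ koszulPart R n m) :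
    toKos (coef u κ) = κ := by
  ext a I
  by_cases h : IsKos (a, I)
  · exact extend_apply (fun t => coef u κ (Sum.inr t)) ⟨(a, I), h⟩
  · rw [toKos_apply, extend_apply_of_not _ _ _ h, hκ a I h]

lemma coef_to (z : Gen n m → R) : coef (toSym z) (toKos z) = z := by
  ext (t | t)
  · have h := acm_hom0 (f := extend IsSym fun t => z (Sum.inl t)) fun a I h =>
      extend_apply_of_not _ _ _ fun h' => h'.2.not_corner h
    have h1 := congrFun (congrFun h t.1.1) t.1.2
    rw [Pi.add_apply, Pi.add_apply, hom0_of_target _ _ _ t.2.2, add_zero, extend_apply] at h1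
    exact h1
  · exact extend_apply (fun t => z (Sum.inr t)) t

variable (x : Fin n → R) (φ : Matrix (Fin n) (Fin m) R)

/-- The differential of the resolution, in terms of coefficients. -/
def diff : (Gen n m → R) →ₗ[R] (Gen n m → R) where
  toFun z := coef (delta x φ (toSym z)) (mu φ (toSym z) + dz x φ (toKos z))
  map_add' y z := by
    ext (t | t)
    · simp [coef]
    · simp only [coef, map_add, Sum.elim_inr, Pi.add_apply]; ring
  map_smul' c z := by
    ext (t | t)
    · simp [coef]
    · simp only [coef, map_smul, Sum.elim_inr, Pi.add_apply, Pi.smul_apply, RingHom.id_apply,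
        smul_eq_mul]; ring

lemma diff_apply (z : Gen n m → R) :
    diff x φ z = coef (delta x φ (toSym z)) (mu φ (toSym z) + dz x φ (toKos z)) := rfl

lemma toSym_diff (z : Gen n m → R) : toSym (diff x φ z) = delta x φ (toSym z) :=
  toSym_coef (delta_mem x φ (toSym_mem z)) _

lemma toKos_diff (z : Gen n m → R) :
    toKos (diff x φ z) = mu φ (toSym z) + dz x φ (toKos z) :=
  toKos_coef _ (add_mem (mu_mem φ (toSym_mem z)) (dz_mem x φ (toKos_mem z)))

lemma diff_diff (z : Gen n m → R) : diff x φ (diff x φ z) = 0 := by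
  rw [diff_apply, toSym_diff, toKos_diff, map_add, ← add_assoc, mu_delta x φ (toSym_mem z).1,
    ← Op.mul_apply, delta_sq, ← Op.mul_apply, dz_sq]
  ext (t | t) <;> simp [coef]

lemma diff_torsion {α : R} (hα : Contracts x φ α) {z : Gen n m → R} (hz : diff x φ z = 0) :
    ∃ w, diff x φ w = α • z := by
  have h1 := toSym_diff x φ z
  have h2 := toKos_diff x φ z
  rw [hz, map_zero] at h1 h2
  obtain ⟨u, hu, κ, hκ, h3, h4⟩ :=
    torsion x φ hα (toSym_mem z) (toKos_mem z) h1.symm h2.symm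
  refine ⟨coef u κ, ?_⟩
  rw [diff_apply, toSym_coef hu, toKos_coef _ hκ, h3, h4, ← map_smul, ← map_smul, coef_to]

section Degree

variable {Γ : Type*} [AddCommGroup Γ] {ℳ : Γ → AddSubgroup R} {ξ η τ : Γ}

/-- The degree of a generator. -/
def dg (ξ η τ : Γ) : Gen n m → Γ :=
  Sum.elim (fun t => wt (ξ - τ) (η - τ) t.1.2 + ((n : ℤ) - 1) • τ)
    (fun t => t.1.2.toRight.card • (ξ + η - τ))

lemma diff_hom (hx : ∀ i d r, r ∈ ℳ d → x i * r ∈ ℳ (d + ξ))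
    (hφ : ∀ i g d r, r ∈ ℳ d → φ i g * r ∈ ℳ (d + η)) (d : Γ) (z : Gen n m → R)
    (hz : ∀ g, z g ∈ ℳ (d - dg ξ η τ g)) (g) : diff x φ z g ∈ ℳ (d + τ - dg ξ η τ g) := by
  have h1 : InH ℳ (wt (ξ - τ) (η - τ)) (d - ((n : ℤ) - 1) • τ) (toSym z) := by
    have h : InH ℳ (wt (ξ - τ) (η - τ)) (d - ((n : ℤ) - 1) • τ)
        (extend IsSym fun t => z (Sum.inl t)) := by
      intro a I
      by_cases h : IsSym (a, I)
      · rw [extend_apply (fun t => z (Sum.inl t)) ⟨(a, I), h⟩]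
        have := hz (Sum.inl ⟨(a, I), h⟩)
        rw [dg, Sum.elim_inl] at this
        rwa [sub_sub, add_comm (((n : ℤ) - 1) • τ)]
      · rw [extend_apply_of_not _ _ _ h]; exact zero_mem _
    have := Hom.theta _ _ (Hom.hom0 _ _ h)
    rwa [add_neg_cancel_right] at this
  rcases g with t | t
  · have h2 := Hom.delta (τ := τ) hx hφ _ _ h1 t.1.1 t.1.2
    rw [dg, Sum.elim_inl]
    rwa [show d - ((n : ℤ) - 1) • τ + τ - wt (ξ - τ) (η - τ) t.1.2 =
      d + τ - (wt (ξ - τ) (η - τ) t.1.2 + ((n : ℤ) - 1) • τ) by abel] at h2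
  · rw [dg, Sum.elim_inr]
    refine add_mem ?_ ?_
    · have hn : n • τ = ((n : ℤ) - 1) • τ + τ := by
        rw [sub_smul, one_smul, natCast_zsmul]; abel
      have h : InH ℳ (wt (ξ - τ) (ξ - τ + η)) (d - ((n : ℤ) - 1) • τ + n • ξ)
          (prAll (fun _ => 0) (toSym z)) := by
        intro a I
        rw [prAll_zero_apply]
        split_ifs with ha
        · by_cases hl : lev a I = 0
          · have hb : I.toRight.card = n := by
              simp [lev, lw, ha] at hl; omega
            have := h1 a I
            rw [wt, hb] at this ⊢
            convert this using 2
            simp only [nsmul_add, nsmul_sub]; abel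
          · rw [(toSym_mem z).2 a I (Or.inl hl)]; exact zero_mem _
        · exact zero_mem _
      have h2 := Hom.Q hφ _ _ h t.1.1 t.1.2
      rw [wt, toLeft_card_eq.2 t.2.2.2] at h2
      rw [mu, Op.mul_apply]
      convert h2 using 2
      rw [add_comm ξ η, show ξ - τ + η = η + ξ - τ by abel, nsmul_sub ξ τ n, hn]; abel
    · have h : InH ℳ (wt 0 (ξ + η - τ)) d (toKos z) := by
        intro a I
        by_cases h : IsKos (a, I)
        · rw [toKos_apply, extend_apply (fun t => z (Sum.inr t)) ⟨(a, I), h⟩]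
          have := hz (Sum.inr ⟨(a, I), h⟩)
          rw [dg, Sum.elim_inr] at this
          rwa [wt, smul_zero, zero_add]
        · rw [toKos_apply, extend_apply_of_not _ _ _ h]; exact zero_mem _
      have h2 := Hom.dz hx hφ _ _ h t.1.1 t.1.2
      rwa [wt, smul_zero, zero_add] at h2

end Degree

end Complex

section Count

variable {n m : ℕ}

lemma targetL_iff (a : Fin n → ℕ) (I : Finset (Ferm n m)) (l : List (Fin n))
    (hl : l.Pairwise (· < ·)) : TargetL a I l ↔
      ∃ i ∈ l, Sum.inl i ∉ I ∧ ∀ k ∈ l, k < i → Sum.inl k ∈ I ∧ a k = 0 := by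
  induction l with
  | nil => simp [TargetL]
  | cons i l ih =>
    rw [List.pairwise_cons] at hl
    rw [TargetL, ih hl.2]
    constructor
    · rintro (h | ⟨h, h0, j, hj, hj', h'⟩)
      · refine ⟨i, by simp, h, fun k hk hki => ?_⟩
        rcases List.mem_cons.1 hk with rfl | hk
        · exact absurd hki (lt_irrefl _)
        · exact absurd (hki.trans (hl.1 k hk)) (lt_irrefl _)
      · refine ⟨j, by simp [hj], hj', fun k hk hki => ?_⟩
        rcases List.mem_cons.1 hk with rfl | hk
        · exact ⟨h, h0⟩
        · exact h' k hk hki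
    · rintro ⟨j, hj, hj', h'⟩
      rcases List.mem_cons.1 hj with rfl | hj
      · exact Or.inl hj'
      · obtain ⟨h1, h2⟩ := h' i (by simp) (hl.1 j hj)
        exact Or.inr ⟨h1, h2, j, hj, hj', fun k hk => h' k (by simp [hk])⟩

lemma target_iff (a : Fin n → ℕ) (I : Finset (Ferm n m)) : Target a I ↔
    ∃ i, i ∉ I.toLeft ∧ ∀ k < i, k ∈ I.toLeft ∧ a k = 0 := by
  rw [Target, targetL_iff _ _ _ (List.pairwise_lt_finRange n)]
  simp

open Classical in
/-- The pairs indexing generators of the symmetric strand, without the second exterior part. -/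
def targets (n e j : ℕ) : Finset ((Fin n → ℕ) × Finset (Fin n)) :=
  (Finset.piAntidiag Finset.univ e ×ˢ Finset.powersetCard j Finset.univ).filter
    fun t => ∃ i, i ∉ t.2 ∧ ∀ k < i, k ∈ t.2 ∧ t.1 k = 0

lemma mem_targets {e j : ℕ} {t : (Fin n → ℕ) × Finset (Fin n)} : t ∈ targets n e j ↔
    (∑ i, t.1 i = e ∧ t.2.card = j) ∧ ∃ i, i ∉ t.2 ∧ ∀ k < i, k ∈ t.2 ∧ t.1 k = 0 := by
  simp [targets, Finset.mem_piAntidiag, Finset.mem_powersetCard]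

lemma card_piAntidiag_fin (n e : ℕ) :
    (Finset.piAntidiag (Finset.univ : Finset (Fin (n + 1))) e).card = (n + e).choose e := by
  have h := Finset.card_finsuppAntidiag_nat_eq_choose (s := (Finset.univ : Finset (Fin (n + 1)))) e
  rw [Finset.finsuppAntidiag, Finset.card_map, Finset.card_attach, Finset.card_univ,
    Fintype.card_fin] at h
  rw [h, show n + 1 + e - 1 = n + e by omega]

lemma exists_target_succ (a : Fin (n + 1) → ℕ) (L : Finset (Fin (n + 1))) :
    (∃ i, i ∉ L ∧ ∀ k < i, k ∈ L ∧ a k = 0) ↔ 0 ∉ L ∨ (0 ∈ L ∧ a 0 = 0 ∧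
      ∃ i : Fin n, i.succ ∉ L ∧ ∀ k < i, k.succ ∈ L ∧ a k.succ = 0) := by
  constructor
  · rintro ⟨i, hi, h⟩
    induction i using Fin.cases with
    | zero => exact Or.inl hi
    | succ i =>
      obtain ⟨h1, h2⟩ := h 0 (Fin.succ_pos i)
      exact Or.inr ⟨h1, h2, i, hi, fun k hk => h _ (Fin.succ_lt_succ_iff.2 hk)⟩
  · rintro (h | ⟨h1, h2, i, hi, h⟩)
    · exact ⟨0, h, fun k hk => absurd hk (Fin.not_lt_zero k)⟩
    · refine ⟨i.succ, hi, fun k hk => ?_⟩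
      induction k using Fin.cases with
      | zero => exact ⟨h1, h2⟩
      | succ k => exact h k (Fin.succ_lt_succ_iff.1 hk)

lemma card_filter_zero_notMem (n e j : ℕ) :
    ((targets (n + 1) e j).filter fun t => 0 ∉ t.2).card = (n + e).choose e * n.choose j := by
  have : (targets (n + 1) e j).filter (fun t => 0 ∉ t.2) =
      Finset.piAntidiag Finset.univ e ×ˢ
        Finset.powersetCard j (Finset.univ.erase (0 : Fin (n + 1))) := by
    ext ⟨a, L⟩
    simp only [Finset.mem_filter, mem_targets, exists_target_succ, Finset.mem_product,
      Finset.mem_piAntidiag, Finset.mem_powersetCard, Finset.subset_erase, Finset.subset_univ,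
      Finset.mem_univ, implies_true, and_true, true_and]
    tauto
  rw [this, Finset.card_product, card_piAntidiag_fin, Finset.card_powersetCard,
    Finset.card_erase_of_mem (Finset.mem_univ _)]
  simp

lemma card_filter_zero_mem (n e j : ℕ) :
    ((targets (n + 1) e (j + 1)).filter fun t => 0 ∈ t.2).card = (targets n e j).card := by
  symm
  refine Finset.card_nbij' (fun t => (Fin.cons 0 t.1, insert 0 (t.2.map (Fin.succEmb n))))
    (fun t => (fun i => t.1 i.succ, Finset.univ.filter fun i => i.succ ∈ t.2)) ?_ ?_ ?_ ?_
  · rintro ⟨a, L⟩ h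
    rw [Finset.mem_coe, mem_targets] at h
    obtain ⟨⟨h1, h2⟩, h3⟩ := h
    rw [Finset.mem_coe, Finset.mem_filter, mem_targets, exists_target_succ]
    refine ⟨⟨⟨?_, ?_⟩, Or.inr ⟨by simp, by simp, ?_⟩⟩, by simp⟩
    · simpa [Fin.sum_univ_succ] using h1
    · rw [Finset.card_insert_of_notMem (by simp), Finset.card_map, h2]
    · simpa [Fin.succ_ne_zero] using h3
  · rintro ⟨a, L⟩ h
    rw [Finset.mem_coe, Finset.mem_filter, mem_targets, exists_target_succ] at h
    obtain ⟨⟨⟨h1, h2⟩, h3⟩, h4⟩ := h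
    simp only at h1 h2 h3 h4
    rcases h3 with h3 | ⟨-, h3, h5⟩
    · exact absurd h4 h3
    rw [Finset.mem_coe, mem_targets]
    refine ⟨⟨?_, ?_⟩, by simpa using h5⟩
    · rw [← h1, Fin.sum_univ_succ, h3, zero_add]
    · have : L = insert 0 ((Finset.univ.filter fun i : Fin n => i.succ ∈ L).map
          (Fin.succEmb n)) := by
        ext i
        induction i using Fin.cases <;> simp [h4, Fin.succ_ne_zero]
      rw [this, Finset.card_insert_of_notMem (by simp), Finset.card_map] at h2
      simpa using h2
  · rintro ⟨a, L⟩ -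
    ext i <;> simp [Fin.succ_ne_zero]
  · rintro ⟨a, L⟩ h
    rw [Finset.mem_coe, Finset.mem_filter, mem_targets, exists_target_succ] at h
    obtain ⟨⟨⟨h1, h2⟩, h3⟩, h4⟩ := h
    simp only at h1 h2 h3 h4
    rcases h3 with h3 | ⟨-, h3, h5⟩
    · exact absurd h4 h3
    ext i
    · induction i using Fin.cases <;> simp [h3]
    · induction i using Fin.cases <;> simp [h4, Fin.succ_ne_zero]

lemma card_targets (n e j : ℕ) : (targets n e j).card =
    if j < n then (n + e - j - 1).choose e * (n + e).choose j else 0 := by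
  induction n generalizing j with
  | zero =>
    rw [if_neg (by omega), Finset.card_eq_zero]
    refine Finset.eq_empty_of_forall_notMem fun t ht => ?_
    obtain ⟨-, i, -⟩ := mem_targets.1 ht
    exact i.elim0
  | succ n ih =>
    have hsplit := Finset.card_filter_add_card_filter_not (s := targets (n + 1) e j)
      (fun t => 0 ∉ t.2)
    rw [card_filter_zero_notMem] at hsplit
    simp only [not_not] at hsplit
    have key : ∀ j ≤ n, (n + e - j).choose e * (n + e).choose j =
        (n + e).choose e * n.choose j := by
      intro j hj
      have h := Nat.choose_mul (n := n + e) (k := n) (s := j) hj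
      rw [← Nat.choose_symm_of_eq_add (n := n + e) (a := e) (b := n) (by omega)] at h
      rw [h, mul_comm, Nat.choose_symm_of_eq_add (n := n + e - j) (a := e) (b := n - j) (by omega)]
    rw [← hsplit]
    cases j with
    | zero =>
      have h0 : (targets (n + 1) e 0).filter (fun t => 0 ∈ t.2) = ∅ := by
        refine Finset.filter_eq_empty_iff.2 fun t ht h => ?_
        have := (mem_targets.1 ht).1.2
        rw [Finset.card_eq_zero] at this
        simp [this] at h
      rw [h0, ← key 0 (by omega)]
      simp [show n + 1 + e - 1 = n + e by omega]
    | succ j =>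
      rw [card_filter_zero_mem, ih]
      by_cases hj : j < n
      · rw [if_pos hj, if_pos (by omega), ← key (j + 1) (by omega),
          show n + 1 + e - (j + 1) - 1 = n + e - (j + 1) by omega,
          show n + e - j - 1 = n + e - (j + 1) by omega, ← mul_add,
          show n + 1 + e = n + e + 1 by omega, Nat.choose_succ_succ (n + e) j,
          add_comm ((n + e).choose j)]
      · rw [if_neg hj, if_neg (by omega), Nat.choose_eq_zero_of_lt (n := n) (by omega), mul_zero]

lemma sum_add_of_lev {a : Fin n → ℕ} {I : Finset (Ferm n m)} (h : lev a I = 0) :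
    n + ∑ i, a i = I.toRight.card := by
  simp only [lev, lw] at h
  zify
  linarith

lemma isKos_iff {a : Fin n → ℕ} {I : Finset (Ferm n m)} :
    IsKos (a, I) ↔ a = 0 ∧ I.toLeft = Finset.univ ∧ I.toRight.card < n := by
  simp only [IsKos, IsCorner, Finset.eq_univ_iff_forall, Finset.mem_toLeft]
  constructor
  · rintro ⟨h, rfl, h'⟩
    refine ⟨rfl, h', ?_⟩
    simp only [lev, lw, Pi.zero_apply, Nat.cast_zero, Finset.sum_const_zero] at h
    zify
    linarith
  · rintro ⟨rfl, h', h⟩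
    refine ⟨?_, rfl, h'⟩
    simp only [lev, lw, Pi.zero_apply, Nat.cast_zero, Finset.sum_const_zero]
    zify at h
    linarith

instance : Finite (Gen n m) := by
  have h : ∀ t : {t : (Fin n → ℕ) × Finset (Ferm n m) // IsSym t}, ∀ i, t.1.1 i < m + 1 := by
    rintro ⟨⟨a, I⟩, h1, -⟩ i
    have h2 := sum_add_of_lev h1
    have h3 := Finset.single_le_sum (f := a) (fun _ _ => Nat.zero_le _) (Finset.mem_univ i)
    have h4 := Finset.card_le_univ I.toRight
    rw [Fintype.card_fin] at h4
    simp only at h2 h3 ⊢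
    omega
  have : Finite {t : (Fin n → ℕ) × Finset (Ferm n m) // IsSym t} :=
    Finite.of_injective (β := (Fin n → Fin (m + 1)) × Finset (Ferm n m))
      (fun t => (fun i => ⟨t.1.1 i, h t i⟩, t.1.2)) fun s t hst => by
        simp only [Prod.mk.injEq, funext_iff, Fin.mk.injEq] at hst
        exact Subtype.ext (Prod.ext (funext hst.1) hst.2)
  have : Finite {t : (Fin n → ℕ) × Finset (Ferm n m) // IsKos t} :=
    Finite.of_injective (β := Finset (Ferm n m)) (fun t => t.1.2) fun s t hst =>
      Subtype.ext (Prod.ext ((isKos_iff.1 s.2).1.trans (isKos_iff.1 t.2).1.symm) hst)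
  infer_instance

/-- The homological degree of a generator. -/
def hd : Gen n m → ℤ := dg 0 0 (-1)

/-- The bidegree of a generator. -/
def gd : Gen n m → ℤ × ℤ := dg (1, 0) (0, 1) 0

lemma hd_inl (t) : hd (Sum.inl t : Gen n m) = t.1.2.toLeft.card + t.1.2.toRight.card - n + 1 := by
  simp [hd, dg, wt]; ring

lemma hd_inr (t) : hd (Sum.inr t : Gen n m) = t.1.2.toRight.card := by
  simp [hd, dg]

lemma gd_inl (t) : gd (Sum.inl t : Gen n m) = (↑t.1.2.toLeft.card, ↑t.1.2.toRight.card) := by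
  simp [gd, dg, wt]

lemma gd_inr (t) : gd (Sum.inr t : Gen n m) = (↑t.1.2.toRight.card, ↑t.1.2.toRight.card) := by
  simp [gd, dg]

lemma toLeft_card_lt {a : Fin n → ℕ} {I : Finset (Ferm n m)} (h : Target a I) :
    I.toLeft.card < n := by
  obtain ⟨i, hi, -⟩ := (target_iff a I).1 h
  have := Finset.card_lt_univ_of_notMem hi
  rwa [Fintype.card_fin] at this

/-- The generators of the Koszul strand in a given degree. -/
def kosEquiv (i : ℕ) (hi : i < n) :
    {g : Gen n m // hd g = i ∧ gd g = (↑i, ↑i)} ≃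
      Finset.powersetCard i (Finset.univ : Finset (Fin m)) := by
  have hB : ∀ B : Finset.powersetCard i (Finset.univ : Finset (Fin m)), B.1.card = i :=
    fun B => (Finset.mem_powersetCard.1 B.2).2
  have hk : ∀ B : Finset.powersetCard i (Finset.univ : Finset (Fin m)),
      IsKos ((0 : Fin n → ℕ), Finset.univ.disjSum B.1) :=
    fun B => isKos_iff.2 ⟨rfl, by simp, by simpa [hB] using hi⟩
  let f : Finset.powersetCard i (Finset.univ : Finset (Fin m)) →
      {g : Gen n m // hd g = i ∧ gd g = (↑i, ↑i)} :=
    fun B => ⟨Sum.inr ⟨_, hk B⟩, by simp [hd_inr, hB], by simp [gd_inr, hB]⟩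
  refine (Equiv.ofBijective f ⟨fun B B' h => ?_, ?_⟩).symm
  · simp only [f, Subtype.mk.injEq, Sum.inr.injEq, Prod.mk.injEq, Finset.disjSum_inj,
      true_and] at h
    exact Subtype.ext h
  · rintro ⟨⟨⟨a, I⟩, h1, h2⟩ | ⟨⟨a, I⟩, h⟩, h3, h4⟩
    · have := sum_add_of_lev h1
      rw [gd_inl, Prod.mk.injEq, Nat.cast_inj, Nat.cast_inj] at h4
      simp only at h4 this
      omega
    · obtain ⟨rfl, h5, h6⟩ := isKos_iff.1 h
      rw [hd_inr, Nat.cast_inj] at h3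
      refine ⟨⟨I.toRight, Finset.mem_powersetCard.2 ⟨Finset.subset_univ _, h3⟩⟩, ?_⟩
      simp only [f, ← h5, Finset.toLeft_disjSum_toRight]

/-- The generators of the symmetric strand in a given degree. -/
def symEquiv (e j : ℕ) :
    {g : Gen n m // hd g = (j + e + 1 : ℕ) ∧ gd g = (↑j, ↑(n + e))} ≃
      ↥(targets n e j ×ˢ Finset.powersetCard (n + e) (Finset.univ : Finset (Fin m))) := by
  have hB : ∀ B : ↥(targets n e j ×ˢ Finset.powersetCard (n + e) (Finset.univ : Finset (Fin m))),
      ((∑ i, B.1.1.1 i = e ∧ B.1.1.2.card = j) ∧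
        ∃ i, i ∉ B.1.1.2 ∧ ∀ k < i, k ∈ B.1.1.2 ∧ B.1.1.1 k = 0) ∧ B.1.2.card = n + e :=
    fun B => by
      have h := B.2
      rw [Finset.mem_product, mem_targets, Finset.mem_powersetCard] at h
      exact ⟨h.1, h.2.2⟩
  have hk : ∀ B : ↥(targets n e j ×ˢ Finset.powersetCard (n + e) (Finset.univ : Finset (Fin m))),
      IsSym (B.1.1.1, B.1.1.2.disjSum B.1.2) := fun B => by
    refine ⟨?_, (target_iff _ _).2 (by simpa using (hB B).1.2)⟩
    simp only [lev, lw, Finset.toRight_disjSum, (hB B).2, ← (hB B).1.1.1]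
    push_cast
    ring
  let f : ↥(targets n e j ×ˢ Finset.powersetCard (n + e) (Finset.univ : Finset (Fin m))) →
      {g : Gen n m // hd g = (j + e + 1 : ℕ) ∧ gd g = (↑j, ↑(n + e))} :=
    fun B => ⟨Sum.inl ⟨_, hk B⟩, by
      simp only [hd_inl, Finset.toLeft_disjSum, Finset.toRight_disjSum, (hB B).2, (hB B).1.1.2]
      push_cast
      ring, by
      simp only [gd_inl, Finset.toLeft_disjSum, Finset.toRight_disjSum, (hB B).2, (hB B).1.1.2]⟩
  refine (Equiv.ofBijective f ⟨?_, ?_⟩).symm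
  · rintro ⟨⟨⟨a, L⟩, B⟩, hB⟩ ⟨⟨⟨a', L'⟩, B'⟩, hB'⟩ h
    simp only [f, Subtype.mk.injEq, Sum.inl.injEq, Prod.mk.injEq, Finset.disjSum_inj] at h ⊢
    tauto
  · rintro ⟨⟨⟨a, I⟩, h1, h2⟩ | ⟨⟨a, I⟩, h⟩, h3, h4⟩
    · have h5 := sum_add_of_lev h1
      have h6 := (target_iff _ _).1 h2
      rw [gd_inl, Prod.mk.injEq, Nat.cast_inj, Nat.cast_inj] at h4
      simp only at h4 h5 h6
      refine ⟨⟨((a, I.toLeft), I.toRight), Finset.mem_product.2 ⟨mem_targets.2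
        ⟨⟨?_, h4.1⟩, h6⟩, Finset.mem_powersetCard.2 ⟨Finset.subset_univ _, h4.2⟩⟩⟩, ?_⟩
      · simp only
        omega
      · simp only [f, Finset.toLeft_disjSum_toRight]
    · obtain ⟨rfl, h5, h6⟩ := isKos_iff.1 h
      rw [gd_inr, Prod.mk.injEq, Nat.cast_inj, Nat.cast_inj] at h4
      simp only at h4
      omega

end Count

section Betti

variable {n m : ℕ}

lemma nonempty_equiv_fin (hn : 0 < n) (hnm : n ≤ m) (i : ℕ) (d : ℤ × ℤ) :
    Nonempty ({g : Gen n m // hd g = i ∧ gd g = d} ≃ Fin (bettiFormula n m i d)) := by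
  by_cases h1 : i ≤ n - 1 ∧ d.1 = (i : ℤ) ∧ d.2 = (i : ℤ)
  · rw [bettiFormula, if_pos h1]
    obtain ⟨h, h'⟩ := h1
    obtain rfl : d = (↑i, ↑i) := Prod.ext h'.1 h'.2
    exact ⟨(kosEquiv i (by omega)).trans (Finset.equivFinOfCardEq (by simp))⟩
  rw [bettiFormula, if_neg h1]
  by_cases h2 : ∃ e j : ℕ, i = j + e + 1 ∧ d = (↑j, ↑(n + e))
  · obtain ⟨e, j, rfl, rfl⟩ := h2
    refine ⟨(symEquiv e j).trans (Finset.equivFinOfCardEq ?_)⟩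
    rw [Finset.card_product, card_targets, Finset.card_powersetCard, Finset.card_univ,
      Fintype.card_fin]
    split_ifs with h3 h4 h4
    · rw [rMult, Int.toNat_natCast, show n + (j + e + 1) - 2 * j - 2 = n + e - j - 1 by omega,
        show j + e + 1 - 1 - j = e by omega, show n + (j + e + 1) - 1 - j = n + e by omega]
    · have : m < n + e := by
        by_contra h5
        exact h4 (by simp only; omega)
      rw [Nat.choose_eq_zero_of_lt this, mul_zero]
    · simp only at h4
      omega
    · simp
  · have he : IsEmpty {g : Gen n m // hd g = i ∧ gd g = d} := by
      refine ⟨?_⟩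
      rintro ⟨⟨⟨a, I⟩, h3, h4⟩ | ⟨⟨a, I⟩, h⟩, h5, h6⟩
      · have h7 := sum_add_of_lev h3
        rw [hd_inl] at h5
        rw [gd_inl] at h6
        simp only at h5 h6 h7
        refine h2 ⟨∑ i, a i, I.toLeft.card, by omega, ?_⟩
        rw [← h6, h7]
      · obtain ⟨-, -, h7⟩ := isKos_iff.1 h
        rw [hd_inr] at h5
        rw [gd_inr] at h6
        simp only at h5 h6
        refine h1 ⟨by omega, ?_⟩
        rw [← h6, h5]
        exact ⟨rfl, rfl⟩
    rw [if_neg]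
    · exact ⟨Equiv.equivOfIsEmpty _ _⟩
    · rintro ⟨h3, h4, h5, h6, h7⟩
      refine h2 ⟨i - 1 - d.1.toNat, d.1.toNat, ?_, Prod.ext ?_ ?_⟩
      · omega
      · simp only; omega
      · simp only; omega

/-- The index type of the free module in a given degree is in bijection with the generators. -/
lemma exists_equiv (hn : 0 < n) (hnm : n ≤ m) (i : ℕ) :
    ∃ e : RIdx (bettiFormula n m) i ≃ {g : Gen n m // hd g = i}, ∀ q, gd (e q).1 = q.1.1 := by
  have E := fun d => (nonempty_equiv_fin hn hnm i d).some
  refine ⟨⟨fun q => ⟨((E q.1.1).symm ⟨q.1.2, q.2⟩).1, ((E q.1.1).symm ⟨q.1.2, q.2⟩).2.1⟩,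
    fun g => ⟨(gd g.1, E (gd g.1) ⟨g.1, g.2, rfl⟩), (E (gd g.1) ⟨g.1, g.2, rfl⟩).2⟩, ?_, ?_⟩,
    fun q => ((E q.1.1).symm ⟨q.1.2, q.2⟩).2.2⟩
  · rintro ⟨⟨d, k⟩, hk⟩
    have key : ∀ s : {g : Gen n m // hd g = i ∧ gd g = d}, ∀ h,
        (⟨(gd s.1, E (gd s.1) ⟨s.1, h⟩), (E (gd s.1) ⟨s.1, h⟩).2⟩ : RIdx (bettiFormula n m) i) =
        ⟨(d, E d s), (E d s).2⟩ := by
      rintro ⟨g, h1, rfl⟩ h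
      rfl
    refine (key _ _).trans ?_
    simp
  · rintro ⟨g, hg⟩
    simp

end Betti

section DegreeOne

variable {R : Type*} [CommRing R] {n m : ℕ}

lemma prod_an_apply (f : Full R n m) (a) (l : List (Ferm n m)) (hl : l.Nodup) (J)
    (h : ∀ i ∈ l, i ∉ J) : ∃ s : R, s * s = 1 ∧
      (l.map an).prod f a J = s * f a (l.toFinset ∪ J) := by
  induction l generalizing J with
  | nil => exact ⟨1, by simp, by simp⟩
  | cons i l ih =>
    rw [List.nodup_cons] at hl
    obtain ⟨s, hs, h'⟩ := ih hl.2 (insert i J) fun k hk => by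
      rw [Finset.mem_insert, not_or]
      exact ⟨fun hki => hl.1 (hki ▸ hk), h k (by simp [hk])⟩
    refine ⟨sg R i J * s, by rw [mul_mul_mul_comm, sg_mul_self, hs, one_mul], ?_⟩
    rw [List.map_cons, List.prod_cons, Op.mul_apply, an_apply, if_neg (h i (by simp)), h',
      mul_assoc, List.toFinset_cons, Finset.union_insert, Finset.insert_union]

lemma prod_cr_apply (f : Full R n m) (a) (l : List (Ferm n m)) (hl : l.Nodup) (J)
    (h : ∀ i ∈ l, i ∈ J) : ∃ s : R, s * s = 1 ∧
      (l.map cr).prod f a J = s * f a (J \ l.toFinset) := by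
  induction l generalizing J with
  | nil => exact ⟨1, by simp, by simp⟩
  | cons i l ih =>
    rw [List.nodup_cons] at hl
    obtain ⟨s, hs, h'⟩ := ih hl.2 (J.erase i) fun k hk => by
      rw [Finset.mem_erase]
      exact ⟨fun hki => hl.1 (hki ▸ hk), h k (by simp [hk])⟩
    refine ⟨sg R i J * s, by rw [mul_mul_mul_comm, sg_mul_self, hs, one_mul], ?_⟩
    rw [List.map_cons, List.prod_cons, Op.mul_apply, cr_apply, if_pos (h i (by simp)), h',
      mul_assoc, List.toFinset_cons]
    congr 3
    ext k
    simp only [Finset.mem_sdiff, Finset.mem_erase, Finset.mem_insert]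
    tauto

variable (φ : Matrix (Fin n) (Fin m) R)

/-- The index sets on which the element is supported satisfy a predicate. -/
def Supp (P : Finset (Ferm n m) → Prop) (f : Full R n m) : Prop := ∀ a I, f a I ≠ 0 → P I

lemma Supp.add {P : Finset (Ferm n m) → Prop} {f g : Full R n m} (hf : Supp P f) (hg : Supp P g) :
    Supp P (f + g) := by
  intro a I h
  by_cases h1 : f a I = 0
  · by_cases h2 : g a I = 0
    · simp [h1, h2] at h
    · exact hg a I h2
  · exact hf a I h1

lemma Supp.sum {P : Finset (Ferm n m) → Prop} {κ : Type*} (s : Finset κ) {f : κ → Full R n m}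
    (hf : ∀ j ∈ s, Supp P (f j)) : Supp P (∑ j ∈ s, f j) := by
  intro a I h
  simp only [Finset.sum_apply] at h
  obtain ⟨j, hj, h'⟩ := Finset.exists_ne_zero_of_sum_ne_zero h
  exact hf j hj a I h'

lemma Supp.smul {P : Finset (Ferm n m) → Prop} (r : R) {f : Full R n m} (hf : Supp P f) :
    Supp P (r • f) := fun a I h => hf a I fun h' => h (by simp [h'])

lemma Supp.an {P P' : Finset (Ferm n m) → Prop} {i : Ferm n m}
    (h : ∀ I, i ∉ I → P (insert i I) → P' I) {f : Full R n m} (hf : Supp P f) :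
    Supp P' (an i f) := by
  intro a I h'
  rw [an_apply] at h'
  split_ifs at h' with hi
  · exact absurd rfl h'
  · exact h I hi (hf a _ fun h'' => h' (by rw [h'', mul_zero]))

lemma Supp.dphi {P P' : Finset (Ferm n m) → Prop} (i : Fin n)
    (h : ∀ g I, Sum.inr g ∉ I → P (insert (Sum.inr g) I) → P' I) {f : Full R n m} (hf : Supp P f) :
    Supp P' (dphi φ i f) := by
  rw [Residual.dphi, Op.sum_apply]
  exact Supp.sum _ fun g _ => Supp.smul _ (Supp.an (h g) hf)

/-- Products of the truncated operators are determinants. -/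
lemma prod_dphi_apply_eq_det (c : Fin n → Fin m) (f : Full R n m) (a J) :
    ((List.finRange n).map fun i => (∑ j, φ i (c j) • an (Sum.inr (c j)) : Op R n m)).prod f a J =
      (φ.submatrix id c).det *
        ((List.finRange n).map fun j => (an (Sum.inr (c j)) : Op R n m)).prod f a J := by
  let ι : (Fin n → R) →ₗ[R] Op R n m :=
    { toFun := fun w => ∑ j, w j • an (Sum.inr (c j))
      map_add' := fun v w => by simp [add_smul, Finset.sum_add_distrib]
      map_smul' := fun r w => by simp [mul_smul, Finset.smul_sum] }
  have hι : ∀ w, ι w * ι w = 0 := fun w => by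
    refine sq_sum _ _ (fun j => ?_) fun i j => ?_
    · rw [smul_mul_smul_comm, an_sq, smul_zero]
    · rw [acm_smul_left, acm_smul_right, acm_an_an, smul_zero, smul_zero]
  let ev : Op R n m →ₗ[R] R :=
    { toFun := fun A => A f a J
      map_add' := fun A B => rfl
      map_smul' := fun r A => rfl }
  let F : (Fin n → R) [⋀^Fin n]→ₗ[R] R :=
    (ev ∘ₗ (ExteriorAlgebra.lift R ⟨ι, hι⟩).toLinearMap).compAlternatingMap
      (ExteriorAlgebra.ιMulti R n)
  have hF : ∀ w, F w = ((List.finRange n).map fun i => ι (w i)).prod f a J := fun w => by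
    simp only [F, LinearMap.compAlternatingMap_apply, ExteriorAlgebra.ιMulti_apply,
      LinearMap.comp_apply, AlgHom.toLinearMap_apply, map_list_prod, List.map_ofFn]
    simp only [List.ofFn_eq_map, Function.comp_def, ExteriorAlgebra.lift_ι_apply]
    rfl
  have h := congrArg (fun G => G (fun i j => φ i (c j)))
    (F.eq_smul_basis_det (Pi.basisFun R (Fin n)))
  rw [AlternatingMap.smul_apply, Pi.basisFun_det_apply, hF, hF] at h
  rw [show (φ.submatrix id c).det = Matrix.det fun i j => φ i (c j) from rfl, mul_comm]
  have hb : ∀ j, ι (Pi.basisFun R (Fin n) j) = an (Sum.inr (c j)) := fun j => by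
    simp only [ι, LinearMap.coe_mk, AddHom.coe_mk, Pi.basisFun_apply]
    rw [Finset.sum_eq_single j (fun k _ hk => by simp [hk]) (by simp)]
    simp
  simp only [hb] at h
  exact h

lemma prod_dphi_congr (c : Fin n ↪ Fin m) {f : Full R n m}
    (hf : Supp (fun I => I.toRight ⊆ Finset.univ.map c) f) (l : List (Fin n)) :
    (l.map fun i => dphi φ i).prod f =
      (l.map fun i => (∑ j, φ i (c j) • an (Sum.inr (c j)) : Op R n m)).prod f ∧
    Supp (fun I => I.toRight ⊆ Finset.univ.map c) ((l.map fun i => dphi φ i).prod f) := by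
  induction l with
  | nil => exact ⟨rfl, hf⟩
  | cons i l ih =>
    simp only [List.map_cons, List.prod_cons, Op.mul_apply]
    rw [← ih.1]
    refine ⟨?_, Supp.dphi φ i (fun g I hg h => ?_) ih.2⟩
    · generalize ((l.map fun i => dphi φ i).prod : Op R n m) f = g at ih
      rw [dphi, Op.sum_apply, Op.sum_apply]
      rw [← Finset.sum_map Finset.univ c fun j => ((φ i j • an (Sum.inr j) : Op R n m) g)]
      symm
      refine Finset.sum_subset (Finset.subset_univ _) fun j _ hj => ?_
      ext a I
      rw [Op.smul_apply, Pi.smul_apply, Pi.smul_apply, an_apply]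
      split_ifs with h
      · simp
      · by_cases h0 : g a (insert (Sum.inr j) I) = 0
        · simp [h0]
        · exact absurd (ih.2 _ _ h0 (by simp)) hj
    · intro k hk
      exact h (by simp only [Finset.mem_toRight, Finset.mem_insert] at hk ⊢; exact Or.inr hk)

lemma prod_pw_congr {f : Full R n m} (hf : Supp (fun I => I.toLeft = ∅) f) (l : List (Fin n)) :
    (l.map fun i => pw φ i).prod f = (l.map fun i => dphi φ i).prod f ∧
    Supp (fun I => I.toLeft = ∅) ((l.map fun i => dphi φ i).prod f) := by
  induction l with
  | nil => exact ⟨rfl, hf⟩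
  | cons i l ih =>
    simp only [List.map_cons, List.prod_cons, Op.mul_apply]
    rw [ih.1]
    refine ⟨?_, Supp.dphi φ i (fun g I hg h => ?_) ih.2⟩
    · generalize ((l.map fun i => dphi φ i).prod : Op R n m) f = g at ih
      rw [pw, Op.add_apply, add_eq_right]
      ext a I
      rw [an_apply]
      split_ifs with h
      · rfl
      · by_cases h0 : g a (insert (Sum.inl i) I) = 0
        · simp [h0]
        · have : Finset.toLeft _ = ∅ := ih.2 _ _ h0
          rw [Finset.eq_empty_iff_forall_notMem] at this
          exact absurd (by simp) (this i)
    · rw [← h]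
      ext k
      simp

lemma supp_prod_pw {f : Full R n m} {N : ℕ} (hf : Supp (fun I => I.card = N) f)
    (l : List (Fin n)) :
    Supp (fun I => I.card + l.length = N) ((l.map fun i => pw φ i).prod f) := by
  induction l with
  | nil => exact hf
  | cons i l ih =>
    simp only [List.map_cons, List.prod_cons, Op.mul_apply]
    rw [pw, Op.add_apply]
    have key : ∀ (k : Ferm n m) (I : Finset (Ferm n m)), k ∉ I → (insert k I).card + l.length = N →
        I.card + (i :: l).length = N := by
      intro k I hk h
      rw [Finset.card_insert_of_notMem hk] at h
      rw [List.length_cons]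
      omega
    exact Supp.add (Supp.an (key _) ih) (Supp.dphi φ i (fun g => key _) ih)

open Classical in
/-- The basis vectors in symmetric degree zero. -/
def single (I : Finset (Ferm n m)) : Full R n m := fun a J => if a = 0 ∧ J = I then 1 else 0

lemma supp_single (I : Finset (Ferm n m)) : Supp (fun J => J = I) (single I : Full R n m) :=
  fun _ _ h => (ite_ne_right_iff.1 h).1.2

lemma Supp.mono {P P' : Finset (Ferm n m) → Prop} {f : Full R n m} (hf : Supp P f)
    (h : ∀ I, P I → P' I) : Supp P' f := fun a I h' => h I (hf a I h')

/-- The entry of `mu` at the corner with empty second exterior part, up to sign. -/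
def cornerEntry (I : Finset (Ferm n m)) : R :=
  ((List.finRange n).map fun i => pw φ i).prod (single I) 0 ∅

lemma cornerEntry_of_card_ne {I : Finset (Ferm n m)} (h : I.card ≠ n) :
    cornerEntry φ I = 0 := by
  by_contra h'
  have : (∅ : Finset (Ferm n m)).card + (List.finRange n).length = I.card :=
    supp_prod_pw φ (N := I.card) ((supp_single I).mono fun J hJ => by rw [hJ]) _ 0 ∅ h'
  rw [Finset.card_empty, List.length_finRange, zero_add] at this
  exact h this.symm

lemma cornerEntry_eq_det (c : Fin n ↪ Fin m) : ∃ s : R, s * s = 1 ∧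
    cornerEntry φ ((∅ : Finset (Fin n)).disjSum (Finset.univ.map c)) =
      s * (φ.submatrix id c).det := by
  have h1 := (prod_pw_congr φ (f := single ((∅ : Finset (Fin n)).disjSum (Finset.univ.map c)))
    ((supp_single _).mono fun J hJ => by rw [hJ, Finset.toLeft_disjSum]) (List.finRange n)).1
  have h2 := (prod_dphi_congr φ c
    (f := single ((∅ : Finset (Fin n)).disjSum (Finset.univ.map c)))
    ((supp_single _).mono fun J hJ => by rw [hJ, Finset.toRight_disjSum]) (List.finRange n)).1
  have hl : ((List.finRange n).map fun j => (Sum.inr (c j) : Ferm n m)).Nodup :=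
    (List.nodup_finRange n).map fun i j h => c.injective (Sum.inr_injective h)
  obtain ⟨s, hs, h3⟩ := prod_an_apply (R := R)
    (single ((∅ : Finset (Fin n)).disjSum (Finset.univ.map c))) 0 _ hl ∅ (by simp)
  refine ⟨s, hs, ?_⟩
  rw [cornerEntry, h1, h2, prod_dphi_apply_eq_det]
  rw [List.map_map] at h3
  rw [Function.comp_def] at h3
  rw [h3, mul_comm]
  have h4 : ((List.finRange n).map fun j => (Sum.inr (c j) : Ferm n m)).toFinset ∪ ∅ =
      (∅ : Finset (Fin n)).disjSum (Finset.univ.map c) := by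
    ext k
    simp [eq_comm]
  rw [h4, single, if_pos ⟨rfl, rfl⟩, mul_one]

lemma mu_apply_corner (u : Full R n m) : ∃ s : R, s * s = 1 ∧
    mu φ u 0 (Finset.univ.disjSum ∅) = s * ∑ I, u 0 I * cornerEntry φ I := by
  obtain ⟨k, hk⟩ := prod_mul_eq_sign (a := fun i => pw φ i) (c := fun i => cr (Sum.inl i))
    (List.nodup_finRange n) fun i j h => by rw [acm_pw_w, if_neg h]
  have hl : ((List.finRange n).map fun j => (Sum.inl j : Ferm n m)).Nodup :=
    (List.nodup_finRange n).map Sum.inl_injective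
  have hp : (prAll fun _ => 0 : Op R n m) u = ∑ I, u 0 I • single I := by
    ext a J
    rw [prAll_zero_apply, Finset.sum_apply, Finset.sum_apply]
    split_ifs with ha
    · simp [single, ha]
    · simp [single, ha]
  obtain ⟨s, hs, h3⟩ := prod_cr_apply (R := R)
    (((List.finRange n).map fun i => pw φ i).prod ((prAll fun _ => 0 : Op R n m) u)) 0 _ hl
    (Finset.univ.disjSum ∅) (by simp)
  have h4 : (Finset.univ : Finset (Fin n)).disjSum ∅ \
      ((List.finRange n).map fun j => (Sum.inl j : Ferm n m)).toFinset = ∅ := by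
    ext k
    simp
  rw [h4, List.map_map, Function.comp_def] at h3
  refine ⟨(-1) ^ k * s, by rw [mul_mul_mul_comm, hs, ← mul_pow]; simp, ?_⟩
  have h5 : ∀ (k : ℕ) (A : Op R n m) f a I, ((-1) ^ k * A) f a I = (-1) ^ k * A f a I := by
    intro k A f a I
    rcases Nat.even_or_odd k with h | h <;> simp [h.neg_one_pow]
  rw [mu, Op.mul_apply, Q, hk, h5, Op.mul_apply, h3, mul_assoc]
  congr 2
  rw [hp, map_sum, Finset.sum_apply, Finset.sum_apply]
  refine Finset.sum_congr rfl fun I _ => ?_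
  rw [map_smul]
  rfl

end DegreeOne

section Augmentation

variable {R : Type} [CommRing R] {n m : ℕ} (x : Fin n → R) (φ : Matrix (Fin n) (Fin m) R)

lemma toSym_apply_of_isSym (z : Gen n m → R) {t : (Fin n → ℕ) × Finset (Ferm n m)}
    (ht : IsSym t) : toSym z t.1 t.2 = z (Sum.inl ⟨t, ht⟩) :=
  congrFun (coef_to z) (Sum.inl ⟨t, ht⟩)

lemma toKos_apply_of_isKos (z : Gen n m → R) {t : (Fin n → ℕ) × Finset (Ferm n m)}
    (ht : IsKos t) : toKos z t.1 t.2 = z (Sum.inr ⟨t, ht⟩) :=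
  congrFun (coef_to z) (Sum.inr ⟨t, ht⟩)

lemma isKos_zero (hn : 0 < n) :
    IsKos ((0 : Fin n → ℕ), Finset.univ.disjSum (∅ : Finset (Fin m))) :=
  isKos_iff.2 ⟨rfl, Finset.toLeft_disjSum, by rwa [Finset.toRight_disjSum, Finset.card_empty]⟩

/-- The generator of degree zero. -/
def gzero (hn : 0 < n) : Gen n m := Sum.inr ⟨_, isKos_zero hn⟩

/-- The ideal resolved by the complex. -/
def augIdeal : Ideal R := Ideal.span (Set.range fun g => ∑ i, x i * φ i g) ⊔ minorsIdeal n φ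

lemma diff_gzero (hn : 0 < n) (z : Gen n m → R) : ∃ s : R, s * s = 1 ∧
    diff x φ z (gzero hn) = s * ∑ I, toSym z 0 I * cornerEntry φ I +
      ∑ g, (∑ i, x i * φ i g) * an (Sum.inr g) (toKos z) 0 (Finset.univ.disjSum ∅) := by
  obtain ⟨s, hs, h⟩ := mu_apply_corner φ (toSym z)
  refine ⟨s, hs, ?_⟩
  rw [← h, diff_apply, gzero, coef, Sum.elim_inr, Pi.add_apply, Pi.add_apply]
  congr 1
  simp only [dz, dphi, Op.sum_apply, Op.smul_apply, Finset.sum_apply, Pi.smul_apply, smul_eq_mul,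
    Finset.mul_sum, Finset.sum_mul]
  rw [Finset.sum_comm]
  exact Finset.sum_congr rfl fun g _ => Finset.sum_congr rfl fun i _ => by ring

lemma lev_zero_iff {I : Finset (Ferm n m)} : lev 0 I = 0 ↔ I.toRight.card = n := by
  simp only [lev, lw, Pi.zero_apply, Nat.cast_zero, Finset.sum_const_zero]
  constructor <;> intro h <;> zify at h ⊢ <;> linarith

lemma toLeft_eq_empty {I : Finset (Ferm n m)} (h : I.card = n) (h' : I.toRight.card = n) :
    I.toLeft = ∅ := by
  have := Finset.card_toLeft_add_card_toRight (u := I)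
  rw [← Finset.card_eq_zero]
  omega

lemma diff_gzero_mem (hn : 0 < n) (z : Gen n m → R) :
    diff x φ z (gzero hn) ∈ augIdeal x φ := by
  obtain ⟨s, -, h⟩ := diff_gzero x φ hn z
  rw [h]
  refine add_mem (Ideal.mul_mem_left _ _ (sum_mem fun I _ => ?_)) (sum_mem fun g _ =>
    Ideal.mul_mem_right _ _ (Ideal.mem_sup_left (Ideal.subset_span ⟨g, rfl⟩)))
  by_cases hI : I.card = n
  · by_cases hl : lev 0 I = 0
    · rw [lev_zero_iff] at hl
      have h1 := toLeft_eq_empty hI hl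
      let c : Fin n ↪ Fin m := (Finset.orderEmbOfFin I.toRight hl).toEmbedding
      obtain ⟨r, -, h2⟩ := cornerEntry_eq_det φ c
      have h3 : (∅ : Finset (Fin n)).disjSum (Finset.univ.map c) = I := by
        rw [Finset.map_orderEmbOfFin_univ, ← h1, Finset.toLeft_disjSum_toRight]
      rw [h3] at h2
      rw [h2]
      exact Ideal.mul_mem_left _ _ (Ideal.mul_mem_left _ _ (Ideal.mem_sup_right
        (Ideal.subset_span ⟨Function.Embedding.refl _, c, rfl⟩)))
    · rw [(toSym_mem z).2 0 I (Or.inl hl), zero_mul]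
      exact zero_mem _
  · rw [cornerEntry_of_card_ne φ hI, mul_zero]
    exact zero_mem _

/-- The ideal of values of the differential in degree zero. -/
def valIdeal (hn : 0 < n) : Ideal R :=
  LinearMap.range (LinearMap.proj (gzero hn) ∘ₗ diff x φ)

lemma det_mem_valIdeal (hn : 0 < n) (c : Fin n ↪ Fin m) :
    (φ.submatrix id c).det ∈ valIdeal x φ hn := by
  classical
  have ht : IsSym ((0 : Fin n → ℕ), (∅ : Finset (Fin n)).disjSum (Finset.univ.map c)) := by
    refine ⟨lev_zero_iff.2 ?_, (target_iff _ _).2 ⟨⟨0, hn⟩, ?_, fun k hk => ?_⟩⟩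
    · rw [Finset.toRight_disjSum, Finset.card_map, Finset.card_univ, Fintype.card_fin]
    · rw [Finset.toLeft_disjSum]
      exact Finset.notMem_empty _
    · exact absurd hk (by simp [Fin.lt_def])
  obtain ⟨s, hs, h⟩ := diff_gzero x φ hn (Pi.single (Sum.inl ⟨_, ht⟩) 1)
  obtain ⟨r, hr, h'⟩ := cornerEntry_eq_det φ c
  have hK : toKos (Pi.single (Sum.inl ⟨_, ht⟩) 1 : Gen n m → R) = 0 := by
    ext a I
    by_cases hk : IsKos (a, I)
    · rw [toKos_apply_of_isKos _ hk]
      exact Pi.single_eq_of_ne Sum.inr_ne_inl _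
    · exact toKos_mem _ a I hk
  rw [hK, Finset.sum_eq_single ((∅ : Finset (Fin n)).disjSum (Finset.univ.map c)), h',
    toSym_apply_of_isSym _ ht, Pi.single_eq_same, one_mul] at h
  · have : (φ.submatrix id c).det = (s * r) * diff x φ (Pi.single (Sum.inl ⟨_, ht⟩) 1)
        (gzero hn) := by
      rw [h]
      simp only [map_zero, Pi.zero_apply, mul_zero, Finset.sum_const_zero, add_zero]
      linear_combination (-(φ.submatrix id c).det * (r * r)) * hs - (φ.submatrix id c).det * hr
    rw [this]
    exact Ideal.mul_mem_left _ _ ⟨_, rfl⟩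
  · intro I _ hI
    by_cases h1 : I.card = n
    · by_cases h2 : lev 0 I = 0
      · have h3 := toLeft_eq_empty h1 (lev_zero_iff.1 h2)
        have ht' : IsSym ((0 : Fin n → ℕ), I) :=
          ⟨h2, (target_iff _ _).2 ⟨⟨0, hn⟩, by simp [h3], fun k hk =>
            absurd hk (by simp [Fin.lt_def])⟩⟩
        rw [toSym_apply_of_isSym _ ht', Pi.single_eq_of_ne, zero_mul]
        simpa using hI
      · rw [(toSym_mem _).2 0 I (Or.inl h2), zero_mul]
    · rw [cornerEntry_of_card_ne φ h1, mul_zero]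
  · simp

lemma sum_mem_valIdeal (hn : 0 < n) (g : Fin m) : ∑ i, x i * φ i g ∈ valIdeal x φ hn := by
  classical
  obtain rfl | hn1 : n = 1 ∨ 1 < n := by omega
  · have h := det_mem_valIdeal x φ hn ⟨fun _ => g, fun _ _ _ => Subsingleton.elim _ _⟩
    rw [Fin.sum_univ_one]
    refine Ideal.mul_mem_left _ _ ?_
    rw [Matrix.det_fin_one] at h
    exact h
  · have ht : IsKos ((0 : Fin n → ℕ), Finset.univ.disjSum ({g} : Finset (Fin m))) :=
      isKos_iff.2 ⟨rfl, Finset.toLeft_disjSum, by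
      rwa [Finset.toRight_disjSum, Finset.card_singleton]⟩
    obtain ⟨s, -, h⟩ := diff_gzero x φ hn (Pi.single (Sum.inr ⟨_, ht⟩) 1)
    have hS : toSym (Pi.single (Sum.inr ⟨_, ht⟩) 1 : Gen n m → R) = 0 := by
      have : (fun t => (Pi.single (Sum.inr ⟨_, ht⟩) 1 : Gen n m → R) (Sum.inl t)) = 0 := by
        ext t
        exact Pi.single_eq_of_ne Sum.inl_ne_inr _
      rw [toSym_apply, this, map_zero, map_zero, map_zero]
    have hi : ∀ k : Fin m, insert (Sum.inr k) ((Finset.univ : Finset (Fin n)).disjSum ∅) =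
        Finset.univ.disjSum {k} := fun k => by
      ext (j | j) <;> simp
    have hK : ∀ k, an (Sum.inr k) (toKos (Pi.single (Sum.inr ⟨_, ht⟩) 1 : Gen n m → R)) 0
        (Finset.univ.disjSum ∅) = if k = g then sg R (Sum.inr k)
          ((Finset.univ : Finset (Fin n)).disjSum ∅) else 0 := fun k => by
      have hk : IsKos ((0 : Fin n → ℕ), Finset.univ.disjSum ({k} : Finset (Fin m))) :=
        isKos_iff.2 ⟨rfl, Finset.toLeft_disjSum, by
      rwa [Finset.toRight_disjSum, Finset.card_singleton]⟩
      rw [an_apply, if_neg (by simp), hi, toKos_apply_of_isKos _ hk]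
      split_ifs with h
      · subst h
        rw [Pi.single_eq_same, mul_one]
      · rw [Pi.single_eq_of_ne, mul_zero]
        simpa using h
    simp only [hS, hK, Pi.zero_apply, zero_mul, Finset.sum_const_zero, mul_zero, zero_add, mul_ite,
      Finset.sum_ite_eq', Finset.mem_univ, if_true] at h
    have : ∑ i, x i * φ i g = sg R (Sum.inr g) ((Finset.univ : Finset (Fin n)).disjSum ∅) *
        diff x φ (Pi.single (Sum.inr ⟨_, ht⟩) 1) (gzero hn) := by
      rw [h, mul_comm, mul_assoc, sg_mul_self, mul_one]
    rw [this]
    exact Ideal.mul_mem_left _ _ ⟨_, rfl⟩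

lemma det_submatrix_eq_mul (r : Fin n ↪ Fin n) (c : Fin n ↪ Fin m) :
    ∃ s : R, (φ.submatrix r c).det = s * (φ.submatrix id c).det := by
  refine ⟨((Equiv.Perm.sign (Equiv.ofBijective r (Finite.injective_iff_bijective.1 r.injective)) :
    ℤˣ) : ℤ), ?_⟩
  rw [← Matrix.det_permute]
  rfl

lemma augIdeal_eq (hn : 0 < n) : augIdeal x φ = valIdeal x φ hn := by
  refine le_antisymm (sup_le (Ideal.span_le.2 ?_) (Ideal.span_le.2 ?_)) ?_
  · rintro _ ⟨g, rfl⟩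
    exact sum_mem_valIdeal x φ hn g
  · rintro _ ⟨r, c, rfl⟩
    obtain ⟨s, h⟩ := det_submatrix_eq_mul φ r c
    rw [h]
    exact Ideal.mul_mem_left _ _ (det_mem_valIdeal x φ hn c)
  · rintro _ ⟨z, rfl⟩
    exact diff_gzero_mem x φ hn z

/-- Multiplication by a power of an element of the ideal kills the homology. -/
lemma exists_diff_eq_pow_smul {α : R} (hα : α ∈ augIdeal x φ) {z : Gen n m → R}
    (hz : diff x φ z = 0) : ∃ N : ℕ, ∃ w, diff x φ w = α ^ N • z := by
  let T : Ideal R := (LinearMap.range (diff x φ)).colon {z}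
  have hT : ∀ r, r ∈ T ↔ ∃ w, diff x φ w = r • z := fun r => by
    rw [Submodule.mem_colon_singleton, LinearMap.mem_range]
  have h : augIdeal x φ ≤ T.radical := by
    refine sup_le (Ideal.span_le.2 ?_) (Ideal.span_le.2 ?_)
    · rintro _ ⟨g, rfl⟩
      exact Ideal.le_radical ((hT _).2 (diff_torsion x φ (contracts_z x φ g) hz))
    · rintro _ ⟨r, c, rfl⟩
      exact ⟨n, (hT _).2 (diff_torsion x φ (contracts_minor x φ r c) hz)⟩
  obtain ⟨N, hN⟩ := h hα
  exact ⟨N, (hT _).1 hN⟩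

end Augmentation

section Strand

variable {R : Type} [CommRing R] {n m : ℕ} {ι ι' : Type*}

/-- The inclusion of the part of homological degree `i`. -/
def strandIncl {i : ℕ} (e : ι ≃ {g : Gen n m // hd g = i}) : (ι →₀ R) →ₗ[R] (Gen n m → R) where
  toFun v g := if h : hd g = i then v (e.symm ⟨g, h⟩) else 0
  map_add' v w := by
    ext g
    simp only [Pi.add_apply, Finsupp.add_apply]
    split_ifs <;> simp
  map_smul' r v := by
    ext g
    simp only [Pi.smul_apply, Finsupp.smul_apply, RingHom.id_apply]
    split_ifs <;> simp

/-- The projection onto the part of homological degree `i`. -/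
def strandProj [Finite ι] {i : ℕ} (e : ι ≃ {g : Gen n m // hd g = i}) :
    (Gen n m → R) →ₗ[R] (ι →₀ R) where
  toFun z := Finsupp.equivFunOnFinite.symm fun q => z (e q)
  map_add' _ _ := Finsupp.ext fun _ => rfl
  map_smul' _ _ := Finsupp.ext fun _ => rfl

lemma strandIncl_apply {i : ℕ} (e : ι ≃ {g : Gen n m // hd g = i}) (v : ι →₀ R) (q : ι) :
    strandIncl e v (e q) = v q := by
  change (if h : hd (e q).1 = i then v (e.symm ⟨e q, h⟩) else 0) = v q
  rw [dif_pos (e q).2]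
  exact congrArg v (e.symm_apply_apply q)

lemma strandIncl_of_ne {i : ℕ} (e : ι ≃ {g : Gen n m // hd g = i}) (v : ι →₀ R) {g : Gen n m}
    (h : hd g ≠ i) : strandIncl e v g = 0 :=
  dif_neg h

lemma strandProj_apply [Finite ι] {i : ℕ} (e : ι ≃ {g : Gen n m // hd g = i}) (z : Gen n m → R)
    (q : ι) : strandProj e z q = z (e q) := by
  rfl

lemma strandProj_strandIncl [Finite ι] {i : ℕ} (e : ι ≃ {g : Gen n m // hd g = i}) (v : ι →₀ R) :
    strandProj e (strandIncl e v) = v := by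
  ext q
  rw [strandProj_apply, strandIncl_apply]

lemma strandIncl_strandProj [Finite ι] {i : ℕ} (e : ι ≃ {g : Gen n m // hd g = i})
    (z : Gen n m → R) {g : Gen n m} (h : hd g = i) : strandIncl e (strandProj e z) g = z g := by
  obtain ⟨q, hq⟩ := e.surjective ⟨g, h⟩
  rw [show g = e q by rw [hq], strandIncl_apply, strandProj_apply]

variable (x : Fin n → R) (φ : Matrix (Fin n) (Fin m) R)

open Classical in
lemma diff_eq_zero_of_hd (P : ℤ → Prop) {z : Gen n m → R} (hz : ∀ g, P (hd g) → z g = 0)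
    {g : Gen n m} (hg : P (hd g + 1)) : diff x φ z g = 0 := by
  let ℳ : ℤ → AddSubgroup R := fun d => if P (-d) then ⊥ else ⊤
  have hℳ : ∀ r d s, s ∈ ℳ d → r * s ∈ ℳ (d + 0) := fun r d s hs => by
    simp only [ℳ, add_zero] at hs ⊢
    split_ifs at hs ⊢
    · rw [AddSubgroup.mem_bot] at hs ⊢
      rw [hs, mul_zero]
    · trivial
  have h := diff_hom (ℳ := ℳ) (ξ := 0) (η := 0) (τ := -1) (x := x) (φ := φ)
    (fun i => hℳ (x i)) (fun i g => hℳ (φ i g)) 0 z (fun g => by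
      change z g ∈ ℳ (0 - hd g)
      simp only [ℳ, zero_sub, neg_neg]
      split_ifs with h
      · rw [AddSubgroup.mem_bot, hz g h]
      · trivial) g
  change diff x φ z g ∈ ℳ (0 + -1 - hd g) at h
  have h1 : -(0 + -1 - hd g) = hd g + 1 := by ring
  simpa only [ℳ, h1, if_pos hg, AddSubgroup.mem_bot] using h

/-- The differential between consecutive homological degrees. -/
def strandDiff [Finite ι] {i : ℕ} (e : ι ≃ {g : Gen n m // hd g = i})
    (e' : ι' ≃ {g : Gen n m // hd g = (i + 1 : ℕ)}) : (ι' →₀ R) →ₗ[R] (ι →₀ R) :=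
  strandProj e ∘ₗ diff x φ ∘ₗ strandIncl e'

lemma strandDiff_apply [Finite ι] {i : ℕ} (e : ι ≃ {g : Gen n m // hd g = i})
    (e' : ι' ≃ {g : Gen n m // hd g = (i + 1 : ℕ)}) (v : ι' →₀ R) :
    strandDiff x φ e e' v = strandProj e (diff x φ (strandIncl e' v)) := rfl

lemma strandIncl_strandDiff [Finite ι] {i : ℕ} (e : ι ≃ {g : Gen n m // hd g = i})
    (e' : ι' ≃ {g : Gen n m // hd g = (i + 1 : ℕ)}) (v : ι' →₀ R) :
    strandIncl e (strandDiff x φ e e' v) = diff x φ (strandIncl e' v) := by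
  ext g
  by_cases h : hd g = i
  · exact strandIncl_strandProj e _ h
  · rw [strandIncl_of_ne e _ h]
    refine (diff_eq_zero_of_hd x φ (fun j => j ≠ (i + 1 : ℕ))
      (fun g hg => strandIncl_of_ne e' v hg) ?_).symm
    push_cast
    simpa using h

lemma strandDiff_strandProj [Finite ι] [Finite ι'] {i : ℕ} (e : ι ≃ {g : Gen n m // hd g = i})
    (e' : ι' ≃ {g : Gen n m // hd g = (i + 1 : ℕ)}) (z : Gen n m → R) :
    strandDiff x φ e e' (strandProj e' z) = strandProj e (diff x φ z) := by
  rw [strandDiff_apply, ← sub_eq_zero, ← map_sub, ← map_sub]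
  ext q
  rw [strandProj_apply]
  refine diff_eq_zero_of_hd x φ (fun j => j = (i + 1 : ℕ)) (fun g hg => ?_) ?_
  · rw [Pi.sub_apply, strandIncl_strandProj e' z hg, sub_self]
  · push_cast
    rw [(e q).2]

lemma hd_gzero (hn : 0 < n) : hd (gzero hn : Gen n m) = (0 : ℕ) := by
  rw [gzero, hd_inr, Finset.toRight_disjSum, Finset.card_empty]

lemma hd_le (hnm : n ≤ m) (g : Gen n m) : hd g ≤ m := by
  rcases g with ⟨⟨a, I⟩, ht⟩ | ⟨⟨a, I⟩, ht⟩
  · rw [hd_inl]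
    have h1 : I.toLeft.card < n := toLeft_card_lt ht.2
    have h2 : I.toRight.card ≤ m := by simpa using Finset.card_le_univ I.toRight
    simp only
    omega
  · rw [hd_inr]
    have := (isKos_iff.1 ht).2.2
    simp only
    omega

lemma eq_gzero (hn : 0 < n) {g : Gen n m} (h : hd g = (0 : ℕ)) : g = gzero hn := by
  rcases g with ⟨⟨a, I⟩, ht⟩ | ⟨⟨a, I⟩, ht⟩
  · have h1 := sum_add_of_lev ht.1
    rw [hd_inl] at h
    simp only at h h1
    omega
  · rw [hd_inr] at h
    have h1 := isKos_iff.1 ht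
    simp only [gzero, Sum.inr.injEq, Subtype.mk.injEq, Prod.mk.injEq]
    refine ⟨h1.1, ?_⟩
    have h2 : I.toRight = ∅ := by
      rw [← Finset.card_eq_zero]
      exact_mod_cast h
    rw [← h1.2.1, ← h2, Finset.toLeft_disjSum_toRight]

variable {ι : ℕ → Type} [∀ i, Finite (ι i)] (e : ∀ i, ι i ≃ {g : Gen n m // hd g = i})

lemma range_strandDiff_zero (hn : 0 < n) (v : ι 0 →₀ R) :
    (∃ w, strandDiff x φ (e 0) (e 1) w = v) ↔
      v ((e 0).symm ⟨gzero hn, hd_gzero hn⟩) ∈ augIdeal x φ := by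
  have h0 : ∀ q, (e 0 q : Gen n m) = gzero hn := fun q => eq_gzero hn (e 0 q).2
  have hq : ∀ q, q = (e 0).symm ⟨gzero hn, hd_gzero hn⟩ := fun q => by
    rw [Equiv.eq_symm_apply]
    exact Subtype.ext (h0 q)
  rw [augIdeal_eq x φ hn]
  constructor
  · rintro ⟨w, rfl⟩
    refine ⟨strandIncl (e 1) w, ?_⟩
    rw [strandDiff_apply, strandProj_apply, Equiv.apply_symm_apply]
    rfl
  · rintro ⟨z, hz⟩
    refine ⟨strandProj (e 1) z, ?_⟩
    rw [strandDiff_strandProj]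
    ext q
    rw [strandProj_apply, hq q, ← hz, Equiv.apply_symm_apply]
    rfl

lemma exact_strandDiff (hn : 0 < n) (hnm : n ≤ m) {rs : List R} (hrs : ∀ r ∈ rs, r ∈ augIdeal x φ)
    (hlen : rs.length = m) (hreg : RingTheory.Sequence.IsWeaklyRegular R rs) (i : ℕ) :
    Function.Exact (strandDiff x φ (e (i + 1)) (e (i + 2))) (strandDiff x φ (e i) (e (i + 1))) := by
  have hd0 : ∀ i, strandDiff x φ (e i) (e (i + 1)) ∘ₗ strandDiff x φ (e (i + 1)) (e (i + 2)) = 0 :=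
    fun i => by
      ext1 q
      ext1
      simp only [LinearMap.comp_apply, LinearMap.zero_apply]
      rw [strandDiff_apply, strandIncl_strandDiff, diff_diff, map_zero]
  refine fun z => ⟨fun hz => ?_, ?_⟩
  · refine acyclic rs (fun i => ι i →₀ R) (fun i => strandDiff x φ (e i) (e (i + 1))) m hd0
      (fun i hi => ?_) (fun i => isWeaklyRegular_of_flat _ hreg) (fun a ha v => ?_)
      (fun a ha i z hz => ?_) i (by omega) z hz
    · have : IsEmpty (ι i) := ⟨fun q => by
        have h1 := hd_le hnm (e i q).1
        rw [(e i q).2] at h1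
        omega⟩
      infer_instance
    · refine ⟨1, (range_strandDiff_zero x φ e hn _).2 ?_⟩
      rw [pow_one, Finsupp.smul_apply, smul_eq_mul]
      exact Ideal.mul_mem_right _ _ (hrs a ha)
    · have h : diff x φ (strandIncl (e (i + 1)) z) = 0 := by
        rw [← strandIncl_strandDiff x φ (e i), hz, map_zero]
      obtain ⟨N, w, hw⟩ := exists_diff_eq_pow_smul x φ (hrs a ha) h
      refine ⟨N, strandProj (e (i + 2)) w, ?_⟩
      rw [strandDiff_strandProj, hw, map_smul, strandProj_strandIncl]
  · rintro ⟨w, rfl⟩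
    exact LinearMap.congr_fun (hd0 i) w

end Strand

section Main

variable {k : Type} [Field k] {n m p : ℕ}

lemma heightGE_of_le_idealHeight {R : Type} [CommRing R] {I : Ideal R} {m : ℕ}
    (h : (m : ℕ∞) ≤ idealHeight I) : HeightGE I m := fun P hP hI => by
  have h1 := h.trans (iInf₂_le (⟨P, hP⟩ : PrimeSpectrum R) hI)
  rwa [← PrimeSpectrum.height_eq_orderHeight] at h1

lemma mul_mem_piece {d e : ℤ × ℤ} {r s : PolyS k n p} (hr : r ∈ piece k n p e)
    (hs : s ∈ piece k n p d) : r * s ∈ piece k n p (d + e) := by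
  rw [add_comm]
  exact IsWeightedHomogeneous.mul hr hs

lemma diff_mem_piece {φ : Matrix (Fin n) (Fin m) (PolyS k n p)}
    (hφ : ∀ i j, φ i j ∈ piece k n p (0, 1)) {d : ℤ × ℤ} {z : Gen n m → PolyS k n p}
    (hz : ∀ g, z g ∈ piece k n p (d - gd g)) (g : Gen n m) :
    diff (fun i => X (Sum.inl i)) φ z g ∈ piece k n p (d - gd g) := by
  have h := diff_hom (ℳ := fun d => (piece k n p d).toAddSubgroup) (ξ := (1, 0)) (η := (0, 1))
    (τ := 0) (x := fun i => X (Sum.inl i)) (φ := φ)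
    (fun i d r hr => mul_mem_piece (isWeightedHomogeneous_X k (bideg n p) (Sum.inl i)) hr)
    (fun i g d r hr => mul_mem_piece (hφ i g) hr) d z hz g
  rwa [add_zero] at h

lemma gd_gzero (hn : 0 < n) : gd (gzero hn : Gen n m) = 0 := by
  rw [gzero, gd_inr, Finset.toRight_disjSum, Finset.card_empty]
  rfl

theorem isBigradedFreeRes (hn : 0 < n) (hnm : n ≤ m) (φ : Matrix (Fin n) (Fin m) (PolyS k n p))
    (hφ : ∀ i j, φ i j ∈ piece k n p (0, 1))
    (hhtJ : (m : ℕ∞) ≤ idealHeight (resJ k n m p φ)) :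
    IsBigradedFreeRes k n p (resJ k n m p φ) (bettiFormula n m) := by
  choose e he using exists_equiv (n := n) (m := m) hn hnm
  have : ∀ i, Finite (RIdx (bettiFormula n m) i) := fun i => Finite.of_equiv _ (e i).symm
  let x : Fin n → PolyS k n p := fun i => X (Sum.inl i)
  obtain ⟨rs, hlen, hrs, hreg⟩ := (heightGE_of_le_idealHeight hhtJ).hasSeq_of_fintype
  let q₀ := (e 0).symm ⟨gzero hn, hd_gzero hn⟩
  have hq₀ : q₀.1.1 = 0 := by
    rw [← he, Equiv.apply_symm_apply, gd_gzero]
  refine ⟨fun i => strandDiff x φ (e i) (e (i + 1)),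
    (Ideal.Quotient.mkₐ (PolyS k n p) (resJ k n m p φ)).toLinearMap ∘ₗ Finsupp.lapply q₀, ?_, ?_,
    fun i => exact_strandDiff x φ e hn hnm hrs hlen hreg i, fun i d v hv q => ?_, fun d v hv => ?_⟩
  · refine Ideal.Quotient.mk_surjective.comp fun r => ⟨Finsupp.single q₀ r, ?_⟩
    rw [Finsupp.lapply_apply, Finsupp.single_eq_same]
  · intro v
    refine Iff.trans ?_ (range_strandDiff_zero x φ e hn v).symm
    exact Ideal.Quotient.eq_zero_iff_mem
  · rw [strandDiff_apply, strandProj_apply, ← he]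
    refine diff_mem_piece hφ (fun g => ?_) _
    by_cases h : hd g = (i + 1 : ℕ)
    · obtain ⟨q', hq'⟩ := (e (i + 1)).surjective ⟨g, h⟩
      rw [show g = e (i + 1) q' by rw [hq'], strandIncl_apply, he]
      exact hv q'
    · rw [strandIncl_of_ne _ _ h]
      exact zero_mem _
  · have h := hv q₀
    rw [hq₀, sub_zero] at h
    exact ⟨v q₀, h, rfl⟩

end Main

end Residual

/-- Under the residual-intersection hypotheses, `S/J` admits a bigraded
free resolution `0 → P_m → ⋯ → P_n → Q_{n-1} ⊕ P_{n-1} → ⋯ → Q_1 ⊕ P_1 → Q_0 → S/J → 0`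
in which `Q_k = S(-k,-k)^{C(m,k)}` for `0 ≤ k ≤ n-1` and
`P_i = ⊕_j S(-j, -(n+i-1-j))^{r(i,j)}` for `1 ≤ i ≤ m`, the sum being over
`max{0, i-(m-n+1)} ≤ j ≤ min{i-1, n-1}`; the multiplicities of the free module in
homological degree `i` are recorded by `bettiFormula n m i`. -/
theorem stmt0
    (k : Type) [Field k] (n m p : ℕ)
    (hn : 0 < n) (hp : 0 < p) (hnm : n ≤ m)
    (φ : Matrix (Fin n) (Fin m) (PolyS k n p))
    (hφ : ∀ i j, φ i j ∈ piece k n p (0, 1))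
    (hgrade : gradeGE (minorsIdeal n φ) (m - n + 1))
    (hhtJ : (m : ℕ∞) ≤ idealHeight (resJ k n m p φ))
    (hgeom : geomResCond k n m p φ) :
    IsBigradedFreeRes k n p (resJ k n m p φ) (bettiFormula n m) := by
  exact Residual.isBigradedFreeRes hn hnm φ hφ hhtJ
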